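/- Let n ≥ 2, α ∈ ℝ, and let ℝⁿ₊ denote a homogeneous half-space of ℝⁿ (an open half-space whose boundary hyperplane contains the origin). Then μ_D(ℝⁿ₊;α) > μ_N(ℝⁿ₊;α) = min over integers k ≥ 1 of |γ_{n,α} + k(n−2+k)|². -/

import Mathlib

open MeasureTheory Metric Set Filter
open scoped RealInnerProductSpace

noncomputable section

/-- The Euclidean Laplacian of `u : ℝⁿ → ℝ` at a point. -/
def lap {n : ℕ} (u : EuclideanSpace ℝ (Fin n) → ℝ) (x : EuclideanSpace ℝ (Fin n)) : ℝ :=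
  ∑ i : Fin n, iteratedFDeriv ℝ 2 u x ![EuclideanSpace.single i 1, EuclideanSpace.single i 1]

/-- The Laplace–Beltrami operator on the unit sphere, computed via the
`0`-homogeneous extension: for a `0`-homogeneous function the Euclidean Laplacian
restricted to the unit sphere is exactly the Laplace–Beltrami operator. -/
def sphLap {n : ℕ} (φ : EuclideanSpace ℝ (Fin n) → ℝ) (σ : EuclideanSpace ℝ (Fin n)) : ℝ :=
  lap (fun x => φ (‖x‖⁻¹ • x)) σ

/-- Squared norm of the spherical gradient, via the `0`-homogeneous extension. -/
def sphGradNormSq {n : ℕ} (φ : EuclideanSpace ℝ (Fin n) → ℝ) (σ : EuclideanSpace ℝ (Fin n)) : ℝ :=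
  ‖fderiv ℝ (fun x => φ (‖x‖⁻¹ • x)) σ‖ ^ 2

/-- The open cone `C_Σ = {rσ : r > 0, σ ∈ Σ}` over a subset of the unit sphere. -/
def coneOf {n : ℕ} (S : Set (EuclideanSpace ℝ (Fin n))) : Set (EuclideanSpace ℝ (Fin n)) :=
  {x | x ≠ 0 ∧ ‖x‖⁻¹ • x ∈ S}

/-- The canonical surface measure `dσ` on the unit sphere of `ℝⁿ`, as a measure on `ℝⁿ`. -/
def sphMeasure (n : ℕ) : Measure (EuclideanSpace ℝ (Fin n)) :=
  Measure.map Subtype.val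
    ((volume : Measure (EuclideanSpace ℝ (Fin n))).toSphere)

/-- A (Dirichlet) eigenfunction of the Laplace–Beltrami operator on `S ⊆ 𝕊^{n-1}`
relative to the eigenvalue `lam`. -/
def IsEigenfun {n : ℕ} (S : Set (EuclideanSpace ℝ (Fin n))) (lam : ℝ)
    (φ : EuclideanSpace ℝ (Fin n) → ℝ) : Prop :=
  ContinuousOn (fun x => φ (‖x‖⁻¹ • x)) (coneOf (closure S)) ∧
  ContDiffOn ℝ 2 (fun x => φ (‖x‖⁻¹ • x)) (coneOf S) ∧
  (∀ σ ∈ closure S \ S, φ σ = 0) ∧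
  (∃ σ ∈ S, φ σ ≠ 0) ∧
  (∀ σ ∈ S, - sphLap φ σ = lam * φ σ)

/-- The Dirichlet spectrum `Λ(Σ)` of the Laplace–Beltrami operator on `S`. -/
def spec {n : ℕ} (S : Set (EuclideanSpace ℝ (Fin n))) : Set ℝ :=
  {lam | ∃ φ, IsEigenfun S lam φ}

/-- `S` is a domain in the unit sphere `𝕊^{n-1}`: a relatively open connected
nonempty subset. -/
def IsSphDomain {n : ℕ} (S : Set (EuclideanSpace ℝ (Fin n))) : Prop :=
  S ⊆ Metric.sphere (0 : EuclideanSpace ℝ (Fin n)) 1 ∧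
  IsOpen (Subtype.val ⁻¹' S : Set (Metric.sphere (0 : EuclideanSpace ℝ (Fin n)) 1)) ∧
  IsConnected S

/-- `S` is a domain of class `C²` in the unit sphere: a domain such that the cone
over it admits local `C²` defining functions away from the origin. -/
def IsC2SphDomain {n : ℕ} (S : Set (EuclideanSpace ℝ (Fin n))) : Prop :=
  IsSphDomain S ∧
  ∀ x ∈ frontier (coneOf S) \ {0}, ∃ (U : Set (EuclideanSpace ℝ (Fin n)))
    (f : EuclideanSpace ℝ (Fin n) → ℝ), IsOpen U ∧ x ∈ U ∧ ContDiff ℝ 2 f ∧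
    fderiv ℝ f x ≠ 0 ∧ coneOf S ∩ U = {y ∈ U | f y < 0}

/-- `γ_{n,α} = ((n-2)/2)² - ((α-2)/2)²`. -/
def gam (n : ℕ) (α : ℝ) : ℝ := (((n : ℝ) - 2) / 2) ^ 2 - ((α - 2) / 2) ^ 2

/-- `γ̄_{n,α} = ((n-2)/2)² + ((α-2)/2)²`. -/
def gbar (n : ℕ) (α : ℝ) : ℝ := (((n : ℝ) - 2) / 2) ^ 2 + ((α - 2) / 2) ^ 2

/-- The class `C²_c(Ω̄ ∖ {0})` of Navier test functions: `C²` up to the closure of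
`Ω`, vanishing on `∂Ω` and in a neighborhood of `0` and of `∞`. -/
def NavierAdm {n : ℕ} (Ω : Set (EuclideanSpace ℝ (Fin n)))
    (u : EuclideanSpace ℝ (Fin n) → ℝ) : Prop :=
  ContDiffOn ℝ 2 u (closure Ω) ∧
  (∀ x ∈ frontier Ω, u x = 0) ∧
  (∃ ε > 0, ∀ x : EuclideanSpace ℝ (Fin n), ‖x‖ < ε → u x = 0) ∧
  (∃ R : ℝ, ∀ x : EuclideanSpace ℝ (Fin n), R < ‖x‖ → u x = 0)

/-- The class `C²_c(Ω)` of Dirichlet test functions: globally `C²` with compact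
support contained in `Ω`. -/
def DirichletAdm {n : ℕ} (Ω : Set (EuclideanSpace ℝ (Fin n)))
    (u : EuclideanSpace ℝ (Fin n) → ℝ) : Prop :=
  ContDiff ℝ 2 u ∧ HasCompactSupport u ∧ tsupport u ⊆ Ω

/-- The best Rellich constant `μ_N(Ω;α)` under Navier boundary conditions. -/
def muN {n : ℕ} (Ω : Set (EuclideanSpace ℝ (Fin n))) (α : ℝ) : ℝ :=
  sInf {q : ℝ | ∃ u, NavierAdm Ω u ∧ (∃ x ∈ Ω, u x ≠ 0) ∧
    q = (∫ x in Ω, ‖x‖ ^ α * (lap u x) ^ 2) / (∫ x in Ω, ‖x‖ ^ (α - 4) * (u x) ^ 2)}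

/-- The best Rellich constant `μ_D(Ω;α)` under Dirichlet boundary conditions. -/
def muD {n : ℕ} (Ω : Set (EuclideanSpace ℝ (Fin n))) (α : ℝ) : ℝ :=
  sInf {q : ℝ | ∃ u, DirichletAdm Ω u ∧ (∃ x ∈ Ω, u x ≠ 0) ∧
    q = (∫ x in Ω, ‖x‖ ^ α * (lap u x) ^ 2) / (∫ x in Ω, ‖x‖ ^ (α - 4) * (u x) ^ 2)}

/-- The surrogate of `H² ∩ H¹₀(Σ)`: functions whose `0`-homogeneous extension is
`C²` up to the closure of the cone, vanishing on the relative boundary of `S`. -/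
def NavAdmS {n : ℕ} (S : Set (EuclideanSpace ℝ (Fin n)))
    (φ : EuclideanSpace ℝ (Fin n) → ℝ) : Prop :=
  ContDiffOn ℝ 2 (fun x => φ (‖x‖⁻¹ • x)) (coneOf (closure S)) ∧
  (∀ σ ∈ closure S \ S, φ σ = 0)

/-- The surrogate of `H²₀(Σ)`: as `NavAdmS`, with in addition vanishing gradient
on the relative boundary of `S`. -/
def DirAdmS {n : ℕ} (S : Set (EuclideanSpace ℝ (Fin n)))
    (φ : EuclideanSpace ℝ (Fin n) → ℝ) : Prop :=
  NavAdmS S φ ∧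
  ∀ σ ∈ closure S \ S,
    fderivWithin ℝ (fun x => φ (‖x‖⁻¹ • x)) (coneOf (closure S)) σ = 0

/-- The Rayleigh-type quotient `∫_Σ |Lφ|² dσ / ∫_Σ |φ|² dσ` with
`Lφ = -Δ_σ φ + γ φ`. -/
def sphQuot {n : ℕ} (S : Set (EuclideanSpace ℝ (Fin n))) (γ : ℝ)
    (φ : EuclideanSpace ℝ (Fin n) → ℝ) : ℝ :=
  (∫ σ in S, (- sphLap φ σ + γ * φ σ) ^ 2 ∂(sphMeasure n)) /
    (∫ σ in S, (φ σ) ^ 2 ∂(sphMeasure n))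

/-- Partial derivative `w_s` of a function on the cylinder `ℝ × 𝕊^{n-1}`. -/
def ws {n : ℕ} (w : ℝ × EuclideanSpace ℝ (Fin n) → ℝ)
    (p : ℝ × EuclideanSpace ℝ (Fin n)) : ℝ :=
  deriv (fun t => w (t, p.2)) p.1

/-- Second partial derivative `w_ss` of a function on the cylinder. -/
def wss {n : ℕ} (w : ℝ × EuclideanSpace ℝ (Fin n) → ℝ)
    (p : ℝ × EuclideanSpace ℝ (Fin n)) : ℝ :=
  deriv (fun t => ws w (t, p.2)) p.1

end

open MeasureTheory Metric Set Filter
open scoped RealInnerProductSpace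

section PolyAlg
open MvPolynomial

/-- complex polynomials in `n` variables -/
abbrev RPoly (n : ℕ) := MvPolynomial (Fin n) ℂ

/-- algebraic Laplacian -/
noncomputable def plap {n : ℕ} (p : RPoly n) : RPoly n := ∑ i, pderiv i (pderiv i p)

/-- the polynomial `|x|²` -/
noncomputable def prho (n : ℕ) : RPoly n := ∑ i, X i ^ 2

lemma prho_hom (n : ℕ) : (prho n).IsHomogeneous 2 := by
  unfold prho
  apply IsHomogeneous.sum
  intro i _
  simpa using (isHomogeneous_X ℂ i).pow 2

lemma plap_hom {n d : ℕ} {p : RPoly n} (hp : p.IsHomogeneous (d + 2)) : (plap p).IsHomogeneous d := by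
  unfold plap
  apply IsHomogeneous.sum
  intro i _
  simpa using (hp.pderiv (i := i)).pderiv (i := i)

lemma plap_eq_zero {n d : ℕ} {p : RPoly n} (hp : p.IsHomogeneous d) (hd : d < 2) : plap p = 0 := by
  unfold plap
  apply Finset.sum_eq_zero
  intro i _
  have h1 := hp.pderiv (i := i)
  have : d - 1 = 0 := by omega
  rw [this] at h1
  have h1 := totalDegree_eq_zero_iff_eq_C.1 (Nat.le_zero.1 h1.totalDegree_le)
  rw [h1, pderiv_C]

lemma plap_add {n : ℕ} (p q : RPoly n) : plap (p + q) = plap p + plap q := by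
  simp [plap, Finset.sum_add_distrib]

lemma plap_smul {n : ℕ} (c : ℂ) (q : RPoly n) : plap (c • q) = c • plap q := by
  simp [plap, Finset.smul_sum]

lemma plap_sub {n : ℕ} (p q : RPoly n) : plap (p - q) = plap p - plap q := by
  simp [plap, Finset.sum_sub_distrib]

lemma plap_rho_mul {n e : ℕ} {s : RPoly n} (hs : s.IsHomogeneous e) :
    plap (prho n * s) = (2 * (n : ℂ) + 4 * e) • s + prho n * plap s := by
  have h1 : ∀ i, pderiv i (prho n) = 2 * X i := by
    intro i
    simp only [prho, map_sum, pderiv_pow, pderiv_X]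
    rw [Finset.sum_eq_single i] <;> simp +contextual
  have h2 : ∀ i, pderiv i (pderiv i (prho n * s)) =
      2 * s + 4 * (X i * pderiv i s) + prho n * pderiv i (pderiv i s) := by
    intro i
    have h3 : pderiv i (2 * X i : RPoly n) = 2 := by
      rw [show (2 : RPoly n) = C 2 from (map_ofNat C 2).symm, pderiv_C_mul, pderiv_X_self, mul_one]
    rw [pderiv_mul, h1, map_add, pderiv_mul (f := 2 * X i), h3, pderiv_mul (f := prho n), h1]; ring
  have he := hs.sum_X_mul_pderiv
  unfold plap
  simp_rw [h2, Finset.sum_add_distrib, ← Finset.mul_sum, he]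
  simp only [Finset.sum_const, Finset.card_univ, Fintype.card_fin, nsmul_eq_mul, smul_eq_C_mul]
  simp only [map_add, map_mul, map_ofNat, map_natCast]
  ring

lemma plap_rho_pow {n d : ℕ} {r : RPoly n} (hr : r.IsHomogeneous d) (m : ℕ) :
    plap (prho n ^ (m + 1) * r) =
      (2 * ((m : ℂ) + 1) * (n + 2 * d + 2 * m)) • (prho n ^ m * r) + prho n ^ (m + 1) * plap r := by
  induction m with
  | zero =>
    rw [zero_add, pow_one, plap_rho_mul hr]
    simp only [pow_zero, one_mul]
    congr 2; push_cast; ring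
  | succ m ih =>
    have hs : (prho n ^ (m + 1) * r).IsHomogeneous (2 * (m + 1) + d) :=
      ((prho_hom n).pow (m + 1)).mul hr
    rw [pow_succ' (prho n) (m + 1), mul_assoc, plap_rho_mul hs, ih]
    simp only [smul_eq_C_mul]
    push_cast
    simp only [map_add, map_mul, map_ofNat, map_natCast, map_one]
    ring

lemma plap_solve {n : ℕ} (hn : 0 < n) : ∀ d : ℕ, ∀ q : RPoly n, q.IsHomogeneous d → ∀ m : ℕ,
    ∃ r : RPoly n, r.IsHomogeneous d ∧ plap (prho n ^ (m + 1) * r) = prho n ^ m * q := by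
  intro d
  induction d using Nat.strong_induction_on with
  | _ d ih =>
    intro q hq m
    set c : ℂ := 2 * ((m : ℂ) + 1) * (n + 2 * d + 2 * m) with hc
    have hc0 : c ≠ 0 := by
      have : c = ((2 * (m + 1) * (n + 2 * d + 2 * m) : ℕ) : ℂ) := by push_cast; rw [hc]
      rw [this]; exact_mod_cast (by positivity)
    have hq0 : (c⁻¹ • q).IsHomogeneous d := by
      rw [smul_eq_C_mul]; simpa using (isHomogeneous_C (Fin n) c⁻¹).mul hq
    have key : plap (prho n ^ (m + 1) * (c⁻¹ • q)) =
        prho n ^ m * q + prho n ^ (m + 1) * (c⁻¹ • plap q) := by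
      rw [plap_rho_pow hq0, plap_smul, ← hc, mul_smul_comm, smul_smul, mul_inv_cancel₀ hc0, one_smul]
    by_cases hd : d < 2
    · exact ⟨c⁻¹ • q, hq0, by rw [key, plap_eq_zero hq hd]; simp⟩
    · obtain ⟨e, rfl⟩ : ∃ e, d = e + 2 := ⟨d - 2, by omega⟩
      have h2 : (c⁻¹ • plap q).IsHomogeneous e := by
        rw [smul_eq_C_mul]; simpa using (isHomogeneous_C (Fin n) c⁻¹).mul (plap_hom hq)
      obtain ⟨r1, hr1, hr2⟩ := ih e (by omega) _ h2 (m + 1)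
      refine ⟨c⁻¹ • q - prho n * r1, hq0.sub ?_, ?_⟩
      · have := (prho_hom n).mul hr1
        rwa [add_comm] at this
      · rw [mul_sub, plap_sub, key, ← mul_assoc, ← pow_succ, hr2]
        ring

/-- evaluation at a real point -/
noncomputable def pev {n : ℕ} (p : RPoly n) (x : EuclideanSpace ℝ (Fin n)) : ℂ :=
  eval (fun i => ((x i : ℝ) : ℂ)) p

/-- restriction to the sphere decomposes into harmonics: decomposition of homogeneous polynomials. -/
lemma hom_decomp {n : ℕ} (hn : 0 < n) {d : ℕ} {p : RPoly n} (hp : p.IsHomogeneous (d + 2)) :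
    ∃ h q : RPoly n, h.IsHomogeneous (d + 2) ∧ plap h = 0 ∧ q.IsHomogeneous d ∧
      p = h + prho n * q := by
  obtain ⟨r, hr, hr2⟩ := plap_solve hn d _ (plap_hom hp) 0
  refine ⟨p - prho n * r, r, hp.sub ?_, ?_, hr, by ring⟩
  · have := (prho_hom n).mul hr
    rwa [add_comm] at this
  · rw [plap_sub]
    simp only [zero_add, pow_one, pow_zero, one_mul] at hr2
    rw [hr2, sub_self]

end PolyAlg

open MeasureTheory Metric Set Filter
open scoped RealInnerProductSpace

section Calc
open MvPolynomial InnerProductSpace Laplacian Topology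

lemma pev_hasFDerivAt {n : ℕ} (p : RPoly n) (x : EuclideanSpace ℝ (Fin n)) :
    HasFDerivAt (pev p) (∑ i, ((EuclideanSpace.proj i : EuclideanSpace ℝ (Fin n) →L[ℝ] ℝ)).smulRight
      (pev (pderiv i p) x)) x := by
  induction p using MvPolynomial.induction_on with
  | C a =>
    have : (pev (C a) : EuclideanSpace ℝ (Fin n) → ℂ) = fun _ => a := by ext; simp [pev]
    rw [this]
    simpa [pev] using hasFDerivAt_const a x
  | add p q hp hq =>
    have : (pev (p + q) : EuclideanSpace ℝ (Fin n) → ℂ) = fun y => pev p y + pev q y := by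
      ext; simp [pev]
    rw [this]
    refine (hp.add hq).congr_fderiv ?_
    ext v
    simp [pev, Finset.sum_add_distrib, mul_add]
  | mul_X p j hp =>
    have : (pev (p * X j) : EuclideanSpace ℝ (Fin n) → ℂ) = fun y => pev p y * ((y j : ℝ) : ℂ) := by
      ext; simp [pev]
    rw [this]
    have h2 : HasFDerivAt (fun y : EuclideanSpace ℝ (Fin n) => ((y j : ℝ) : ℂ))
        (Complex.ofRealCLM.comp (EuclideanSpace.proj j : EuclideanSpace ℝ (Fin n) →L[ℝ] ℝ)) x :=
      (Complex.ofRealCLM.comp (EuclideanSpace.proj j : EuclideanSpace ℝ (Fin n) →L[ℝ] ℝ)).hasFDerivAt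
    refine (hp.mul h2).congr_fderiv ?_
    ext v
    simp [pev, Finset.sum_add_distrib, mul_add, Finset.mul_sum, Pi.single_apply, apply_ite]
    congr 1
    · ring
    · apply Finset.sum_congr rfl; intros; ring

lemma pev_fderiv {n : ℕ} (p : RPoly n) (x : EuclideanSpace ℝ (Fin n)) (i : Fin n) :
    fderiv ℝ (pev p) x (EuclideanSpace.single i 1) = pev (pderiv i p) x := by
  rw [(pev_hasFDerivAt p x).fderiv]
  simp [Pi.single_apply]

lemma pev_contDiff {n : ℕ} (p : RPoly n) (k : ℕ) : ContDiff ℝ k (pev p) := by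
  induction p using MvPolynomial.induction_on with
  | C a =>
    have : (pev (C a) : EuclideanSpace ℝ (Fin n) → ℂ) = fun _ => a := by ext; simp [pev]
    rw [this]; exact contDiff_const
  | add p q hp hq =>
    have : (pev (p + q) : EuclideanSpace ℝ (Fin n) → ℂ) = fun y => pev p y + pev q y := by
      ext; simp [pev]
    rw [this]; exact hp.add hq
  | mul_X p j hp =>
    have : (pev (p * X j) : EuclideanSpace ℝ (Fin n) → ℂ) = fun y => pev p y * ((y j : ℝ) : ℂ) := by
      ext; simp [pev]
    rw [this]
    exact hp.mul (Complex.ofRealCLM.comp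
      (EuclideanSpace.proj j : EuclideanSpace ℝ (Fin n) →L[ℝ] ℝ)).contDiff

/-- Radial profile times polynomial. -/
noncomputable def Nf {n : ℕ} (f : ℝ → ℂ) (p : RPoly n) (x : EuclideanSpace ℝ (Fin n)) : ℂ :=
  f (Real.log ‖x‖) * pev p x

lemma lognorm_contDiffAt {n : ℕ} {x : EuclideanSpace ℝ (Fin n)} (hx : x ≠ 0) (k : ℕ) :
    ContDiffAt ℝ k (fun y : EuclideanSpace ℝ (Fin n) => Real.log ‖y‖) x :=
  (contDiffAt_norm ℝ hx).log (by simpa using hx)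

lemma lognorm_hasFDerivAt {n : ℕ} {x : EuclideanSpace ℝ (Fin n)} (hx : x ≠ 0) :
    HasFDerivAt (fun y : EuclideanSpace ℝ (Fin n) => Real.log ‖y‖)
      (Real.exp (-2 * Real.log ‖x‖) • innerSL ℝ x) x := by
  have h0 : ‖x‖ ≠ 0 := by simpa using hx
  have h1 : HasFDerivAt (fun y : EuclideanSpace ℝ (Fin n) => ‖y‖ ^ 2) (2 • innerSL ℝ x) x :=
    (hasStrictFDerivAt_norm_sq x).hasFDerivAt
  have h2 := (h1.log (by positivity)).const_mul (1 / 2 : ℝ)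
  have h3 : (fun y : EuclideanSpace ℝ (Fin n) => Real.log ‖y‖) =
      fun y => 1 / 2 * Real.log (‖y‖ ^ 2) := by
    ext y; rw [Real.log_pow]; push_cast; ring
  rw [h3]
  refine h2.congr_fderiv ?_
  have h4 : Real.exp (-2 * Real.log ‖x‖) = (‖x‖ ^ 2)⁻¹ := by
    rw [show -2 * Real.log ‖x‖ = - Real.log (‖x‖ ^ 2) by rw [Real.log_pow]; push_cast; ring,
      Real.exp_neg, Real.exp_log (by positivity)]
  rw [h4]
  ext v
  simp
  ring

lemma Nf_contDiffAt {n : ℕ} {f : ℝ → ℂ} {k : ℕ} (hf : ContDiff ℝ k f) (p : RPoly n)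
    {x : EuclideanSpace ℝ (Fin n)} (hx : x ≠ 0) : ContDiffAt ℝ k (Nf f p) x :=
  (hf.contDiffAt.comp x (lognorm_contDiffAt hx k)).mul (pev_contDiff p k).contDiffAt

lemma Nf_fderiv {n : ℕ} {f : ℝ → ℂ} (hf : Differentiable ℝ f) (p : RPoly n)
    {x : EuclideanSpace ℝ (Fin n)} (hx : x ≠ 0) (i : Fin n) :
    fderiv ℝ (Nf f p) x (EuclideanSpace.single i 1) =
      Nf (fun s => (Real.exp (-2 * s) : ℂ) * deriv f s) (X i * p) x + Nf f (pderiv i p) x := by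
  have h1 : HasFDerivAt (fun y : EuclideanSpace ℝ (Fin n) => f (Real.log ‖y‖)) _ x :=
    HasFDerivAt.comp x (hf (Real.log ‖x‖)).hasFDerivAt (lognorm_hasFDerivAt hx)
  have h2 := h1.mul (pev_hasFDerivAt p x)
  have h3 : fderiv ℝ (Nf f p) x = _ := h2.fderiv
  rw [h3]
  simp [Pi.single_apply, Nf, pev, EuclideanSpace.inner_single_right]
  ring

lemma laplacian_of_partials {n : ℕ} {h : EuclideanSpace ℝ (Fin n) → ℂ}
    {x : EuclideanSpace ℝ (Fin n)} (hh : ContDiffAt ℝ 2 h x) (g : Fin n → EuclideanSpace ℝ (Fin n) → ℂ)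
    (hg : ∀ i, ∀ᶠ y in 𝓝 x, fderiv ℝ h y (EuclideanSpace.single i 1) = g i y) :
    (Δ h) x = ∑ i, fderiv ℝ (g i) x (EuclideanSpace.single i 1) := by
  rw [laplacian_eq_iteratedFDeriv_orthonormalBasis h (EuclideanSpace.basisFun (Fin n) ℝ)]
  apply Finset.sum_congr rfl
  intro i _
  rw [iteratedFDeriv_two_apply]
  have h1 : DifferentiableAt ℝ (fderiv ℝ h) x :=
    (hh.fderiv_right (m := 1) (by norm_num)).differentiableAt (by norm_num)
  have h2 : fderiv ℝ (g i) x = fderiv ℝ (fun y => fderiv ℝ h y (EuclideanSpace.single i 1)) x :=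
    Filter.EventuallyEq.fderiv_eq ((hg i).mono fun y hy => hy.symm)
  rw [h2, fderiv_clm_apply h1 (by fun_prop)]
  simp

lemma Nf_laplacian {n j : ℕ} {f : ℝ → ℂ} (hf : ContDiff ℝ 2 f) {p : RPoly n}
    (hp : p.IsHomogeneous j) (hpl : plap p = 0)
    {x : EuclideanSpace ℝ (Fin n)} (hx : x ≠ 0) :
    (Δ (Nf f p)) x = Nf (fun s => (Real.exp (-2 * s) : ℂ) *
      (deriv (deriv f) s + ((n : ℂ) + 2 * j - 2) * deriv f s)) p x := by
  have hd : Differentiable ℝ f := hf.differentiable (by norm_num)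
  have hd1 : Differentiable ℝ (deriv f) := by
    have := (contDiff_succ_iff_deriv (n := 1)).1 hf
    exact this.2.2.differentiable (by norm_num)
  set F : ℝ → ℂ := fun s => (Real.exp (-2 * s) : ℂ) * deriv f s with hF
  have hEd : ∀ s : ℝ, HasDerivAt (fun s : ℝ => (Real.exp (-2 * s) : ℂ)) (-2 * (Real.exp (-2 * s) : ℂ)) s := by
    intro s
    have h1 : HasDerivAt (fun s : ℝ => Real.exp (-2 * s)) (Real.exp (-2 * s) * (-2 * 1)) s :=
      ((hasDerivAt_id s).const_mul (-2)).exp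
    refine h1.ofReal_comp.congr_deriv ?_
    push_cast; ring
  have hFd : ∀ s, HasDerivAt F ((Real.exp (-2 * s) : ℂ) * (deriv (deriv f) s - 2 * deriv f s)) s := by
    intro s
    refine ((hEd s).mul (hd1 s).hasDerivAt).congr_deriv ?_
    ring
  have hFD : Differentiable ℝ F := fun s => (hFd s).differentiableAt
  rw [laplacian_of_partials (Nf_contDiffAt hf p hx)
    (fun i y => Nf F (X i * p) y + Nf f (pderiv i p) y) ?_]
  · have hterm : ∀ i : Fin n, fderiv ℝ (fun y => Nf F (X i * p) y + Nf f (pderiv i p) y) x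
        (EuclideanSpace.single i 1) =
        Nf (fun s => (Real.exp (-2 * s) : ℂ) * deriv F s) (X i * (X i * p)) x +
        Nf F (p + 2 * (X i * pderiv i p)) x + Nf f (pderiv i (pderiv i p)) x := by
      intro i
      have hA : DifferentiableAt ℝ (fun y => Nf F (X i * p) y) x :=
        (((hFD _).comp x (lognorm_hasFDerivAt hx).differentiableAt).mul
          (pev_hasFDerivAt _ x).differentiableAt)
      have hB : DifferentiableAt ℝ (fun y => Nf f (pderiv i p) y) x :=
        (((hd _).comp x (lognorm_hasFDerivAt hx).differentiableAt).mul
          (pev_hasFDerivAt _ x).differentiableAt)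
      rw [fderiv_fun_add hA hB, add_apply]
      have e1 := Nf_fderiv hFD (X i * p) hx i
      have e2 := Nf_fderiv hd (pderiv i p) hx i
      rw [show (fun y => Nf F (X i * p) y) = Nf F (X i * p) from rfl,
        show (fun y => Nf f (pderiv i p) y) = Nf f (pderiv i p) from rfl, e1, e2]
      rw [pderiv_mul, pderiv_X_self, ← hF]
      simp [Nf, pev]
      ring
    simp_rw [hterm, Finset.sum_add_distrib]
    have s1 : ∑ i, pev (X i * (X i * p)) x = (Real.exp (2 * Real.log ‖x‖) : ℂ) * pev p x := by
      have h0 : 0 < ‖x‖ := by simpa using hx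
      have : Real.exp (2 * Real.log ‖x‖) = ∑ i, x i ^ 2 := by
        rw [mul_comm, Real.exp_mul, Real.exp_log h0]
        have := EuclideanSpace.real_norm_sq_eq x
        exact_mod_cast this
      rw [this]
      simp only [pev, map_mul, eval_X]
      push_cast
      rw [Finset.sum_mul]
      exact Finset.sum_congr rfl fun i _ => by ring
    have s2 : ∑ i, pev (p + 2 * (X i * pderiv i p)) x = ((n : ℂ) + 2 * j) * pev p x := by
      have he := congrArg (fun q => pev q x) hp.sum_X_mul_pderiv
      simp only [pev, map_sum, map_add, map_mul, map_nsmul, map_ofNat, Finset.sum_add_distrib,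
        ← Finset.mul_sum] at he ⊢
      rw [he]
      simp
      ring
    have s3 : ∑ i, pev (pderiv i (pderiv i p)) x = 0 := by
      have he := congrArg (fun q => pev q x) hpl
      simpa [pev, plap] using he
    simp only [Nf]
    rw [← Finset.mul_sum, ← Finset.mul_sum, ← Finset.mul_sum, s1, s2, s3, (hFd _).deriv]
    simp only [hF]
    have hE : (Real.exp (-2 * Real.log ‖x‖) : ℂ) * (Real.exp (2 * Real.log ‖x‖) : ℂ) = 1 := by
      rw [← Complex.ofReal_mul, ← Real.exp_add]; simp
    linear_combination (Real.exp (-2 * Real.log ‖x‖) : ℂ) * (deriv (deriv f) (Real.log ‖x‖) - 2 * deriv f (Real.log ‖x‖)) * pev p x * hE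
  · intro i
    filter_upwards [isOpen_ne.mem_nhds hx] with y hy
    exact Nf_fderiv hd p hy i

lemma lap_eq_laplacian {n : ℕ} (u : EuclideanSpace ℝ (Fin n) → ℝ) (x : EuclideanSpace ℝ (Fin n)) :
    lap u x = (Δ u) x := by
  rw [laplacian_eq_iteratedFDeriv_orthonormalBasis u (EuclideanSpace.basisFun (Fin n) ℝ)]
  simp [lap]

lemma laplacian_comp_isometry {n : ℕ} {h : EuclideanSpace ℝ (Fin n) → ℂ}
    (T : EuclideanSpace ℝ (Fin n) ≃ₗᵢ[ℝ] EuclideanSpace ℝ (Fin n))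
    (x : EuclideanSpace ℝ (Fin n)) :
    (Δ (h ∘ T)) x = (Δ h) (T x) := by
  rw [laplacian_eq_iteratedFDeriv_orthonormalBasis (h ∘ T) (EuclideanSpace.basisFun (Fin n) ℝ),
    laplacian_eq_iteratedFDeriv_orthonormalBasis h ((EuclideanSpace.basisFun (Fin n) ℝ).map T)]
  apply Finset.sum_congr rfl
  intro i _
  have := ContinuousLinearEquiv.iteratedFDerivWithin_comp_right (𝕜 := ℝ) T.toContinuousLinearEquiv h
    (s := univ) uniqueDiffOn_univ (x := x) (mem_univ _) 2
  have h2 : (h ∘ T) = h ∘ T.toContinuousLinearEquiv := rfl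
  rw [preimage_univ, iteratedFDerivWithin_univ, iteratedFDerivWithin_univ] at this
  rw [h2, this]
  simp only [ContinuousMultilinearMap.compContinuousLinearMap_apply]
  congr 1
  ext k
  fin_cases k <;> simp

end Calc

open MeasureTheory Metric Set Filter
open scoped RealInnerProductSpace

section Polar
open Real

/-- weight measure on the line -/
noncomputable def wline (n : ℕ) : Measure ℝ :=
  (volume : Measure ℝ).withDensity (fun s => ENNReal.ofReal (Real.exp (n * s)))

noncomputable instance (n : ℕ) : SFinite (wline n) := by unfold wline; infer_instance

abbrev Eu (n : ℕ) := EuclideanSpace ℝ (Fin n)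
abbrev Sp (n : ℕ) := Metric.sphere (0 : Eu n) 1

noncomputable abbrev nu (n : ℕ) : Measure (Sp n) := (volume : Measure (Eu n)).toSphere

noncomputable def expIoi (s : ℝ) : Ioi (0 : ℝ) := ⟨Real.exp s, Real.exp_pos s⟩

lemma measurable_expIoi : Measurable expIoi :=
  (Real.measurable_exp).subtype_mk

lemma expIoi_mp {n : ℕ} (hn : 1 ≤ n) :
    MeasurePreserving expIoi (wline n) (Measure.volumeIoiPow (n - 1)) := by
  refine ⟨measurable_expIoi, ?_⟩
  ext t ht
  rw [Measure.map_apply measurable_expIoi ht, wline,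
    withDensity_apply _ (measurable_expIoi ht), Measure.volumeIoiPow,
    withDensity_apply _ ht]
  have h1 : ∫⁻ a in t, ENNReal.ofReal ((a:ℝ) ^ (n-1)) ∂(Measure.comap Subtype.val (volume : Measure ℝ))
      = ∫⁻ a in Subtype.val '' t, ENNReal.ofReal (a ^ (n-1)) := by
    have := (MeasurableEmbedding.subtype_coe (measurableSet_Ioi (a := (0:ℝ)))).restrict_comap volume t
    rw [this]
    have h2 := (MeasurableEmbedding.subtype_coe (measurableSet_Ioi (a := (0:ℝ)))).lintegral_map
      (μ := Measure.comap Subtype.val (volume.restrict (Subtype.val '' t))) (fun a => ENNReal.ofReal (a ^ (n-1)))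
    rw [← h2, (MeasurableEmbedding.subtype_coe (measurableSet_Ioi (a := (0:ℝ)))).map_comap,
      Measure.restrict_restrict (by
        rw [Subtype.range_coe]; exact measurableSet_Ioi), inter_eq_right.2]
    rintro _ ⟨a, -, rfl⟩
    exact ⟨a, rfl⟩
  rw [h1]
  have himg : Subtype.val '' t = Real.exp '' (expIoi ⁻¹' t) := by
    ext y
    constructor
    · rintro ⟨⟨a, ha⟩, hat, rfl⟩
      refine ⟨Real.log a, ?_, Real.exp_log ha⟩
      simp only [mem_preimage, expIoi]
      convert hat
      exact Subtype.ext (Real.exp_log ha)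
    · rintro ⟨s, hs, rfl⟩
      exact ⟨_, hs, rfl⟩
  rw [himg, lintegral_image_eq_lintegral_abs_deriv_mul (measurable_expIoi ht)
    (fun x _ => (Real.hasDerivAt_exp x).hasDerivWithinAt) Real.exp_injective.injOn]
  apply lintegral_congr
  intro s
  rw [abs_of_pos (Real.exp_pos s), ← ENNReal.ofReal_mul (Real.exp_pos s).le, ← Real.exp_nat_mul, ← Real.exp_add]
  congr 2
  push_cast [Nat.cast_sub hn]
  ring

noncomputable def theta {n : ℕ} (p : Sp n × ℝ) : Eu n := Real.exp p.2 • (p.1 : Eu n)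

lemma continuous_theta {n : ℕ} : Continuous (theta (n := n)) := by
  unfold theta; fun_prop

lemma norm_theta {n : ℕ} (p : Sp n × ℝ) : ‖theta p‖ = Real.exp p.2 := by
  simp [theta, norm_smul]

lemma theta_mp {n : ℕ} (hn : 1 ≤ n) :
    MeasurePreserving (theta (n := n)) ((nu n).prod (wline n)) volume := by
  have : Nonempty (Fin n) := ⟨⟨0, hn⟩⟩
  have hd : Module.finrank ℝ (Eu n) = n := by simp
  have h1 : MeasurePreserving (Prod.map id expIoi) ((nu n).prod (wline n))
    ((nu n).prod (Measure.volumeIoiPow (n-1))) :=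
    (MeasurePreserving.id _).prod (expIoi_mp hn)
  have h2 := Measure.measurePreserving_homeomorphUnitSphereProd (volume : Measure (Eu n))
  rw [hd] at h2
  have h3 := MeasurePreserving.symm (homeomorphUnitSphereProd (Eu n)).toMeasurableEquiv h2
  have h4 : MeasurePreserving (Subtype.val : ({0}ᶜ : Set (Eu n)) → Eu n)
      (Measure.comap Subtype.val volume) volume := by
    refine ⟨measurable_subtype_coe, ?_⟩
    rw [(MeasurableEmbedding.subtype_coe (measurableSet_singleton (0 : Eu n)).compl).map_comap]
    simp [Measure.restrict_eq_self_of_ae_mem, ae_iff]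
  have := h4.comp (h3.comp h1)
  convert this using 1
  funext p
  simp [theta, expIoi]

lemma polar_integral {n : ℕ} (hn : 1 ≤ n) {F : Type*} [NormedAddCommGroup F] [NormedSpace ℝ F]
    {f : Eu n → F} (hf : Integrable f) :
    ∫ x, f x = ∫ σ, (∫ s, Real.exp (n * s) • f (Real.exp s • (σ : Eu n))) ∂(nu n) := by
  have mp := theta_mp hn
  rw [show ∫ x, f x = ∫ p, (f ∘ theta) p ∂((nu n).prod (wline n)) from ?_]
  swap
  · rw [← mp.map_eq, integral_map mp.measurable.aemeasurable (by rw [mp.map_eq]; exact hf.1)]; rfl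
  rw [integral_prod _ (mp.integrable_comp_of_integrable hf)]
  apply integral_congr_ae
  filter_upwards with σ
  rw [wline, integral_withDensity_eq_integral_toReal_smul (by fun_prop) (by simp)]
  apply integral_congr_ae
  filter_upwards with s
  rw [ENNReal.toReal_ofReal (Real.exp_pos _).le]
  rfl

lemma polar_lintegral {n : ℕ} (hn : 1 ≤ n) 
    {f : Eu n → ENNReal} (hf : Measurable f) :
    ∫⁻ x, f x = ∫⁻ σ, (∫⁻ s, ENNReal.ofReal (Real.exp (n * s)) * f (Real.exp s • (σ : Eu n))) ∂(nu n) := by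
  have mp := theta_mp hn
  rw [show ∫⁻ x, f x = ∫⁻ p, (f ∘ theta) p ∂((nu n).prod (wline n)) from (mp.lintegral_comp hf).symm]
  rw [lintegral_prod _ (hf.comp mp.measurable).aemeasurable]
  apply lintegral_congr
  intro σ
  rw [wline, lintegral_withDensity_eq_lintegral_mul _ (by fun_prop)]
  · rfl
  · exact hf.comp (mp.measurable.comp measurable_prodMk_left)

end Polar

open MeasureTheory Metric Set Filter
open scoped RealInnerProductSpace

section SphereMap
open Pointwise

/-- The action of a linear isometry on the sphere. -/
noncomputable def sphMap {n : ℕ} (T : Eu n ≃ₗᵢ[ℝ] Eu n) (σ : Sp n) : Sp n :=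
  ⟨T σ, by simp⟩

lemma continuous_sphMap {n : ℕ} (T : Eu n ≃ₗᵢ[ℝ] Eu n) : Continuous (sphMap T) :=
  (T.continuous.comp continuous_subtype_val).subtype_mk _

lemma sphMap_mp {n : ℕ} (T : Eu n ≃ₗᵢ[ℝ] Eu n) : MeasurePreserving (sphMap T) (nu n) (nu n) := by
  refine ⟨(continuous_sphMap T).measurable, ?_⟩
  ext s hs
  rw [Measure.map_apply (continuous_sphMap T).measurable hs,
    Measure.toSphere_apply' _ ((continuous_sphMap T).measurable hs), Measure.toSphere_apply' _ hs]
  congr 1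
  have h : Ioo (0:ℝ) 1 • (Subtype.val '' s : Set (Eu n)) =
     T.symm ⁻¹' (Ioo (0:ℝ) 1 • (Subtype.val '' (sphMap T ⁻¹' s) : Set (Eu n))) := by
    ext x
    simp only [mem_preimage, Set.mem_smul]
    constructor
    · rintro ⟨r, hr, _, ⟨σ, hσ, rfl⟩, rfl⟩
      refine ⟨r, hr, T.symm σ, ⟨⟨T.symm σ, by simp⟩, ?_, rfl⟩, by simp⟩
      simp [sphMap]; exact hσ
    · rintro ⟨r, hr, _, ⟨σ, hσ, rfl⟩, h⟩
      refine ⟨r, hr, T σ, ⟨_, hσ, rfl⟩, ?_⟩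
      have h' : r • (σ : Eu n) = T.symm x := h
      change r • T σ = x
      rw [← map_smul, h']; simp
  rw [h]
  have := T.symm.measurePreserving
  exact (MeasurePreserving.measure_preimage_equiv (f := T.symm.toHomeomorph.toMeasurableEquiv) this _).symm
end SphereMap

section Planch
open FourierTransform Real
open scoped SchwartzMap


lemma plancherel1 {g : ℝ → ℂ} (h1 : Integrable g) (h2 : MemLp g 2) :
    ∫⁻ ξ, ‖𝓕 g ξ‖ₑ ^ 2 = ∫⁻ s, ‖g s‖ₑ ^ 2 := by
  set G := h2.toLp g with hG
  have hcont : Continuous (𝓕 g) := VectorFourier.fourierIntegral_continuous Real.continuous_fourierChar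
    (by fun_prop) h1
  have key : (𝓕 G : Lp ℂ 2 (volume : Measure ℝ)) =ᵐ[volume] 𝓕 g := by
    apply ae_eq_of_integral_contDiff_smul_eq
    · exact (Lp.memLp _).locallyIntegrable (by norm_num)
    · exact hcont.locallyIntegrable
    · intro η hη hc
      have hη' : ContDiff ℝ ((⊤ : ℕ∞) : WithTop ℕ∞) (fun x => (η x : ℂ)) :=
        Complex.ofRealCLM.contDiff.comp hη
      have hc' : HasCompactSupport (fun x => (η x : ℂ)) :=
        hc.comp_left (g := fun t : ℝ => (t : ℂ)) (by simp)
      set θ : 𝓢(ℝ, ℂ) := hc'.toSchwartzMap hη' with hθ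
      have e1 := congrArg (fun D : 𝓢'(ℝ, ℂ) => D θ) (Lp.fourier_toTemperedDistribution_eq G)
      simp only [TemperedDistribution.fourier_apply, Lp.toTemperedDistribution_apply] at e1
      have e2 : ∫ x, (𝓕 θ) x • G x = ∫ x, (𝓕 θ) x • g x := by
        apply integral_congr_ae
        filter_upwards [h2.coeFn_toLp] with x hx
        rw [hx]
      have e3 := VectorFourier.integral_fourierIntegral_smul_eq_flip (𝕜 := ℝ) (e := Real.fourierChar)
        (L := innerₗ ℝ) (μ := volume) (ν := volume) (f := θ) (g := g) Real.continuous_fourierChar (by fun_prop)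
        θ.integrable h1
      have e4 : ∫ x, (𝓕 θ) x • g x = ∫ x, θ x • 𝓕 g x := by
        rw [flip_innerₗ] at e3
        exact e3
      have e5 : ∀ x, θ x = (η x : ℂ) := fun x => rfl
      rw [e2, e4] at e1
      simp only [e5] at e1
      simpa using e1.symm
  have hn := Lp.norm_fourier_eq G
  rw [Lp.norm_def, Lp.norm_def, ENNReal.toReal_eq_toReal_iff' (Lp.eLpNorm_ne_top _) (Lp.eLpNorm_ne_top _),
    eLpNorm_congr_ae key, eLpNorm_congr_ae h2.coeFn_toLp,
    eLpNorm_eq_lintegral_rpow_enorm_toReal (by norm_num) (by norm_num), eLpNorm_eq_lintegral_rpow_enorm_toReal (by norm_num) (by norm_num)] at hn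
  have := congrArg (fun t => t ^ (2:ℝ)) hn
  simp only [← ENNReal.rpow_mul] at this
  simpa using this
end Planch

open MeasureTheory Metric Set Filter
open scoped RealInnerProductSpace

section Green
open InnerProductSpace Laplacian Topology

lemma div0 {n : ℕ} {K : Eu n → ℂ} (hK : ContDiff ℝ 1 K) (hc : HasCompactSupport K) (e : Eu n) :
    ∫ x, fderiv ℝ K x e = 0 := by
  have hcd : Continuous (fun x => fderiv ℝ K x e) :=
    (hK.continuous_fderiv (by norm_num)).clm_apply continuous_const
  have hsd : HasCompactSupport (fun x => fderiv ℝ K x e) := hc.fderiv_apply (𝕜 := ℝ) e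
  have := integral_mul_fderiv_eq_neg_fderiv_mul_of_integrable (μ := (volume : Measure (Eu n)))
    (f := fun _ => (1:ℂ)) (g := K) (v := e) (by simp) (by simpa using hcd.integrable_of_hasCompactSupport hsd)
    (by simpa using hK.continuous.integrable_of_hasCompactSupport hc)
    (fun x _ => by fun_prop) (fun x _ => hK.differentiable (by norm_num) x)
  simpa using this

/-- components of the Green vector field -/
noncomputable def Kf {n : ℕ} (F G : Eu n → ℂ) (i : Fin n) (x : Eu n) : ℂ :=
  fderiv ℝ F x (EuclideanSpace.single i 1) * G x - F x * fderiv ℝ G x (EuclideanSpace.single i 1)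

lemma Kf_contDiffAt {n : ℕ} {F G : Eu n → ℂ} {x : Eu n} (hF : ContDiffAt ℝ 2 F x)
    (hG : ContDiffAt ℝ 2 G x) (i : Fin n) : ContDiffAt ℝ 1 (Kf F G i) x := by
  unfold Kf
  have h1 : ContDiffAt ℝ 1 (fderiv ℝ F) x := hF.fderiv_right (m := 1) (by norm_num)
  have h2 : ContDiffAt ℝ 1 (fderiv ℝ G) x := hG.fderiv_right (m := 1) (by norm_num)
  exact ((h1.clm_apply contDiffAt_const).mul (hG.of_le (by norm_num))).sub
    ((hF.of_le (by norm_num)).mul (h2.clm_apply contDiffAt_const))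

lemma green_pt {n : ℕ} {F G : Eu n → ℂ} {x : Eu n} (hF : ContDiffAt ℝ 2 F x)
    (hG : ContDiffAt ℝ 2 G x) :
    ∑ i, fderiv ℝ (Kf F G i) x (EuclideanSpace.single i 1) = (Δ F) x * G x - F x * (Δ G) x := by
  have h1 : DifferentiableAt ℝ (fderiv ℝ F) x :=
    (hF.fderiv_right (m := 1) (by norm_num)).differentiableAt (by norm_num)
  have h2 : DifferentiableAt ℝ (fderiv ℝ G) x :=
    (hG.fderiv_right (m := 1) (by norm_num)).differentiableAt (by norm_num)
  have f1 : DifferentiableAt ℝ F x := hF.differentiableAt (by norm_num)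
  have f2 : DifferentiableAt ℝ G x := hG.differentiableAt (by norm_num)
  rw [laplacian_of_partials hF (fun i y => fderiv ℝ F y (EuclideanSpace.single i 1)) (fun i => by simp),
    laplacian_of_partials hG (fun i y => fderiv ℝ G y (EuclideanSpace.single i 1)) (fun i => by simp),
    Finset.sum_mul, Finset.mul_sum, ← Finset.sum_sub_distrib]
  apply Finset.sum_congr rfl
  intro i _
  have d1 : DifferentiableAt ℝ (fun y => fderiv ℝ F y (EuclideanSpace.single i 1)) x :=
    h1.clm_apply (by fun_prop)
  have d2 : DifferentiableAt ℝ (fun y => fderiv ℝ G y (EuclideanSpace.single i 1)) x :=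
    h2.clm_apply (by fun_prop)
  have : fderiv ℝ (Kf F G i) x = _ := ((d1.hasFDerivAt.mul f2.hasFDerivAt).sub
    (f1.hasFDerivAt.mul d2.hasFDerivAt)).fderiv
  rw [this]
  simp
  ring

lemma Kf_zero {n : ℕ} {F G : Eu n → ℂ} {x : Eu n} (hx : F =ᶠ[𝓝 x] 0) (i : Fin n) :
    Kf F G i =ᶠ[𝓝 x] 0 := by
  filter_upwards [hx.eventuallyEq_nhds] with y hy
  have h1 : fderiv ℝ F y = 0 := by rw [hy.fderiv_eq]; simp
  simp [Kf, h1, hy.eq_of_nhds]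

lemma green_compact {n : ℕ} {F G : Eu n → ℂ} (hF : ContDiff ℝ 2 F) (hc : HasCompactSupport F)
    (hG : ∀ x ∈ tsupport F, ContDiffAt ℝ 2 G x) :
    ∫ x, ((Δ F) x * G x - F x * (Δ G) x) = 0 := by
  have hz : ∀ x ∉ tsupport F, F =ᶠ[𝓝 x] 0 := fun x hx => notMem_tsupport_iff_eventuallyEq.1 hx
  have hK : ∀ i, ContDiff ℝ 1 (Kf F G i) := by
    intro i
    rw [contDiff_iff_contDiffAt]
    intro x
    by_cases hx : x ∈ tsupport F
    · exact Kf_contDiffAt hF.contDiffAt (hG x hx) i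
    · exact (contDiffAt_const (c := (0:ℂ))).congr_of_eventuallyEq (Kf_zero (hz x hx) i)
  have hKc : ∀ i, HasCompactSupport (Kf F G i) := by
    intro i
    refine HasCompactSupport.intro hc.isCompact ?_
    intro x hx
    exact (Kf_zero (hz x hx) i).eq_of_nhds
  have hpt : ∀ x, (Δ F) x * G x - F x * (Δ G) x =
      ∑ i, fderiv ℝ (Kf F G i) x (EuclideanSpace.single i 1) := by
    intro x
    by_cases hx : x ∈ tsupport F
    · exact (green_pt hF.contDiffAt (hG x hx)).symm
    · have h1 : (Δ F) x = 0 := by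
        have := laplacian_congr_nhds (hz x hx)
        rw [this.eq_of_nhds]; simp [laplacian_eq_iteratedFDeriv_orthonormalBasis _ (EuclideanSpace.basisFun (Fin n) ℝ)]
      have h2 : ∀ i, fderiv ℝ (Kf F G i) x = 0 := by
        intro i
        rw [(Kf_zero (hz x hx) i).fderiv_eq]; simp
      simp [h1, h2, (hz x hx).eq_of_nhds]
  simp_rw [hpt]
  rw [integral_finset_sum]
  · exact Finset.sum_eq_zero fun i _ => div0 (hK i) (hKc i) _
  · intro i _
    exact (((hK i).continuous_fderiv (by norm_num)).clm_apply
      continuous_const).integrable_of_hasCompactSupport ((hKc i).fderiv_apply (𝕜 := ℝ) _)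
end Green

open MeasureTheory Metric Set Filter
open scoped RealInnerProductSpace

section Orth
open InnerProductSpace Laplacian Topology MvPolynomial

lemma pev_smul {n j : ℕ} {p : RPoly n} (hp : p.IsHomogeneous j) (r : ℝ) (x : Eu n) :
    pev p (r • x) = (r : ℂ) ^ j * pev p x := by
  unfold pev
  rw [eval_eq, eval_eq, Finset.mul_sum]
  apply Finset.sum_congr rfl
  intro d hd
  have hdeg : ∑ i ∈ d.support, d i = j := by
    have := hp (mem_support_iff.1 hd)
    rw [Finsupp.weight_apply] at this
    simpa [Finsupp.sum] using this
  have : ∏ i ∈ d.support, (((r • x) i : ℝ) : ℂ) ^ d i = (r:ℂ) ^ j * ∏ i ∈ d.support, ((x i : ℝ) : ℂ) ^ d i := by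
    rw [← hdeg, ← Finset.prod_pow_eq_pow_sum, ← Finset.prod_mul_distrib]
    apply Finset.prod_congr rfl
    intro i _
    simp [mul_pow]
  rw [this]; ring

/-- coefficientwise conjugation -/
noncomputable def pconj {n : ℕ} (p : RPoly n) : RPoly n := map (starRingEnd ℂ) p

lemma pev_pconj {n : ℕ} (p : RPoly n) (x : Eu n) : pev (pconj p) x = (starRingEnd ℂ) (pev p x) := by
  unfold pev pconj
  rw [eval_map]
  induction p using MvPolynomial.induction_on with
  | C a => simp
  | add p q hp hq => simp [hp, hq]
  | mul_X p i hp => simp [hp]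

lemma pconj_hom {n j : ℕ} {p : RPoly n} (hp : p.IsHomogeneous j) : (pconj p).IsHomogeneous j :=
  hp.map _

lemma plap_pconj {n : ℕ} (p : RPoly n) : plap (pconj p) = pconj (plap p) := by
  simp [plap, pconj, pderiv_map]

lemma laplacian_pev {n : ℕ} (p : RPoly n) (x : Eu n) : (Δ (pev p)) x = pev (plap p) x := by
  rw [laplacian_of_partials (pev_contDiff p 2).contDiffAt (fun i => pev (pderiv i p))
    (fun i => by filter_upwards with y using pev_fderiv p y i)]
  simp_rw [pev_fderiv]
  simp [pev, plap]

lemma Nf_zero_near {n : ℕ} {f : ℝ → ℂ} (h1 : ∀ s < 1, f s = 0) (p : RPoly n) {x : Eu n}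
    (hx : ‖x‖ < 2) : Nf f p x = 0 := by
  unfold Nf
  rw [h1, zero_mul]
  rcases (norm_nonneg x).eq_or_lt with h | h
  · rw [← h]; simp
  · rw [Real.log_lt_iff_lt_exp h]
    have := Real.exp_one_gt_d9
    linarith

lemma Nf_zero_far {n : ℕ} {f : ℝ → ℂ} {R : ℝ} (h2 : ∀ s > R, f s = 0) (p : RPoly n) {x : Eu n}
    (hx : Real.exp R < ‖x‖) : Nf f p x = 0 := by
  unfold Nf
  rw [h2, zero_mul]
  exact (Real.lt_log_iff_exp_lt ((Real.exp_pos _).trans hx)).2 hx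

lemma Nf_contDiff {n : ℕ} {f : ℝ → ℂ} (hf : ContDiff ℝ 2 f) (h1 : ∀ s < 1, f s = 0)
    (p : RPoly n) : ContDiff ℝ 2 (Nf f p) := by
  rw [contDiff_iff_contDiffAt]
  intro x
  by_cases hx : x = 0
  · refine (contDiffAt_const (c := (0:ℂ))).congr_of_eventuallyEq ?_
    filter_upwards [Metric.ball_mem_nhds x (show (0:ℝ) < 2 by norm_num)] with y hy
    exact Nf_zero_near h1 p (by simpa [hx] using hy)
  · exact Nf_contDiffAt (k := 2) hf p hx

lemma Nf_compact {n : ℕ} {f : ℝ → ℂ} {R : ℝ} (h2 : ∀ s > R, f s = 0)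
    (p : RPoly n) : HasCompactSupport (Nf f p) := by
  refine HasCompactSupport.intro (isCompact_closedBall (0 : Eu n) (Real.exp R)) ?_
  intro x hx
  exact Nf_zero_far h2 p (by simpa using hx)

lemma pev_continuous {n : ℕ} (p : RPoly n) : Continuous (pev p) := (pev_contDiff p 0).continuous

lemma sphere_orth {n j k : ℕ} (hn : 2 ≤ n) (hjk : j ≠ k) {p q : RPoly n} (hp : p.IsHomogeneous j)
    (hpl : plap p = 0) (hq : q.IsHomogeneous k) (hql : plap q = 0) :
    ∫ σ : Sp n, pev p σ * pev q σ ∂(nu n) = 0 := by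
  let b : ContDiffBump (2 : ℝ) := ⟨1/2, 1, by norm_num, by norm_num⟩
  set f : ℝ → ℂ := fun s => ((b s : ℝ) : ℂ) with hf
  have hfc : ContDiff ℝ 2 f := Complex.ofRealCLM.contDiff.comp (b.contDiff (n := 2))
  have hz : ∀ s, 1 ≤ |s - 2| → f s = 0 := by
    intro s hs
    have : b s = 0 := b.zero_of_le_dist (by simpa [Real.dist_eq] using hs)
    simp [hf, this]
  have h1 : ∀ s < 1, f s = 0 := fun s hs => hz s (by rw [abs_of_neg (by linarith)]; linarith)
  have h2 : ∀ s > 3, f s = 0 := fun s hs => hz s (by rw [abs_of_pos (by linarith)]; linarith)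
  have hfs : HasCompactSupport f := by
    refine HasCompactSupport.intro (isCompact_Icc (a := (1:ℝ)) (b := 3)) ?_
    intro s hs
    rw [mem_Icc, not_and_or, not_le, not_le] at hs
    exact hs.elim (h1 s) (h2 s)
  have hd1 : ContDiff ℝ 1 (deriv f) := ((contDiff_succ_iff_deriv (n := 1)).1 hfc).2.2
  have hg := green_compact (Nf_contDiff hfc h1 p) (Nf_compact h2 p) (G := pev q)
    (fun x _ => (pev_contDiff q 2).contDiffAt)
  simp_rw [laplacian_pev, hql] at hg
  have hpz : ∀ x : Eu n, pev (0 : RPoly n) x = 0 := by intro x; simp [pev]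
  simp only [hpz, mul_zero, sub_zero] at hg
  set D : ℝ → ℂ := fun s => deriv (deriv f) s + ((n : ℂ) + 2 * j - 2) * deriv f s with hD
  set κ : ℝ := n + j + k - 2 with hκ
  have hκpos : 0 < κ := by
    have : (2:ℝ) ≤ n := by exact_mod_cast hn
    have : 1 ≤ j + k := by omega
    have : (1:ℝ) ≤ j + k := by exact_mod_cast this
    linarith
  have hintg : Integrable (fun x => (Δ (Nf f p)) x * pev q x) := by
    have hc : Continuous (Δ (Nf f p)) := by
      rw [show (Δ (Nf f p)) = fun x => ∑ i, iteratedFDeriv ℝ 2 (Nf f p) x ![EuclideanSpace.basisFun (Fin n) ℝ i, EuclideanSpace.basisFun (Fin n) ℝ i] from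
        laplacian_eq_iteratedFDeriv_orthonormalBasis _ (EuclideanSpace.basisFun (Fin n) ℝ)]
      have := (Nf_contDiff hfc h1 p).continuous_iteratedFDeriv (m := 2) (by norm_num)
      fun_prop
    refine (hc.mul (pev_continuous q)).integrable_of_hasCompactSupport ?_
    refine HasCompactSupport.intro (Nf_compact h2 p).isCompact ?_
    intro x hx
    have := laplacian_congr_nhds (notMem_tsupport_iff_eventuallyEq.1 hx)
    rw [Pi.mul_apply, this.eq_of_nhds]
    simp [laplacian_eq_iteratedFDeriv_orthonormalBasis _ (EuclideanSpace.basisFun (Fin n) ℝ)]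
  rw [polar_integral (by omega) hintg] at hg
  have hpt : ∀ (σ : Sp n) (s : ℝ), Real.exp (n * s) • ((Δ (Nf f p)) (Real.exp s • (σ : Eu n)) * pev q (Real.exp s • (σ : Eu n)))
      = (pev p σ * pev q σ) * ((Real.exp (κ * s) : ℂ) * D s) := by
    intro σ s
    have hne : Real.exp s • (σ : Eu n) ≠ 0 := by
      rw [← norm_ne_zero_iff, norm_smul]; simp
    rw [Nf_laplacian hfc hp hpl hne, pev_smul hq, Nf, pev_smul hp]
    have hl : Real.log ‖Real.exp s • (σ : Eu n)‖ = s := by simp [norm_smul]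
    rw [hl, Complex.real_smul]
    have he : (Real.exp (κ * s) : ℂ) = (Real.exp (n * s) : ℂ) * (Real.exp (-2 * s) : ℂ) * (Real.exp s : ℂ) ^ j * (Real.exp s : ℂ) ^ k := by
      rw [← Complex.ofReal_pow, ← Complex.ofReal_pow, ← Real.exp_nat_mul, ← Real.exp_nat_mul, ← Complex.ofReal_mul, ← Complex.ofReal_mul, ← Complex.ofReal_mul,
        ← Real.exp_add, ← Real.exp_add, ← Real.exp_add]
      congr 2
      rw [hκ]; ring
    rw [he]
    ring
  simp_rw [hpt, integral_const_mul] at hg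
  rw [integral_mul_const] at hg
  refine (mul_eq_zero.1 hg).resolve_right ?_
  have hE : ∀ s : ℝ, HasDerivAt (fun s : ℝ => (Real.exp (κ * s) : ℂ)) (κ * (Real.exp (κ * s) : ℂ)) s := by
    intro s
    have h1 : HasDerivAt (fun s : ℝ => Real.exp (κ * s)) (Real.exp (κ * s) * (κ * 1)) s :=
      ((hasDerivAt_id s).const_mul κ).exp
    refine h1.ofReal_comp.congr_deriv ?_
    push_cast; ring
  have hder : ∀ s, HasDerivAt (fun s => (Real.exp (κ * s) : ℂ) * (deriv f s + ((j : ℂ) - k) * f s))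
     ((Real.exp (κ * s) : ℂ) * D s + κ * ((j : ℂ) - k) * ((Real.exp (κ * s) : ℂ) * f s)) s := by
    intro s
    refine ((hE s).mul (((hd1.differentiable (by norm_num) s).hasDerivAt).add
      (((hfc.differentiable (by norm_num) s).hasDerivAt).const_mul _))).congr_deriv ?_
    simp only [hD, hκ, Pi.add_apply]
    push_cast
    ring
  have hEc : Continuous (fun s : ℝ => (Real.exp (κ * s) : ℂ)) := by fun_prop
  have hdc : HasCompactSupport (deriv f) := hfs.deriv
  have i1 : Integrable (fun s => (Real.exp (κ * s) : ℂ) * f s) :=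
    (hEc.mul hfc.continuous).integrable_of_hasCompactSupport hfs.mul_left
  have i2 : Integrable (fun s => (Real.exp (κ * s) : ℂ) * deriv f s) :=
    (hEc.mul hd1.continuous).integrable_of_hasCompactSupport hdc.mul_left
  have i3 : Integrable (fun s => (Real.exp (κ * s) : ℂ) * deriv (deriv f) s) :=
    (hEc.mul (hd1.continuous_deriv le_rfl)).integrable_of_hasCompactSupport hdc.deriv.mul_left
  have i4 : Integrable (fun s => (Real.exp (κ * s) : ℂ) * D s) := by
    refine (i3.add (i2.const_mul ((n : ℂ) + 2 * j - 2))).congr (ae_of_all _ fun s => ?_)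
    simp only [hD, Pi.add_apply]; ring
  have hz0 := integral_eq_zero_of_hasDerivAt_of_integrable hder (i4.add (i1.const_mul _))
    (by
      refine (i2.add (i1.const_mul ((j:ℂ) - k))).congr (ae_of_all _ fun s => ?_)
      simp only [Pi.add_apply]; ring)
  rw [integral_add i4 (i1.const_mul _), integral_const_mul] at hz0
  intro hcon
  rw [hcon, zero_add] at hz0
  have hI : ∫ s, (Real.exp (κ * s) : ℂ) * f s = ((∫ s, Real.exp (κ * s) * b s : ℝ) : ℂ) := by
    rw [← integral_complex_ofReal]; simp [hf]
  rw [hI] at hz0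
  have hbpos : 0 < ∫ s, Real.exp (κ * s) * b s := by
    have hcb : Continuous (fun s => Real.exp (κ * s) * b s) := by
      have := b.continuous; fun_prop
    refine hcb.integral_pos_of_hasCompactSupport_nonneg_nonzero (b.hasCompactSupport.mul_left)
      (fun s => mul_nonneg (Real.exp_pos _).le b.nonneg) (x := 2) ?_
    have : b 2 = 1 := b.one_of_mem_closedBall (Metric.mem_closedBall_self b.rIn_pos.le)
    rw [this]; positivity
  have hjk' : (j : ℂ) - k ≠ 0 := sub_ne_zero.2 (by exact_mod_cast hjk)
  have := mul_ne_zero (mul_ne_zero (Complex.ofReal_ne_zero.2 hκpos.ne') hjk') (Complex.ofReal_ne_zero.2 hbpos.ne')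
  exact this hz0

end Orth

open MeasureTheory Metric Set Filter
open scoped RealInnerProductSpace

section HB
open Topology MvPolynomial

/-- restriction of polynomials to the sphere -/
noncomputable def polyC (n : ℕ) : RPoly n →ₐ[ℂ] C(Sp n, ℂ) where
  toFun p := ⟨fun σ => pev p (σ : Eu n), (pev_continuous p).comp continuous_subtype_val⟩
  map_one' := by ext; simp [pev]
  map_mul' p q := by ext; simp [pev]
  map_zero' := by ext; simp [pev]
  map_add' p q := by ext; simp [pev]
  commutes' c := by ext; simp [pev]

/-- restriction of polynomials to the sphere, in `L²` -/
noncomputable def polyL (n : ℕ) : RPoly n →ₗ[ℂ] Lp ℂ 2 (nu n) :=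
  (ContinuousMap.toLp (E := ℂ) 2 (nu n) ℂ).toLinearMap ∘ₗ (polyC n).toLinearMap

lemma polyL_coe {n : ℕ} (p : RPoly n) : polyL n p =ᵐ[nu n] fun σ => pev p (σ : Eu n) := by
  exact ContinuousMap.coeFn_toLp (nu n) (polyC n p)

/-- homogeneous harmonic polynomials -/
noncomputable def harm (n j : ℕ) : Submodule ℂ (RPoly n) where
  carrier := {p | p.IsHomogeneous j ∧ plap p = 0}
  add_mem' := fun ⟨h1, h2⟩ ⟨h3, h4⟩ => ⟨h1.add h3, by rw [plap_add, h2, h4, add_zero]⟩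
  zero_mem' := ⟨isHomogeneous_zero _ _ _, by simp [plap]⟩
  smul_mem' := fun c p ⟨h1, h2⟩ => ⟨(homogeneousSubmodule (Fin n) ℂ j).smul_mem c h1, by rw [plap_smul, h2, smul_zero]⟩

lemma harm_finite (n j : ℕ) : Module.Finite ℂ (harm n j) := by
  have : Module.Finite ℂ (homogeneousSubmodule (Fin n) ℂ j) :=
    Module.Finite.iff_fg.2 (homogeneousSubmodule_fg _ _ _)
  have hle : harm n j ≤ homogeneousSubmodule (Fin n) ℂ j := fun p hp => hp.1
  exact Module.Finite.of_injective (Submodule.inclusion hle) (Submodule.inclusion_injective hle)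

noncomputable def Hj (n j : ℕ) : Submodule ℂ (Lp ℂ 2 (nu n)) := (harm n j).map (polyL n)

instance Hj_finite (n j : ℕ) : FiniteDimensional ℂ (Hj n j) := by
  have := harm_finite n j
  unfold Hj
  infer_instance

lemma inner_polyL {n : ℕ} (p : RPoly n) (f : Lp ℂ 2 (nu n)) :
    inner ℂ (polyL n p) f = ∫ σ : Sp n, pev (pconj p) (σ : Eu n) * f σ ∂(nu n) := by
  rw [L2.inner_def]
  apply integral_congr_ae
  filter_upwards [polyL_coe p] with σ hσ
  rw [hσ, pev_pconj]
  simp [mul_comm]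

lemma Hj_orth {n : ℕ} (hn : 2 ≤ n) :
    OrthogonalFamily ℂ (fun j => Hj n j) (fun j => (Hj n j).subtypeₗᵢ) := by
  intro j k hjk
  rintro ⟨_, p, hp, rfl⟩ ⟨_, q, hq, rfl⟩
  change inner ℂ (polyL n p) (polyL n q) = 0
  rw [inner_polyL]
  have h := sphere_orth hn hjk (pconj_hom hp.1) (by rw [plap_pconj, hp.2]; simp [pconj]) hq.1 hq.2
  rw [← h]
  apply integral_congr_ae
  filter_upwards [polyL_coe q] with σ hσ
  rw [hσ]

lemma prho_sphere {n : ℕ} (σ : Sp n) : pev (prho n) (σ : Eu n) = 1 := by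
  have h : ‖(σ : Eu n)‖ ^ 2 = 1 := by simp
  rw [EuclideanSpace.real_norm_sq_eq] at h
  simp only [pev, prho, map_sum, map_pow, eval_X]
  exact_mod_cast h

lemma hom_mem_iSup {n : ℕ} (hn : 2 ≤ n) (d : ℕ) :
    ∀ p : RPoly n, p.IsHomogeneous d → polyL n p ∈ ⨆ j, Hj n j := by
  induction d using Nat.strong_induction_on with
  | _ d ih =>
    intro p hp
    by_cases hd : d < 2
    · exact Submodule.mem_iSup_of_mem d ⟨p, ⟨hp, plap_eq_zero hp hd⟩, rfl⟩
    · obtain ⟨d, rfl⟩ : ∃ e, d = e + 2 := ⟨d - 2, by omega⟩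
      obtain ⟨h, q, hh, hl, hq, rfl⟩ := hom_decomp (by omega) hp
      rw [map_add]
      refine add_mem (Submodule.mem_iSup_of_mem (d+2) ⟨h, ⟨hh, hl⟩, rfl⟩) ?_
      have : polyL n (prho n * q) = polyL n q := by
        have : polyC n (prho n * q) = polyC n q := by
          rw [map_mul]
          ext σ
          simp [polyC, prho_sphere]
        simp [polyL, this]
      rw [this]
      exact ih d (by omega) q hq

lemma polyL_mem_iSup {n : ℕ} (hn : 2 ≤ n) (p : RPoly n) : polyL n p ∈ ⨆ j, Hj n j := by
  rw [← sum_homogeneousComponent p, map_sum]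
  exact Submodule.sum_mem _ fun i _ => hom_mem_iSup hn i _ (homogeneousComponent_isHomogeneous i p)

lemma polyC_dense (n : ℕ) : Dense (Set.range (polyC n)) := by
  let A : StarSubalgebra ℂ C(Sp n, ℂ) :=
    { (polyC n).range with
      star_mem' := by
        rintro _ ⟨p, rfl⟩
        refine ⟨pconj p, ?_⟩
        ext σ
        simp [polyC, pev_pconj] }
  have hA : A.topologicalClosure = ⊤ := by
    apply ContinuousMap.starSubalgebra_topologicalClosure_eq_top_of_separatesPoints
    intro σ τ hne
    have : ∃ i, (σ : Eu n) i ≠ (τ : Eu n) i := by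
      by_contra hcon
      push Not at hcon
      exact hne (Subtype.ext (PiLp.ext hcon))
    obtain ⟨i, hi⟩ := this
    refine ⟨_, ⟨polyC n (X i), ⟨X i, rfl⟩, rfl⟩, ?_⟩
    simpa [polyC, pev] using hi
  have h2 : (A : Set C(Sp n, ℂ)) = Set.range (polyC n) := rfl
  rw [← h2, dense_iff_closure_eq, ← StarSubalgebra.topologicalClosure_coe, hA]
  rfl

lemma polyL_dense (n : ℕ) : DenseRange (polyL n) := by
  have h1 : DenseRange (ContinuousMap.toLp (E := ℂ) 2 (nu n) ℂ) :=
    ContinuousMap.toLp_denseRange ℂ (nu n) ℂ (by norm_num)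
  exact h1.comp (polyC_dense n) (ContinuousMap.toLp (E := ℂ) 2 (nu n) ℂ).continuous

theorem exists_basis {n : ℕ} (hn : 2 ≤ n) :
    ∃ (ι : Type) (b : HilbertBasis ι ℂ (Lp ℂ 2 (nu n))) (deg : ι → ℕ) (P : ι → RPoly n),
      (∀ i, (P i).IsHomogeneous (deg i) ∧ plap (P i) = 0 ∧ b i = polyL n (P i)) ∧
      ∀ K, {i | deg i ≤ K}.Finite := by
  let e : ∀ j, OrthonormalBasis (Fin (Module.finrank ℂ (Hj n j))) ℂ (Hj n j) := fun j =>
    stdOrthonormalBasis ℂ (Hj n j)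
  let w : (Σ j, Fin (Module.finrank ℂ (Hj n j))) → Lp ℂ 2 (nu n) := fun a => (e a.1 a.2 : Lp ℂ 2 (nu n))
  have hw : Orthonormal ℂ w := by
    have := (Hj_orth hn).orthonormal_sigma_orthonormal (v_family := fun j => ⇑(e j))
      (fun j => (e j).orthonormal)
    exact this
  have hspan : ⊤ ≤ (Submodule.span ℂ (Set.range w)).topologicalClosure := by
    have hle : ⨆ j, Hj n j ≤ Submodule.span ℂ (Set.range w) := by
      apply iSup_le
      intro j x hx
      have h1 : (⟨x, hx⟩ : Hj n j) ∈ Submodule.span ℂ (Set.range (e j)) := by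
        rw [← OrthonormalBasis.coe_toBasis, (e j).toBasis.span_eq]; trivial
      have h2 := Submodule.mem_map_of_mem (f := (Hj n j).subtype) h1
      rw [Submodule.map_span] at h2
      refine Submodule.span_mono ?_ h2
      rintro _ ⟨_, ⟨i, rfl⟩, rfl⟩
      exact ⟨⟨j, i⟩, rfl⟩
    intro x _
    have h1 : x ∈ closure (Set.range (polyL n)) := polyL_dense n x
    refine closure_mono ?_ h1
    rintro _ ⟨p, rfl⟩
    exact hle (polyL_mem_iSup hn p)
  have hP : ∀ a : (Σ j, Fin (Module.finrank ℂ (Hj n j))), ∃ p : RPoly n, p.IsHomogeneous a.1 ∧ plap p = 0 ∧ w a = polyL n p := by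
    intro a
    obtain ⟨p, hp, h⟩ := (e a.1 a.2).2
    exact ⟨p, hp.1, hp.2, h.symm⟩
  choose P hP using hP
  refine ⟨_, HilbertBasis.mk hw hspan, fun a => a.1, P, fun i => ?_, fun K => ?_⟩
  · rw [HilbertBasis.coe_mk]; exact hP i
  · have hfin : (⋃ j ∈ Set.Iic K, Set.range
        (fun i : Fin (Module.finrank ℂ (Hj n j)) => (⟨j, i⟩ : Σ j, Fin (Module.finrank ℂ (Hj n j))))).Finite :=
      (Set.finite_Iic K).biUnion (fun j _ => Set.finite_range _)
    refine hfin.subset ?_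
    rintro ⟨j, i⟩ hj
    exact Set.mem_biUnion (x := j) hj ⟨i, rfl⟩
end HB

open MeasureTheory Metric Set Filter
open scoped RealInnerProductSpace

section Half
open Topology InnerProductSpace Laplacian

/-- the half space -/
def Hs {n : ℕ} (v : Eu n) : Set (Eu n) := {x | 0 < ⟪x, v⟫}

lemma Hs_open {n : ℕ} (v : Eu n) : IsOpen (Hs v) := isOpen_lt continuous_const (by fun_prop)

lemma Hs_ne_zero {n : ℕ} {v x : Eu n} (hx : x ∈ Hs v) : x ≠ 0 := by
  rintro rfl; simp [Hs] at hx

lemma Hs_closure {n : ℕ} {v : Eu n} (hv : v ≠ 0) : closure (Hs v) = {x | 0 ≤ ⟪x, v⟫} := by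
  apply Subset.antisymm
  · exact closure_minimal (fun x (hx : 0 < ⟪x, v⟫) => hx.le) (isClosed_le continuous_const (by fun_prop))
  · intro x (hx : 0 ≤ ⟪x, v⟫)
    have h1 : Tendsto (fun t : ℝ => x + t • v) (𝓝[>] 0) (𝓝 x) := by
      have : Tendsto (fun t : ℝ => x + t • v) (𝓝 0) (𝓝 (x + (0:ℝ) • v)) := by
        apply Continuous.tendsto; fun_prop
      simpa using this.mono_left nhdsWithin_le_nhds
    refine mem_closure_of_tendsto h1 ?_
    filter_upwards [self_mem_nhdsWithin] with t (ht : 0 < t)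
    simp only [Hs, mem_setOf_eq, inner_add_left, inner_smul_left]
    have : 0 < ⟪v, v⟫ := real_inner_self_pos.2 hv
    simp only [conj_trivial]
    positivity

lemma Hs_frontier {n : ℕ} {v : Eu n} (hv : v ≠ 0) : frontier (Hs v) = {x | ⟪x, v⟫ = 0} := by
  rw [frontier, Hs_closure hv, (Hs_open v).interior_eq]
  ext x
  simp only [Hs, mem_diff, mem_setOf_eq, not_lt]
  exact ⟨fun h => le_antisymm h.2 h.1, fun h => ⟨h.ge, h.le⟩⟩

lemma half_div {n : ℕ} {v : Eu n} {K : Eu n → ℂ} {C R : ℝ} (e : Eu n)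
    (hK : ∀ x ∈ Hs v, ContDiffAt ℝ 1 K x) (hb : ∀ x ∈ Hs v, ‖K x‖ ≤ C * ⟪x, v⟫)
    (hR : ∀ x ∈ Hs v, R < ‖x‖ → K x = 0) (hd : ∀ x ∈ Hs v, ‖fderiv ℝ K x e‖ ≤ C) :
    ∫ x in Hs v, fderiv ℝ K x e = 0 := by
  set χ : ℝ → ℝ := fun t => Real.smoothTransition (t - 1) with hχ
  have hχc : ContDiff ℝ 1 χ := Real.smoothTransition.contDiff.comp (contDiff_id.sub contDiff_const)
  have hχ0 : ∀ t ≤ 1, χ t = 0 := fun t ht => Real.smoothTransition.zero_of_nonpos (by linarith)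
  have hχ1 : ∀ t, 2 ≤ t → χ t = 1 := fun t ht => Real.smoothTransition.one_of_one_le (by linarith)
  have hχ2 : ∀ t, |χ t| ≤ 1 := fun t => by
    rw [abs_of_nonneg (Real.smoothTransition.nonneg _)]; exact Real.smoothTransition.le_one _
  obtain ⟨M, hM⟩ := (isCompact_Icc (a := (0:ℝ)) (b := 3)).exists_bound_of_continuousOn
    (hχc.continuous_deriv le_rfl).continuousOn
  have hM0 : 0 ≤ M := (norm_nonneg _).trans (hM 0 (by simp))
  have hχd0 : ∀ t, t < 1 → deriv χ t = 0 := by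
    intro t ht
    have : χ =ᶠ[𝓝 t] fun _ => 0 := by
      filter_upwards [Iio_mem_nhds ht] with s hs using hχ0 s (le_of_lt hs)
    rw [this.deriv_eq]; simp
  have hχd2 : ∀ t, 2 < t → deriv χ t = 0 := by
    intro t ht
    have : χ =ᶠ[𝓝 t] fun _ => 1 := by
      filter_upwards [Ioi_mem_nhds ht] with s hs using hχ1 s (le_of_lt hs)
    rw [this.deriv_eq]; simp
  have hχd : ∀ t, 0 ≤ t → |deriv χ t| * t ≤ 2 * M := by
    intro t ht
    by_cases h2 : 2 < t
    · rw [hχd2 t h2]; simpa using hM0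
    · have := hM t ⟨ht, by linarith⟩
      rw [Real.norm_eq_abs] at this
      have h3 : 0 ≤ |deriv χ t| := abs_nonneg _
      nlinarith
  set δ : ℕ → ℝ := fun k => 1 / ((k : ℝ) + 1) with hδ
  have hδp : ∀ k, 0 < δ k := fun k => by positivity
  set Kd : ℕ → Eu n → ℂ := fun k x => ((χ (⟪x, v⟫ / δ k) : ℝ) : ℂ) * K x with hKd
  have hout : ∀ k, ∀ x ∉ Hs v, Kd k =ᶠ[𝓝 x] fun _ => 0 := by
    intro k x hx
    have hx' : ⟪x, v⟫ < δ k := lt_of_le_of_lt (not_lt.1 hx) (hδp k)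
    have hcont : Continuous fun y : Eu n => ⟪y, v⟫ := by fun_prop
    filter_upwards [hcont.continuousAt.eventually (gt_mem_nhds hx')] with y hy
    simp only [hKd]
    rw [hχ0 _ ((div_le_one (hδp k)).2 hy.le)]; simp
  have hin : ∀ k, ∀ x, HasFDerivAt (fun y : Eu n => ((χ (⟪y, v⟫ / δ k) : ℝ) : ℂ))
      (Complex.ofRealCLM.comp ((deriv χ (⟪x, v⟫ / δ k)) • ((δ k)⁻¹ • innerSL ℝ v))) x := by
    intro k x
    have h1 : HasFDerivAt (fun y : Eu n => ⟪y, v⟫ / δ k) ((δ k)⁻¹ • innerSL ℝ v) x := by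
      have : (fun y : Eu n => ⟪y, v⟫ / δ k) = ((δ k)⁻¹ • innerSL ℝ v : Eu n →L[ℝ] ℝ) := by
        ext y; simp [real_inner_comm, div_eq_inv_mul]
      rw [this]
      exact ContinuousLinearMap.hasFDerivAt _
    have h2 : HasDerivAt χ (deriv χ (⟪x, v⟫ / δ k)) (⟪x, v⟫ / δ k) :=
      (hχc.differentiable (by norm_num) _).hasDerivAt
    have h3 := h2.comp_hasFDerivAt x h1
    exact Complex.ofRealCLM.hasFDerivAt.comp x h3
  have hKdC : ∀ k, ContDiff ℝ 1 (Kd k) := by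
    intro k
    rw [contDiff_iff_contDiffAt]
    intro x
    by_cases hx : x ∈ Hs v
    · refine ContDiffAt.mul ?_ (hK x hx)
      have h2 : ContDiff ℝ 1 (fun y : Eu n => χ (⟪y, v⟫ / δ k)) :=
        hχc.comp ((contDiff_id.inner ℝ contDiff_const).div_const _)
      exact (Complex.ofRealCLM.contDiff.comp h2).contDiffAt
    · exact contDiffAt_const.congr_of_eventuallyEq (hout k x hx)
  have hKdS : ∀ k, HasCompactSupport (Kd k) := by
    intro k
    refine HasCompactSupport.intro (isCompact_closedBall (0 : Eu n) R) ?_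
    intro x hx
    by_cases hxH : x ∈ Hs v
    · simp only [hKd]; rw [hR x hxH (by simpa using hx)]; simp
    · exact (hout k x hxH).eq_of_nhds
  have hz : ∀ k, ∫ x in Hs v, fderiv ℝ (Kd k) x e = 0 := by
    intro k
    rw [← div0 (hKdC k) (hKdS k) e]
    apply setIntegral_eq_integral_of_forall_compl_eq_zero
    intro x hx
    rw [(hout k x hx).fderiv_eq]; simp
  have hform : ∀ k, ∀ x ∈ Hs v, fderiv ℝ (Kd k) x e =
      ((χ (⟪x, v⟫ / δ k) : ℝ) : ℂ) * fderiv ℝ K x e +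
        ((deriv χ (⟪x, v⟫ / δ k) * ((δ k)⁻¹ * ⟪v, e⟫) : ℝ) : ℂ) * K x := by
    intro k x hx
    have h1 := (hin k x).mul ((hK x hx).differentiableAt (by norm_num)).hasFDerivAt
    have h2 : fderiv ℝ (Kd k) x = _ := h1.fderiv
    rw [h2]
    simp
    ring
  have hlim : Tendsto (fun k => ∫ x in Hs v, fderiv ℝ (Kd k) x e) atTop (𝓝 (∫ x in Hs v, fderiv ℝ K x e)) := by
    refine tendsto_integral_of_dominated_convergence
      ((closedBall (0 : Eu n) R).indicator fun _ => C + 2 * M * |⟪v, e⟫| * C) ?_ ?_ ?_ ?_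
    · intro k
      exact (((hKdC k).continuous_fderiv (by norm_num)).clm_apply continuous_const).aestronglyMeasurable
    · refine Integrable.integrableOn ?_
      rw [integrable_indicator_iff measurableSet_closedBall]
      exact integrableOn_const (measure_closedBall_lt_top.ne)
    · intro k
      rw [ae_restrict_iff' (Hs_open v).measurableSet]
      filter_upwards with x hx
      by_cases hxR : x ∈ closedBall (0 : Eu n) R
      · rw [indicator_of_mem hxR, hform k x hx]
        have hx0 : 0 < ⟪x, v⟫ := hx
        have hC : 0 ≤ C := (norm_nonneg _).trans (hd x hx)
        refine (norm_add_le _ _).trans (add_le_add ?_ ?_)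
        · rw [norm_mul, Complex.norm_real, Real.norm_eq_abs]
          calc _ ≤ 1 * C := mul_le_mul (hχ2 _) (hd x hx) (norm_nonneg _) zero_le_one
            _ = C := one_mul _
        · rw [norm_mul, Complex.norm_real, Real.norm_eq_abs, abs_mul, abs_mul,
            abs_of_pos (inv_pos.2 (hδp k))]
          have h3 := hχd (⟪x, v⟫ / δ k) (by have := hδp k; positivity)
          calc |deriv χ (⟪x, v⟫ / δ k)| * ((δ k)⁻¹ * |⟪v, e⟫|) * ‖K x‖
              ≤ |deriv χ (⟪x, v⟫ / δ k)| * ((δ k)⁻¹ * |⟪v, e⟫|) * (C * ⟪x, v⟫) := by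
                have := hδp k
                gcongr; exact hb x hx
            _ = (|deriv χ (⟪x, v⟫ / δ k)| * (⟪x, v⟫ / δ k)) * (|⟪v, e⟫| * C) := by
                ring
            _ ≤ 2 * M * (|⟪v, e⟫| * C) := by gcongr
            _ = _ := by ring
      · rw [indicator_of_notMem hxR]
        have hx2 : Kd k =ᶠ[𝓝 x] fun _ => 0 := by
          have hxR' : R < ‖x‖ := by simpa using hxR
          filter_upwards [continuous_norm.continuousAt.eventually (lt_mem_nhds hxR'), (Hs_open v).mem_nhds hx] with y hy hyH
          simp only [hKd]; rw [hR y hyH hy]; simp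
        rw [hx2.fderiv_eq]; simp
    · rw [ae_restrict_iff' (Hs_open v).measurableSet]
      filter_upwards with x hx
      have hx0 : 0 < ⟪x, v⟫ := hx
      refine tendsto_const_nhds.congr' ?_
      have ht : Tendsto (fun k : ℕ => ⟪x, v⟫ * ((k : ℝ) + 1)) atTop atTop :=
        Tendsto.const_mul_atTop hx0 (tendsto_atTop_add_const_right _ _ tendsto_natCast_atTop_atTop)
      filter_upwards [ht.eventually_gt_atTop 2] with k hk
      rw [hform k x hx]
      have hk' : ⟪x, v⟫ / δ k = ⟪x, v⟫ * ((k : ℝ) + 1) := by simp [hδ]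
      rw [hk', hχ1 _ hk.le, hχd2 _ hk]; simp
  simp_rw [hz] at hlim
  exact (tendsto_nhds_unique tendsto_const_nhds hlim).symm

lemma iterated_eq {n : ℕ} {F : Eu n → ℂ} (x : Eu n) (e : Eu n) (hF : ContDiffAt ℝ 2 F x) :
    fderiv ℝ (fun y => fderiv ℝ F y e) x e = iteratedFDeriv ℝ 2 F x ![e, e] := by
  rw [iteratedFDeriv_two_apply]
  have h1 : DifferentiableAt ℝ (fderiv ℝ F) x :=
    (hF.fderiv_right (m := 1) (by norm_num)).differentiableAt (by norm_num)
  rw [fderiv_clm_apply h1 (by fun_prop)]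
  simp

lemma Kf_fderiv {n : ℕ} {F G : Eu n → ℂ} {x : Eu n} (hF : ContDiffAt ℝ 2 F x)
    (hG : ContDiffAt ℝ 2 G x) (i : Fin n) :
    fderiv ℝ (Kf F G i) x (EuclideanSpace.single i 1) =
      iteratedFDeriv ℝ 2 F x ![EuclideanSpace.single i 1, EuclideanSpace.single i 1] * G x
       - F x * iteratedFDeriv ℝ 2 G x ![EuclideanSpace.single i 1, EuclideanSpace.single i 1] := by
  have h1 : DifferentiableAt ℝ (fderiv ℝ F) x :=
    (hF.fderiv_right (m := 1) (by norm_num)).differentiableAt (by norm_num)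
  have h2 : DifferentiableAt ℝ (fderiv ℝ G) x :=
    (hG.fderiv_right (m := 1) (by norm_num)).differentiableAt (by norm_num)
  have f1 : DifferentiableAt ℝ F x := hF.differentiableAt (by norm_num)
  have f2 : DifferentiableAt ℝ G x := hG.differentiableAt (by norm_num)
  have d1 : DifferentiableAt ℝ (fun y => fderiv ℝ F y (EuclideanSpace.single i 1)) x :=
    h1.clm_apply (by fun_prop)
  have d2 : DifferentiableAt ℝ (fun y => fderiv ℝ G y (EuclideanSpace.single i 1)) x :=
    h2.clm_apply (by fun_prop)
  have : fderiv ℝ (Kf F G i) x = _ := ((d1.hasFDerivAt.mul f2.hasFDerivAt).sub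
    (f1.hasFDerivAt.mul d2.hasFDerivAt)).fderiv
  rw [this, ← iterated_eq x _ hF, ← iterated_eq x _ hG]
  simp
  ring

lemma norm_itf_le {n : ℕ} {F : Eu n → ℂ} {x : Eu n} {i : Fin n} :
   ‖iteratedFDeriv ℝ 2 F x ![EuclideanSpace.single i 1, EuclideanSpace.single i 1]‖ ≤ ‖iteratedFDeriv ℝ 2 F x‖ := by
  refine (ContinuousMultilinearMap.le_opNorm _ _).trans ?_
  simp [Fin.prod_univ_two]

lemma green_half {n : ℕ} {v : Eu n} {F G : Eu n → ℂ} {C ε R : ℝ} (hε : 0 < ε)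
    (hF : ∀ x ∈ Hs v, ContDiffAt ℝ 2 F x) (hF0 : ∀ x ∈ Hs v, ‖F x‖ ≤ C * ⟪x, v⟫) (hFb : ∀ x ∈ Hs v, ‖F x‖ ≤ C)
    (hF1 : ∀ x ∈ Hs v, ‖fderiv ℝ F x‖ ≤ C) (hF2 : ∀ x ∈ Hs v, ‖iteratedFDeriv ℝ 2 F x‖ ≤ C)
    (hFε : ∀ x, ‖x‖ < ε → F x = 0) (hFR : ∀ x, R < ‖x‖ → F x = 0)
    (hG : ∀ x, x ≠ 0 → ContDiffAt ℝ 2 G x) {C' : ℝ}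
    (hG0 : ∀ x ∈ Hs v, ε ≤ ‖x‖ → ‖x‖ ≤ R → ‖G x‖ ≤ C' * ⟪x, v⟫) :
    ∫ x in Hs v, ((Δ F) x * G x - F x * (Δ G) x) = 0 := by
  set A : Set (Eu n) := closedBall 0 R \ ball 0 ε with hA
  have hAc : IsCompact A := (isCompact_closedBall _ _).diff isOpen_ball
  have hA0 : ∀ x ∈ A, x ≠ 0 := by
    rintro x hx rfl
    exact hx.2 (by simpa using hε)
  have hmemA : ∀ x : Eu n, x ∈ A ↔ ε ≤ ‖x‖ ∧ ‖x‖ ≤ R := by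
    intro x; simp [hA, and_comm]
  obtain ⟨B0, hB0⟩ := hAc.exists_bound_of_continuousOn (f := G)
    (fun x hx => (hG x (hA0 x hx)).continuousAt.continuousWithinAt)
  obtain ⟨B1, hB1⟩ := hAc.exists_bound_of_continuousOn (f := fderiv ℝ G)
    (fun x hx => ((hG x (hA0 x hx)).fderiv_right (m := 1) (by norm_num)).continuousAt.continuousWithinAt)
  obtain ⟨B2, hB2⟩ := hAc.exists_bound_of_continuousOn (f := iteratedFDeriv ℝ 2 G)
    (fun x hx => ((hG x (hA0 x hx)).iteratedFDeriv_right (m := 0) (i := 2) (by norm_num)).continuousAt.continuousWithinAt)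
  have hnear : ∀ x ∈ Hs v, x ∉ A → F =ᶠ[𝓝 x] 0 := by
    intro x hxH hx
    rw [hmemA, not_and_or, not_le, not_le] at hx
    rcases hx with hx | hx
    · filter_upwards [continuous_norm.continuousAt.eventually (gt_mem_nhds hx)] with y hy using hFε y hy
    · filter_upwards [continuous_norm.continuousAt.eventually (lt_mem_nhds hx)] with y hy using hFR y hy
  have hC : (Hs v).Nonempty → 0 ≤ C := fun ⟨x, hx⟩ => (norm_nonneg _).trans (hFb x hx)
  have hKf : ∀ i, ∀ x ∈ Hs v, ‖fderiv ℝ (Kf F G i) x (EuclideanSpace.single i 1)‖ ≤ C * |B0| + C * |B2| := by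
    intro i x hx
    have hC := hC ⟨x, hx⟩
    by_cases hxA : x ∈ A
    · rw [Kf_fderiv (hF x hx) (hG x (Hs_ne_zero hx)) i]
      refine (norm_sub_le _ _).trans ?_
      rw [norm_mul, norm_mul]
      gcongr
      · exact norm_itf_le.trans (hF2 x hx)
      · exact (hB0 x hxA).trans (le_abs_self _)
      · exact hFb x hx
      · exact norm_itf_le.trans ((hB2 x hxA).trans (le_abs_self _))
    · rw [(Kf_zero (hnear x hx hxA) i).fderiv_eq]
      simp; positivity
  have hdiv : ∀ i, ∫ x in Hs v, fderiv ℝ (Kf F G i) x (EuclideanSpace.single i 1) = 0 := by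
    intro i
    refine half_div (C := C * |C'| + C * |B1| + (C * |B0| + C * |B2|)) (R := R) _
      (fun x hx => Kf_contDiffAt (hF x hx) (hG x (Hs_ne_zero hx)) i) ?_ ?_ ?_
    · intro x hx
      have hC := hC ⟨x, hx⟩
      have hx0 : 0 < ⟪x, v⟫ := hx
      by_cases hxA : x ∈ A
      · unfold Kf
        have a1 : ‖fderiv ℝ F x (EuclideanSpace.single i 1)‖ ≤ C :=
          ((fderiv ℝ F x).le_opNorm _).trans (by simpa using hF1 x hx)
        have a2 : ‖fderiv ℝ G x (EuclideanSpace.single i 1)‖ ≤ |B1| :=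
          ((fderiv ℝ G x).le_opNorm _).trans (by simpa using (hB1 x hxA).trans (le_abs_self _))
        have a3 : ‖G x‖ ≤ |C'| * ⟪x, v⟫ := by
          refine (hG0 x hx ((hmemA x).1 hxA).1 ((hmemA x).1 hxA).2).trans ?_
          gcongr; exact le_abs_self _
        refine (norm_sub_le _ _).trans ?_
        rw [norm_mul, norm_mul]
        calc _ ≤ C * (|C'| * ⟪x, v⟫) + (C * ⟪x, v⟫) * |B1| := by
              gcongr; exact hF0 x hx
          _ ≤ (C * |C'| + C * |B1| + (C * |B0| + C * |B2|)) * ⟪x, v⟫ := by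
              have : 0 ≤ (C * |B0| + C * |B2|) * ⟪x, v⟫ := by positivity
              nlinarith
      · rw [(Kf_zero (hnear x hx hxA) i).eq_of_nhds]
        simp only [Pi.zero_apply, norm_zero]; positivity
    · intro x hx hxR
      refine (Kf_zero (hnear x hx ?_) i).eq_of_nhds
      rw [hmemA]; intro h; linarith
    · intro x hx
      refine (hKf i x hx).trans ?_
      have hC := hC ⟨x, hx⟩
      have : 0 ≤ C * |C'| + C * |B1| := by positivity
      linarith
  have hpt : ∀ x ∈ Hs v, (Δ F) x * G x - F x * (Δ G) x =
      ∑ i, fderiv ℝ (Kf F G i) x (EuclideanSpace.single i 1) := fun x hx =>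
    (green_pt (hF x hx) (hG x (Hs_ne_zero hx))).symm
  rw [setIntegral_congr_fun (Hs_open v).measurableSet hpt, integral_finsetSum]
  · exact Finset.sum_eq_zero fun i _ => hdiv i
  · intro i _
    have hmeas : ContinuousOn (fun x => fderiv ℝ (Kf F G i) x (EuclideanSpace.single i 1)) (Hs v) := by
      intro x hx
      have := (Kf_contDiffAt (hF x hx) (hG x (Hs_ne_zero hx)) i).fderiv_right (m := 0) (by norm_num)
      exact (this.continuousAt.clm_apply continuousAt_const).continuousWithinAt
    have hsub : IntegrableOn (fun x => fderiv ℝ (Kf F G i) x (EuclideanSpace.single i 1)) (Hs v ∩ closedBall 0 R) := by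
      have hfin : volume (Hs v ∩ closedBall 0 R) < ⊤ :=
        (measure_mono inter_subset_right).trans_lt measure_closedBall_lt_top
      haveI : IsFiniteMeasure (volume.restrict (Hs v ∩ closedBall (0 : Eu n) R)) :=
        ⟨by rwa [Measure.restrict_apply_univ]⟩
      refine Integrable.of_bound (C := C * |B0| + C * |B2|) ?_ ?_
      · exact hmeas.aestronglyMeasurable (Hs_open v).measurableSet |>.mono_set inter_subset_left
      · rw [ae_restrict_iff' ((Hs_open v).measurableSet.inter measurableSet_closedBall)]
        filter_upwards with x hx using hKf i x hx.1
    refine hsub.of_forall_diff_eq_zero (Hs_open v).measurableSet ?_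
    intro x hx
    have hxA : x ∉ A := by
      intro h; exact hx.2 ⟨hx.1, h.1⟩
    rw [(Kf_zero (hnear x hx.1 hxA) i).fderiv_eq]; simp
end Half

open MeasureTheory Metric Set Filter
open scoped RealInnerProductSpace

section NavBounds
open Topology InnerProductSpace Laplacian

lemma half_bounds {n : ℕ} {v : Eu n} (hv : v ≠ 0) {u : Eu n → ℂ} {R : ℝ}
    (h1 : ContDiffOn ℝ 2 u (closure (Hs v))) (h2 : ∀ x ∈ frontier (Hs v), u x = 0)
    (h3 : ∀ x, R < ‖x‖ → u x = 0) :
    ∃ C : ℝ, 0 ≤ C ∧ (∀ x ∈ Hs v, ContDiffAt ℝ 2 u x) ∧ (∀ x ∈ Hs v, ‖u x‖ ≤ C * ⟪x, v⟫) ∧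
      (∀ x ∈ Hs v, ‖u x‖ ≤ C) ∧ (∀ x ∈ Hs v, ‖fderiv ℝ u x‖ ≤ C) ∧
      (∀ x ∈ Hs v, ‖iteratedFDeriv ℝ 2 u x‖ ≤ C) := by
  set K := closure (Hs v) with hK
  have hKeq := Hs_closure hv
  have hconv : Convex ℝ K := by
    rw [hK, hKeq]
    intro x (hx : 0 ≤ ⟪x, v⟫) y (hy : 0 ≤ ⟪y, v⟫) a b ha hb hab
    change 0 ≤ ⟪a • x + b • y, v⟫
    rw [inner_add_left, inner_smul_left, inner_smul_left]
    simp only [conj_trivial]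
    positivity
  have hvH : v ∈ Hs v := real_inner_self_pos.2 hv
  have hsub : Hs v ⊆ interior K := interior_maximal subset_closure (Hs_open v)
  have hU : UniqueDiffOn ℝ K := uniqueDiffOn_convex hconv ⟨v, hsub hvH⟩
  have hcd : ∀ x ∈ Hs v, ContDiffAt ℝ 2 u x := fun x hx =>
    h1.contDiffAt (mem_interior_iff_mem_nhds.1 (hsub hx))
  have hcomp : IsCompact (K ∩ closedBall 0 R) := (isCompact_closedBall _ _).inter_left isClosed_closure
  obtain ⟨C0, hC0⟩ := hcomp.exists_bound_of_continuousOn (h1.continuousOn.mono inter_subset_left)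
  obtain ⟨C1, hC1⟩ := hcomp.exists_bound_of_continuousOn
    ((h1.continuousOn_fderivWithin hU (by norm_num)).mono inter_subset_left)
  obtain ⟨C2, hC2⟩ := hcomp.exists_bound_of_continuousOn
    ((h1.continuousOn_iteratedFDerivWithin (m := 2) (by norm_num) hU).mono inter_subset_left)
  have hnear : ∀ x, R < ‖x‖ → u =ᶠ[𝓝 x] fun _ => 0 := fun x hx => by
    filter_upwards [(isOpen_lt continuous_const continuous_norm).mem_nhds hx] with y hy using h3 y hy
  have hd1 : ∀ x ∈ K, ‖fderivWithin ℝ u K x‖ ≤ |C1| := by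
    intro x hx
    by_cases hxR : ‖x‖ ≤ R
    · exact (hC1 x ⟨hx, by simpa using hxR⟩).trans (le_abs_self _)
    · push Not at hxR
      rw [((hnear x hxR).filter_mono nhdsWithin_le_nhds).fderivWithin_eq (h3 x hxR)]
      simp
  have hn : 0 < ‖v‖ := norm_pos_iff.2 hv
  refine ⟨|C0| + |C1| + |C1| / ‖v‖ + |C2|, by positivity, hcd, ?_, ?_, ?_, ?_⟩
  · intro x hx
    set y := x - (⟪x, v⟫ / ‖v‖ ^ 2) • v with hy
    have hyv : ⟪y, v⟫ = 0 := by
      rw [hy, inner_sub_left, inner_smul_left, real_inner_self_eq_norm_sq]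
      simp only [conj_trivial]
      field_simp; ring
    have hyK : y ∈ K := by rw [hK, hKeq]; exact hyv.ge
    have huy : u y = 0 := h2 y (by rw [Hs_frontier hv]; exact hyv)
    have := hconv.norm_image_sub_le_of_norm_fderivWithin_le (h1.differentiableOn (by norm_num)) hd1 hyK
      (subset_closure hx)
    rw [huy, sub_zero] at this
    refine this.trans ?_
    have hx' : 0 < ⟪x, v⟫ := hx
    have : x - y = (⟪x, v⟫ / ‖v‖ ^ 2) • v := by rw [hy]; abel
    rw [this, norm_smul, Real.norm_of_nonneg (by positivity)]
    have e : |C1| * (⟪x, v⟫ / ‖v‖ ^ 2 * ‖v‖) = (|C1| / ‖v‖) * ⟪x, v⟫ := by field_simp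
    rw [e]
    gcongr
    have := abs_nonneg C0; have := abs_nonneg C1; have := abs_nonneg C2
    linarith
  · intro x hx
    have : ‖u x‖ ≤ |C0| := by
      by_cases hxR : ‖x‖ ≤ R
      · exact (hC0 x ⟨subset_closure hx, by simpa using hxR⟩).trans (le_abs_self _)
      · rw [h3 x (not_le.1 hxR)]; simp
    have : 0 ≤ |C1| + |C1| / ‖v‖ + |C2| := by positivity
    linarith
  · intro x hx
    have h := hd1 x (subset_closure hx)
    rw [fderivWithin_of_mem_nhds (mem_interior_iff_mem_nhds.1 (hsub hx))] at h
    have : 0 ≤ |C0| + |C1| / ‖v‖ + |C2| := by positivity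
    linarith
  · intro x hx
    have : ‖iteratedFDeriv ℝ 2 u x‖ ≤ |C2| := by
      by_cases hxR : ‖x‖ ≤ R
      · rw [← iteratedFDerivWithin_eq_iteratedFDeriv hU (hcd x hx) (subset_closure hx)]
        exact (hC2 x ⟨subset_closure hx, by simpa using hxR⟩).trans (le_abs_self _)
      · rw [((hnear x (not_le.1 hxR)).iteratedFDeriv ℝ 2).eq_of_nhds]
        simp
    have : 0 ≤ |C0| + |C1| + |C1| / ‖v‖ := by positivity
    linarith

/-- Data of an annulus-supported pair satisfying the weak harmonic relation. -/
structure HPair {n : ℕ} (F L : Eu n → ℂ) : Prop where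
  mF : Measurable F
  mL : Measurable L
  bd : ∃ C : ℝ, (∀ x, ‖F x‖ ≤ C) ∧ ∀ x, ‖L x‖ ≤ C
  near : ∃ ε > 0, ∀ x, ‖x‖ < ε → F x = 0 ∧ L x = 0
  far : ∃ R : ℝ, ∀ x, R < ‖x‖ → F x = 0 ∧ L x = 0
  rel : ∀ (j : ℕ) (p : RPoly n), p.IsHomogeneous j → plap p = 0 → ∀ w : ℂ,
    ∫ x, L x * Nf (fun s => Complex.exp (w * s)) p x =
      w * (w + n - 2 + 2 * j) * ∫ x, F x * Nf (fun s => Complex.exp ((w - 2) * s)) p x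

lemma Nf_exp_lap {n j : ℕ} {p : RPoly n} (hp : p.IsHomogeneous j) (hpl : plap p = 0) (w : ℂ) {x : Eu n}
    (hx : x ≠ 0) : (Δ (Nf (fun s => Complex.exp (w * s)) p)) x =
      w * (w + n - 2 + 2 * j) * Nf (fun s => Complex.exp ((w - 2) * s)) p x := by
  have hf : ContDiff ℝ 2 (fun s : ℝ => Complex.exp (w * s)) :=
    (contDiff_const.mul Complex.ofRealCLM.contDiff).cexp
  have hd : deriv (fun s : ℝ => Complex.exp (w * s)) = fun s : ℝ => w * Complex.exp (w * s) := by
    ext s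
    have : HasDerivAt (fun s : ℝ => w * (s : ℂ)) (w * 1) s :=
      (Complex.ofRealCLM.hasDerivAt (x := s)).const_mul w
    rw [this.cexp.deriv]; ring
  rw [Nf_laplacian hf hp hpl hx]
  have hd2 : deriv (fun s : ℝ => w * Complex.exp (w * s)) = fun s : ℝ => w * (w * Complex.exp (w * s)) := by
    ext s
    rw [deriv_const_mul_field, congrFun hd s]
  simp only [hd, hd2, Nf]
  have : Complex.exp ((w - 2) * (Real.log ‖x‖ : ℝ)) =
    (Real.exp (-2 * Real.log ‖x‖) : ℂ) * Complex.exp (w * (Real.log ‖x‖ : ℝ)) := by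
    push_cast; rw [← Complex.exp_add]; congr 1; ring
  rw [this]; ring
end NavBounds

open MeasureTheory Metric Set Filter
open scoped RealInnerProductSpace

section Pairs
open Topology InnerProductSpace Laplacian

lemma ann_integrable {n : ℕ} {F g : Eu n → ℂ} {C ε R : ℝ} (hε : 0 < ε) (mF : Measurable F)
    (hC : ∀ x, ‖F x‖ ≤ C) (h1 : ∀ x, ‖x‖ < ε → F x = 0) (h2 : ∀ x, R < ‖x‖ → F x = 0)
    (hg : ∀ x, x ≠ 0 → ContinuousAt g x) : Integrable (fun x => F x * g x) := by
  set A : Set (Eu n) := closedBall 0 R ∩ {x | ε ≤ ‖x‖} with hA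
  have hAc : IsCompact A := (isCompact_closedBall _ _).inter_right (isClosed_le continuous_const continuous_norm)
  have hgA : ContinuousOn g A := fun x hx => (hg x (by
    rintro rfl; have := hx.2; simp at this; linarith)).continuousWithinAt
  have h3 : IntegrableOn (fun x => F x * g x) A :=
    (hgA.integrableOn_compact hAc).bdd_mul (c := C) mF.aestronglyMeasurable
     (Eventually.of_forall hC)
  rw [← integrableOn_univ]
  refine h3.of_forall_sdiff_eq_zero MeasurableSet.univ ?_
  rintro x ⟨-, hx⟩
  have : F x = 0 := by
    by_cases h : ‖x‖ < ε
    · exact h1 x h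
    · refine h2 x ?_
      by_contra h'
      exact hx ⟨by simpa using not_lt.1 h', not_lt.1 h⟩
  simp [this]

lemma Nf_exp_contDiffAt {n : ℕ} (w : ℂ) (p : RPoly n) {x : Eu n} (hx : x ≠ 0) :
    ContDiffAt ℝ 2 (Nf (fun s => Complex.exp (w * s)) p) x :=
  Nf_contDiffAt (k := 2) (contDiff_const.mul Complex.ofRealCLM.contDiff).cexp p hx

lemma lap_ofReal {n : ℕ} {u : Eu n → ℝ} {x : Eu n} (hu : ContDiffAt ℝ 2 u x) :
    (Δ (fun y => (u y : ℂ))) x = (lap u x : ℂ) := by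
  rw [lap_eq_laplacian]
  have := hu.laplacian_CLM_comp_left (l := Complex.ofRealCLM)
  simpa [Function.comp_def] using this

lemma lap_zero {n : ℕ} {u : Eu n → ℝ} {x : Eu n} (hu : u =ᶠ[𝓝 x] fun _ => 0) : lap u x = 0 := by
  unfold lap
  refine Finset.sum_eq_zero fun i _ => ?_
  rw [(hu.iteratedFDeriv ℝ 2).eq_of_nhds]
  simp

lemma lap_contAt {n : ℕ} {u : Eu n → ℝ} {x : Eu n} (hu : ContDiffAt ℝ 2 u x) : ContinuousAt (lap u) x := by
  unfold lap
  have h : ContinuousAt (iteratedFDeriv ℝ 2 u) x :=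
    (hu.iteratedFDeriv_right (m := 0) (i := 2) (by norm_num)).continuousAt
  refine tendsto_finsetSum _ fun i _ => ?_
  exact ((ContinuousMultilinearMap.apply ℝ (fun _ : Fin 2 => Eu n) ℝ
    ![EuclideanSpace.single i 1, EuclideanSpace.single i 1]).continuous.continuousAt (x := iteratedFDeriv ℝ 2 u x)).comp h

lemma zero_near {n : ℕ} {u : Eu n → ℝ} {ε : ℝ} (h : ∀ x, ‖x‖ < ε → u x = 0) (x : Eu n) (hx : ‖x‖ < ε) :
    u =ᶠ[𝓝 x] fun _ => 0 := by
  filter_upwards [(isOpen_lt continuous_norm continuous_const).mem_nhds hx] with y hy using h y hy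

lemma zero_far {n : ℕ} {u : Eu n → ℝ} {R : ℝ} (h : ∀ x, R < ‖x‖ → u x = 0) (x : Eu n) (hx : R < ‖x‖) :
    u =ᶠ[𝓝 x] fun _ => 0 := by
  filter_upwards [(isOpen_lt continuous_const continuous_norm).mem_nhds hx] with y hy using h y hy

lemma dir_near_far {n : ℕ} {v : Eu n} {u : Eu n → ℝ} (hu : DirichletAdm (Hs v) u) :
    (∃ ε > 0, ∀ x, ‖x‖ < ε → u x = 0) ∧ ∃ R, ∀ x, R < ‖x‖ → u x = 0 := by
  obtain ⟨h1, h2, h3⟩ := hu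
  constructor
  · have h0 : (0 : Eu n) ∉ tsupport u := fun h => Hs_ne_zero (h3 h) rfl
    obtain ⟨ε, hε, hb⟩ := Metric.isOpen_iff.1 (isClosed_tsupport u).isOpen_compl 0 h0
    exact ⟨ε, hε, fun x hx => image_eq_zero_of_notMem_tsupport (hb (by simpa using hx))⟩
  · obtain ⟨R, hR⟩ := h2.isBounded.subset_closedBall 0
    refine ⟨R, fun x hx => image_eq_zero_of_notMem_tsupport fun h => ?_⟩
    have := hR h
    simp at this; linarith

lemma hpair_dirichlet {n : ℕ} {v : Eu n} {u : Eu n → ℝ} (hu : DirichletAdm (Hs v) u) :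
    HPair (fun x => (u x : ℂ)) (fun x => (lap u x : ℂ)) := by
  obtain ⟨⟨ε, hε, hn⟩, R, hR⟩ := dir_near_far hu
  obtain ⟨h1, h2, h3⟩ := hu
  have cu : Continuous (fun x => (u x : ℂ)) := Complex.continuous_ofReal.comp h1.continuous
  have cl : Continuous (fun x => (lap u x : ℂ)) := Complex.continuous_ofReal.comp
    (continuous_iff_continuousAt.2 fun x => lap_contAt h1.contDiffAt)
  have su : HasCompactSupport (fun x => (u x : ℂ)) := h2.comp_left (g := fun t : ℝ => (t : ℂ)) (by simp)
  have lfar : ∀ x, R < ‖x‖ → (lap u x : ℂ) = 0 := fun x hx => by rw [lap_zero (zero_far hR x hx)]; simp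
  have lnear : ∀ x, ‖x‖ < ε → (lap u x : ℂ) = 0 := fun x hx => by rw [lap_zero (zero_near hn x hx)]; simp
  have sl : HasCompactSupport (fun x => (lap u x : ℂ)) :=
    HasCompactSupport.intro (isCompact_closedBall (0 : Eu n) R) fun x hx => lfar x (by simpa using hx)
  obtain ⟨C1, hC1⟩ := su.exists_bound_of_continuous cu
  obtain ⟨C2, hC2⟩ := sl.exists_bound_of_continuous cl
  refine ⟨cu.measurable, cl.measurable, ⟨max C1 C2, fun x => (hC1 x).trans (le_max_left _ _),
    fun x => (hC2 x).trans (le_max_right _ _)⟩, ⟨ε, hε, fun x hx => ⟨by simp [hn x hx], lnear x hx⟩⟩,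
    ⟨R, fun x hx => ⟨by simp [hR x hx], lfar x hx⟩⟩, ?_⟩
  intro j p hp hpl w
  have hg := green_compact (F := fun x => (u x : ℂ)) (G := Nf (fun s => Complex.exp (w * s)) p)
    (Complex.ofRealCLM.contDiff.comp h1) su (fun x hx => Nf_exp_contDiffAt w p ?_)
  · have e : ∀ x, (Δ (fun x => (u x : ℂ))) x * Nf (fun s => Complex.exp (w * s)) p x -
        (u x : ℂ) * (Δ (Nf (fun s => Complex.exp (w * s)) p)) x =
        (lap u x : ℂ) * Nf (fun s => Complex.exp (w * s)) p x - w * (w + n - 2 + 2 * j) *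
         ((u x : ℂ) * Nf (fun s => Complex.exp ((w - 2) * s)) p x) := by
      intro x
      rw [lap_ofReal h1.contDiffAt]
      by_cases hx : x = 0
      · have : u x = 0 := hn x (by simpa [hx] using hε)
        simp [this]
      · rw [Nf_exp_lap hp hpl w hx]; ring
    simp only [e] at hg
    rw [integral_sub, integral_const_mul, sub_eq_zero] at hg
    · exact hg
    · exact ann_integrable hε cl.measurable hC2 lnear lfar fun x hx => (Nf_exp_contDiffAt w p hx).continuousAt
    · refine Integrable.const_mul ?_ _
      exact ann_integrable (R := R) hε cu.measurable hC1 (fun x hx => by simp [hn x hx]) (fun x hx => by simp [hR x hx])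
        fun x hx => (Nf_exp_contDiffAt _ p hx).continuousAt
  · have : tsupport (fun x => (u x : ℂ)) ⊆ tsupport u := closure_mono fun x hx => by
      simpa using hx
    exact Hs_ne_zero (h3 (this hx))
end Pairs

open MeasureTheory Metric Set Filter
open scoped RealInnerProductSpace

section NavPair
open Topology InnerProductSpace Laplacian

/-- reflection across the hyperplane orthogonal to `v` -/
noncomputable def Rf {n : ℕ} (v : Eu n) : Eu n ≃ₗᵢ[ℝ] Eu n := (ℝ ∙ v)ᗮ.reflection

lemma Rf_apply {n : ℕ} {v : Eu n} (x : Eu n) : Rf v x = x - (2 * (⟪x, v⟫ / ‖v‖ ^ 2)) • v := by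
  unfold Rf
  rw [Submodule.reflection_orthogonal_apply, Submodule.reflection_singleton_apply]
  rw [real_inner_comm]
  simp [mul_smul, two_smul]

lemma Rf_Rf {n : ℕ} (v : Eu n) (x : Eu n) : Rf v (Rf v x) = x := Submodule.reflection_reflection _ _

lemma Rf_inner {n : ℕ} {v : Eu n} (hv : v ≠ 0) (x : Eu n) : ⟪Rf v x, v⟫ = - ⟪x, v⟫ := by
  have hn : 0 < ‖v‖ := norm_pos_iff.2 hv
  rw [Rf_apply, inner_sub_left, inner_smul_left, real_inner_self_eq_norm_sq]
  simp only [conj_trivial]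
  field_simp; ring

lemma pev_lip {n : ℕ} (p : RPoly n) (R : ℝ) : ∃ K : ℝ, 0 ≤ K ∧ ∀ x y : Eu n, ‖x‖ ≤ R → ‖y‖ ≤ R →
    ‖pev p x - pev p y‖ ≤ K * ‖x - y‖ := by
  have h1 : ContDiff ℝ 1 (pev p) := by simpa using pev_contDiff p 1
  obtain ⟨K, hK⟩ := (isCompact_closedBall (0 : Eu n) R).exists_bound_of_continuousOn
    (h1.continuous_fderiv (by norm_num)).continuousOn
  refine ⟨|K|, abs_nonneg _, fun x y hx hy => ?_⟩
  refine (convex_closedBall (0 : Eu n) R).norm_image_sub_le_of_norm_fderiv_le (𝕜 := ℝ) (f := pev p)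
    (fun z _ => h1.differentiable (by norm_num) z) (fun z hz => (hK z hz).trans (le_abs_self _)) (by simpa using hy)
    (by simpa using hx)

/-- odd extension -/
noncomputable def oddx {n : ℕ} (v : Eu n) (F : Eu n → ℂ) (x : Eu n) : ℂ :=
  (Hs v).indicator F x - (Hs v).indicator F (Rf v x)

lemma oddx_int {n : ℕ} {v : Eu n} {F h : Eu n → ℂ} {C ε R : ℝ} (hε : 0 < ε)
    (mF : Measurable ((Hs v).indicator F)) (hC : ∀ x, ‖(Hs v).indicator F x‖ ≤ C)
    (h1 : ∀ x, ‖x‖ < ε → (Hs v).indicator F x = 0)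
    (h2 : ∀ x, R < ‖x‖ → (Hs v).indicator F x = 0) (hh : ∀ x, x ≠ 0 → ContinuousAt h x) :
    ∫ x, oddx v F x * h x = ∫ x in Hs v, F x * (h x - h (Rf v x)) := by
  have hR : ∀ x, x ≠ 0 → ContinuousAt (fun x => h (Rf v x)) x := fun x hx =>
    ContinuousAt.comp (g := h) (hh (Rf v x) (by simpa using hx)) (Rf v).continuous.continuousAt
  have i1 := ann_integrable hε mF hC h1 h2 hh
  have i2 := ann_integrable hε mF hC h1 h2 hR
  have i3 : Integrable (fun x => (Hs v).indicator F (Rf v x) * h x) := by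
    have := (Rf v).measurePreserving.integrable_comp_of_integrable i2
    simpa [Function.comp_def, Rf_Rf] using this
  have e3 : ∫ x, (Hs v).indicator F (Rf v x) * h x = ∫ x, (Hs v).indicator F x * h (Rf v x) := by
    have := (Rf v).measurePreserving.integral_comp (Rf v).toHomeomorph.measurableEmbedding
      (fun x => (Hs v).indicator F x * h (Rf v x))
    simpa [Rf_Rf] using this
  simp only [oddx, sub_mul]
  rw [integral_sub i1 i3, e3, ← integral_sub i1 i2, ← integral_indicator (Hs_open v).measurableSet]
  congr 1; ext x
  by_cases hx : x ∈ Hs v <;> simp [hx, mul_sub]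

lemma hpair_navier {n : ℕ} {v : Eu n} (hv : v ≠ 0) {u : Eu n → ℝ} (hu : NavierAdm (Hs v) u) :
    HPair (oddx v (fun x => (u x : ℂ))) (oddx v (fun x => (lap u x : ℂ))) := by
  obtain ⟨hc, hf, ⟨ε, hε, hn⟩, R, hR⟩ := hu
  set U : Eu n → ℂ := fun x => (u x : ℂ) with hU
  set V : Eu n → ℂ := fun x => (lap u x : ℂ) with hV
  obtain ⟨C, hC, b1, b2, b3, b4, b5⟩ := half_bounds (R := R) hv (u := U)
    (Complex.ofRealCLM.contDiff.comp_contDiffOn hc) (fun x hx => by simp [hU, hf x hx])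
    (fun x hx => by simp [hU, hR x hx])
  have hcd : ∀ x ∈ Hs v, ContDiffAt ℝ 2 u x := fun x hx =>
    hc.contDiffAt (mem_interior_iff_mem_nhds.1 (interior_maximal subset_closure (Hs_open v) hx))
  have vD : ∀ x ∈ Hs v, V x = (Δ U) x := fun x hx => (lap_ofReal (hcd x hx)).symm
  have mH := (Hs_open v).measurableSet
  have mind : ∀ f : Eu n → ℂ, ContinuousOn f (Hs v) → Measurable ((Hs v).indicator f) := by
    intro f hf
    classical
    have := hf.measurable_piecewise (g := 0) continuousOn_const mH
    rwa [piecewise_eq_indicator] at this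
  have mU : Measurable ((Hs v).indicator U) := by
    refine mind U fun x hx => (b1 x hx).continuousAt.continuousWithinAt
  have mV : Measurable ((Hs v).indicator V) := by
    refine mind V fun x hx => ?_
    exact (Complex.continuous_ofReal.continuousAt.comp (lap_contAt (hcd x hx))).continuousWithinAt
  have bU : ∀ x, ‖(Hs v).indicator U x‖ ≤ C := fun x => by
    by_cases hx : x ∈ Hs v <;> simp [hx, hC, b3]
  have bV : ∀ x, ‖(Hs v).indicator V x‖ ≤ n * C := fun x => by
    by_cases hx : x ∈ Hs v
    · simp only [hx, indicator_of_mem]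
      rw [vD x hx, laplacian_eq_iteratedFDeriv_orthonormalBasis U (EuclideanSpace.basisFun (Fin n) ℝ)]
      refine (norm_sum_le _ _).trans ?_
      refine (Finset.sum_le_sum (g := fun _ => C) fun i _ => ?_).trans (by simp)
      have := (norm_itf_le (F := U) (x := x) (i := i)).trans (b5 x hx)
      simpa using this
    · simp [hx]; positivity
  have nU : ∀ x, ‖x‖ < ε → (Hs v).indicator U x = 0 := fun x hx => by
    apply indicator_apply_eq_zero.2; intro _; simp [hU, hn x hx]
  have fU : ∀ x, R < ‖x‖ → (Hs v).indicator U x = 0 := fun x hx => by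
    apply indicator_apply_eq_zero.2; intro _; simp [hU, hR x hx]
  have nV : ∀ x, ‖x‖ < ε → (Hs v).indicator V x = 0 := fun x hx => by
    apply indicator_apply_eq_zero.2; intro _; simp [hV, lap_zero (zero_near hn x hx)]
  have fV : ∀ x, R < ‖x‖ → (Hs v).indicator V x = 0 := fun x hx => by
    apply indicator_apply_eq_zero.2; intro _; simp [hV, lap_zero (zero_far hR x hx)]
  have mRf : Measurable (Rf v) := (Rf v).continuous.measurable
  refine ⟨mU.sub (mU.comp mRf), mV.sub (mV.comp mRf), ⟨2 * C + 2 * (n * C), ?_, ?_⟩, ⟨ε, hε, ?_⟩, ⟨R, ?_⟩, ?_⟩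
  · intro x
    refine (norm_sub_le _ _).trans ?_
    have := bU x; have := bU (Rf v x)
    have : 0 ≤ n * C := by positivity
    linarith
  · intro x
    refine (norm_sub_le _ _).trans ?_
    have := bV x; have := bV (Rf v x)
    linarith
  · intro x hx
    have hx' : ‖Rf v x‖ < ε := by simpa using hx
    simp [oddx, nU x hx, nU _ hx', nV x hx, nV _ hx']
  · intro x hx
    have hx' : R < ‖Rf v x‖ := by simpa using hx
    simp [oddx, fU x hx, fU _ hx', fV x hx, fV _ hx']
  · intro j p hp hpl w
    set h := Nf (fun s => Complex.exp (w * s)) p with hh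
    set h' := Nf (fun s => Complex.exp ((w - 2) * s)) p with hh'
    have hhc : ∀ x, x ≠ 0 → ContDiffAt ℝ 2 h x := fun x hx => Nf_exp_contDiffAt w p hx
    have hhR : ∀ x, x ≠ 0 → ContDiffAt ℝ 2 (h ∘ Rf v) x := fun x hx =>
      (hhc (Rf v x) (by simpa using hx)).comp x (Rf v).contDiff.contDiffAt
    rw [oddx_int hε mV bV nV fV fun x hx => (hhc x hx).continuousAt,
      oddx_int hε mU bU nU fU fun x hx => (Nf_exp_contDiffAt _ p hx).continuousAt]
    set c := w * (w + n - 2 + 2 * j) with hc'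
    obtain ⟨K, hK, hlip⟩ := pev_lip p R
    set A : Set (Eu n) := closedBall 0 R ∩ {x | ε ≤ ‖x‖} with hA
    have hAc : IsCompact A := (isCompact_closedBall _ _).inter_right (isClosed_le continuous_const continuous_norm)
    obtain ⟨B, hB⟩ := hAc.exists_bound_of_continuousOn (f := fun x : Eu n => Complex.exp (w * Real.log ‖x‖))
      (by
        intro x hx
        have hx0 : ‖x‖ ≠ 0 := by have := hx.2; simp only [mem_ofPred_eq] at this; linarith
        have : ContinuousAt (fun x : Eu n => Real.log ‖x‖) x := continuousAt_id.norm.log hx0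
        exact ((continuousAt_const.mul (Complex.continuous_ofReal.continuousAt.comp this)).cexp).continuousWithinAt)
    have hg := green_half (R := R) (v := v) (F := U) (G := fun x => h x - (h ∘ Rf v) x) hε b1 b2 b3 b4 b5
      (fun x hx => by simp [hU, hn x hx]) (fun x hx => by simp [hU, hR x hx])
      (fun x hx => (hhc x hx).sub (hhR x hx)) (C' := |B| * (K * (2 / ‖v‖))) ?_
    · have e : ∀ x ∈ Hs v, (Δ U) x * (h x - (h ∘ Rf v) x) - U x * (Δ (fun x => h x - (h ∘ Rf v) x)) x =
         V x * (h x - h (Rf v x)) - c * (U x * (h' x - h' (Rf v x))) := by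
        intro x hx
        have hx0 := Hs_ne_zero hx
        have hs : (Δ (fun x => h x - (h ∘ Rf v) x)) x = (Δ h) x - (Δ (h ∘ Rf v)) x := by
          have := (hhc x hx0).laplacian_sub (hhR x hx0)
          simpa [Pi.sub_def] using this
        rw [hs, laplacian_comp_isometry, hh, Nf_exp_lap hp hpl w hx0,
          Nf_exp_lap hp hpl w (by simpa using hx0 : Rf v x ≠ 0), vD x hx]
        simp only [Function.comp]
        ring
      rw [setIntegral_congr_fun mH e] at hg
      have jj : ∀ (f k : Eu n → ℂ) (M : ℝ), Measurable ((Hs v).indicator f) → (∀ x, ‖(Hs v).indicator f x‖ ≤ M) →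
          (∀ x, ‖x‖ < ε → (Hs v).indicator f x = 0) → (∀ x, R < ‖x‖ → (Hs v).indicator f x = 0) →
          (∀ x, x ≠ 0 → ContinuousAt k x) → IntegrableOn (fun x => f x * (k x - k (Rf v x))) (Hs v) := by
        intro f k M q1 q2 q3 q4 q5
        have := ann_integrable (g := fun x => k x - k (Rf v x)) hε q1 q2 q3 q4 fun x hx => (q5 x hx).sub
          (ContinuousAt.comp (g := k) (q5 (Rf v x) (by simpa using hx)) (Rf v).continuous.continuousAt)
        rw [← integrable_indicator_iff mH]
        refine this.congr (Eventually.of_forall fun x => ?_)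
        by_cases hx : x ∈ Hs v <;> simp [hx]
      rw [integral_sub (jj V h _ mV bV nV fV fun x hx => (hhc x hx).continuousAt)
        ((jj U h' _ mU bU nU fU fun x hx => (Nf_exp_contDiffAt _ p hx).continuousAt).const_mul _),
        integral_const_mul, sub_eq_zero] at hg
      exact hg
    · intro x hx hx1 hx2
      have hx' : 0 < ⟪x, v⟫ := hx
      have hnv : 0 < ‖v‖ := norm_pos_iff.2 hv
      have hxr : x - Rf v x = (2 * (⟪x, v⟫ / ‖v‖ ^ 2)) • v := by rw [Rf_apply]; abel
      have hl := hlip x (Rf v x) hx2 (by simpa using hx2)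
      rw [hxr, norm_smul, Real.norm_of_nonneg (by positivity)] at hl
      have e1 : h x - (h ∘ Rf v) x = Complex.exp (w * Real.log ‖x‖) * (pev p x - pev p (Rf v x)) := by
        simp [hh, Nf, mul_sub]
      rw [e1, norm_mul]
      have hb := (hB x ⟨by simpa using hx2, hx1⟩).trans (le_abs_self _)
      calc _ ≤ |B| * (K * (2 * (⟪x, v⟫ / ‖v‖ ^ 2) * ‖v‖)) := by gcongr
        _ = _ := by field_simp
end NavPair

open MeasureTheory Metric Set Filter
open scoped RealInnerProductSpace

section Trans
open FourierTransform

/-- radial profile -/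
noncomputable def gsl {n : ℕ} (c : ℝ) (F : Eu n → ℂ) (σ : Sp n) (s : ℝ) : ℂ :=
  (Real.exp (c * s) : ℂ) * F (Real.exp s • (σ : Eu n))

/-- Mellin transform -/
noncomputable def tr {n : ℕ} (c : ℝ) (F : Eu n → ℂ) (ξ : ℝ) (σ : Sp n) : ℂ := 𝓕 (gsl c F σ) ξ

lemma norm_expsmul {n : ℕ} (s : ℝ) (σ : Sp n) : ‖Real.exp s • (σ : Eu n)‖ = Real.exp s := by
  rw [norm_smul, norm_eq_of_mem_sphere σ, mul_one, Real.norm_of_nonneg (Real.exp_pos s).le]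

structure Ann {n : ℕ} (F : Eu n → ℂ) : Prop where
  m : Measurable F
  bd : ∃ C : ℝ, ∀ x, ‖F x‖ ≤ C
  near : ∃ ε > 0, ∀ x, ‖x‖ < ε → F x = 0
  far : ∃ R : ℝ, ∀ x, R < ‖x‖ → F x = 0

variable {n : ℕ} {F : Eu n → ℂ} (c : ℝ)

lemma gsl_meas (hF : Ann F) : Measurable (fun q : Sp n × ℝ => gsl c F q.1 q.2) := by
  unfold gsl
  have h1 : Measurable (fun q : Sp n × ℝ => F (theta q)) := hF.m.comp continuous_theta.measurable
  have h2 : Measurable (fun q : Sp n × ℝ => (Real.exp (c * q.2) : ℂ)) := by fun_prop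
  exact h2.mul h1

lemma gsl_bound (hF : Ann F) : ∃ M A B : ℝ, ∀ (σ : Sp n) s, ‖gsl c F σ s‖ ≤ (Icc A B).indicator (fun _ => M) s := by
  obtain ⟨C, hC⟩ := hF.bd
  obtain ⟨ε, hε, h1⟩ := hF.near
  obtain ⟨R, h2⟩ := hF.far
  obtain ⟨M, hM⟩ := (isCompact_Icc (a := Real.log ε) (b := Real.log (max R 1))).exists_bound_of_continuousOn
    (f := fun s => Real.exp (c * s)) (by fun_prop)
  refine ⟨|M| * |C|, Real.log ε, Real.log (max R 1), fun σ s => ?_⟩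
  by_cases hs : s ∈ Icc (Real.log ε) (Real.log (max R 1))
  · rw [indicator_of_mem hs, gsl, norm_mul]
    have := hM s hs
    gcongr
    · rw [Complex.norm_real]; exact this.trans (le_abs_self _)
    · exact (hC _).trans (le_abs_self _)
  · rw [indicator_of_notMem hs, norm_le_zero_iff, gsl]
    have : F (Real.exp s • (σ : Eu n)) = 0 := by
      rw [mem_Icc, not_and_or, not_le, not_le] at hs
      rcases hs with hs | hs
      · apply h1; rw [norm_expsmul]; exact (Real.lt_log_iff_exp_lt hε).1 hs
      · apply h2; rw [norm_expsmul]
        exact (le_max_left _ _).trans_lt ((Real.log_lt_iff_lt_exp (by positivity)).1 hs)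
    simp [this]

lemma gsl_memLp (hF : Ann F) (σ : Sp n) (p : ENNReal) : MemLp (gsl c F σ) p := by
  obtain ⟨M, A, B, h⟩ := gsl_bound c hF
  have hi : MemLp ((Icc A B).indicator (fun _ => M)) p (volume : Measure ℝ) :=
    memLp_indicator_const p measurableSet_Icc M (Or.inr (by simp))
  refine hi.mono ?_ (Eventually.of_forall fun s => (h σ s).trans (le_abs_self _))
  exact ((gsl_meas c hF).comp (measurable_const.prodMk measurable_id)).aestronglyMeasurable

lemma gsl_integrable (hF : Ann F) (σ : Sp n) : Integrable (gsl c F σ) :=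
  memLp_one_iff_integrable.1 (gsl_memLp c hF σ 1)

lemma tr_bound (hF : Ann F) : ∃ B : ℝ, ∀ ξ (σ : Sp n), ‖tr c F ξ σ‖ ≤ B := by
  obtain ⟨M, A, B, h⟩ := gsl_bound c hF
  refine ⟨∫ s, (Icc A B).indicator (fun _ => M) s, fun ξ σ => ?_⟩
  unfold tr
  rw [Real.fourier_real_eq]
  refine (norm_integral_le_integral_norm _).trans ?_
  simp only [Circle.norm_smul]
  refine integral_mono (gsl_integrable c hF σ).norm ?_ (h σ)
  exact (integrable_indicator_iff measurableSet_Icc).2 (by simp)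

lemma tr_meas (hF : Ann F) : StronglyMeasurable (fun q : ℝ × Sp n => tr c F q.1 q.2) := by
  unfold tr
  simp only [Real.fourier_real_eq_integral_exp_smul]
  refine StronglyMeasurable.integral_prod_right
    (f := fun (q : ℝ × Sp n) (s : ℝ) => Complex.exp (↑(-2 * Real.pi * s * q.1) * Complex.I) • gsl c F q.2 s) ?_
  refine Measurable.stronglyMeasurable ?_
  have h1 : Measurable (fun q : (ℝ × Sp n) × ℝ => gsl c F q.1.2 q.2) :=
    (gsl_meas c hF).comp (by fun_prop : Measurable (fun q : (ℝ × Sp n) × ℝ => (q.1.2, q.2)))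
  have h2 : Measurable (fun q : (ℝ × Sp n) × ℝ => Complex.exp (↑(-2 * Real.pi * q.2 * q.1.1) * Complex.I)) := by
    fun_prop
  exact h2.smul h1

lemma tr_memLp (hF : Ann F) (ξ : ℝ) : MemLp (tr c F ξ) 2 (nu n) := by
  obtain ⟨B, hB⟩ := tr_bound c hF
  exact MemLp.of_bound ((tr_meas c hF).comp_measurable
    (measurable_const.prodMk measurable_id : Measurable fun σ : Sp n => (ξ, σ))).aestronglyMeasurable B (Eventually.of_forall (hB ξ))

lemma tr_plancherel (hn : 1 ≤ n) (hF : Ann F) (β : ℝ) (hβ : β = 2 * c - n) :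
    ∫⁻ ξ, ∫⁻ σ, ‖tr c F ξ σ‖ₑ ^ 2 ∂(nu n) = ∫⁻ x, ENNReal.ofReal (‖x‖ ^ β) * ‖F x‖ₑ ^ 2 := by
  rw [lintegral_lintegral_swap]
  · have : ∀ σ : Sp n, ∫⁻ ξ, ‖tr c F ξ σ‖ₑ ^ 2 = ∫⁻ s, ‖gsl c F σ s‖ₑ ^ 2 := fun σ =>
      plancherel1 (gsl_integrable c hF σ) (gsl_memLp c hF σ 2)
    simp only [this]
    rw [polar_lintegral hn]
    · refine lintegral_congr fun σ => lintegral_congr fun s => ?_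
      rw [norm_expsmul, ← mul_assoc, ← ENNReal.ofReal_mul (Real.exp_pos _).le, gsl, enorm_mul, mul_pow]
      congr 1
      rw [← ofReal_norm, Complex.norm_real, Real.norm_of_nonneg (Real.exp_pos _).le, ← ENNReal.ofReal_pow (Real.exp_pos _).le]
      congr 1
      rw [← Real.exp_mul, ← Real.exp_add, ← Real.exp_nat_mul, hβ]
      congr 1; push_cast; ring
    · have := hF.m
      fun_prop
  · exact ((tr_meas c hF).measurable.enorm.pow_const 2).aemeasurable

lemma tr_test (hn : 1 ≤ n) (hF : Ann F) {j : ℕ} {p : RPoly n} (hp : p.IsHomogeneous j) (ξ : ℝ) (w : ℂ)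
    (hw : w = c - n - j - 2 * Real.pi * ξ * Complex.I) :
    ∫ σ, pev p σ * tr c F ξ σ ∂(nu n) = ∫ x, F x * Nf (fun s => Complex.exp (w * s)) p x := by
  obtain ⟨C, hC⟩ := hF.bd
  obtain ⟨ε, hε, h1⟩ := hF.near
  obtain ⟨R, h2⟩ := hF.far
  rw [polar_integral hn (ann_integrable hε hF.m hC h1 h2 fun x hx => (Nf_exp_contDiffAt w p hx).continuousAt)]
  congr 1; ext σ
  rw [tr, Real.fourier_real_eq_integral_exp_smul, ← integral_const_mul]
  congr 1; ext s
  rw [Nf, norm_expsmul, Real.log_exp, pev_smul hp, gsl, Complex.real_smul, smul_eq_mul]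
  push_cast
  rw [← Complex.exp_nat_mul]
  have : Complex.exp (-2 * Real.pi * s * ξ * Complex.I) * Complex.exp (c * s) =
    Complex.exp (n * s) * Complex.exp (w * s) * Complex.exp (j * s) := by
    rw [← Complex.exp_add, ← Complex.exp_add, ← Complex.exp_add, hw]; congr 1; ring
  linear_combination (pev p σ * F (Real.exp s • (σ : Eu n))) * this

lemma HPair.annF {F L : Eu n → ℂ} (h : HPair F L) : Ann F := by
  obtain ⟨h1, h2, ⟨C, h3, h4⟩, ⟨ε, hε, h5⟩, ⟨R, h6⟩, h7⟩ := h
  exact ⟨h1, ⟨C, h3⟩, ⟨ε, hε, fun x hx => (h5 x hx).1⟩, ⟨R, fun x hx => (h6 x hx).1⟩⟩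

lemma HPair.annL {F L : Eu n → ℂ} (h : HPair F L) : Ann L := by
  obtain ⟨h1, h2, ⟨C, h3, h4⟩, ⟨ε, hε, h5⟩, ⟨R, h6⟩, h7⟩ := h
  exact ⟨h2, ⟨C, h4⟩, ⟨ε, hε, fun x hx => (h5 x hx).2⟩, ⟨R, fun x hx => (h6 x hx).2⟩⟩

/-- the eigenvalues -/
noncomputable def lamj (n j : ℕ) : ℝ := j * (n - 2 + j)

/-- the symbol -/
noncomputable def qsym (n : ℕ) (α : ℝ) (j : ℕ) (τ : ℝ) : ℂ :=
  -((gam n α + lamj n j + τ ^ 2 : ℝ) + ((α - 2) * τ : ℝ) * Complex.I)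

lemma HPair.symb (hn : 1 ≤ n) (α : ℝ) {F L : Eu n → ℂ} (h : HPair F L) {j : ℕ} {p : RPoly n}
    (hp : p.IsHomogeneous j) (hpl : plap p = 0) (ξ : ℝ) :
    ∫ σ, pev p σ * tr ((α + n) / 2) L ξ σ ∂(nu n) =
      qsym n α j (2 * Real.pi * ξ) * ∫ σ, pev p σ * tr ((α - 4 + n) / 2) F ξ σ ∂(nu n) := by
  set w : ℂ := ((α + n) / 2 : ℝ) - n - j - 2 * Real.pi * ξ * Complex.I with hw
  rw [tr_test _ hn h.annL hp ξ w hw, h.rel j p hp hpl w,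
    tr_test _ hn h.annF hp ξ (w - 2) (by rw [hw]; push_cast; ring)]
  congr 1
  rw [hw, qsym, gam, lamj]
  push_cast
  have := Complex.I_sq
  linear_combination (2 * Real.pi * ξ) ^ 2 * this
end Trans

open MeasureTheory Metric Set Filter
open scoped RealInnerProductSpace

section Static
variable {n : ℕ}

lemma lint_toLp {f : Sp n → ℂ} (hf : MemLp f 2 (nu n)) :
    ∫⁻ σ, ‖f σ‖ₑ ^ 2 ∂(nu n) = ENNReal.ofReal (‖hf.toLp f‖ ^ 2) := by
  rw [Lp.norm_toLp, ENNReal.ofReal_pow ENNReal.toReal_nonneg, ENNReal.ofReal_toReal hf.eLpNorm_ne_top,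
    eLpNorm_eq_lintegral_rpow_enorm_toReal (by norm_num) (by norm_num)]
  simp only [ENNReal.toReal_ofNat, ENNReal.rpow_ofNat, one_div]
  rw [← ENNReal.rpow_natCast, ← ENNReal.rpow_mul]
  norm_num

/-- the transform as an L² element -/
noncomputable def trL (c : ℝ) {F : Eu n → ℂ} (hF : Ann F) (ξ : ℝ) : Lp ℂ 2 (nu n) := (tr_memLp c hF ξ).toLp _

lemma trL_coe (c : ℝ) {F : Eu n → ℂ} (hF : Ann F) (ξ : ℝ) : trL c hF ξ =ᵐ[nu n] tr c F ξ :=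
  MemLp.coeFn_toLp _

lemma inner_trL (c : ℝ) {F : Eu n → ℂ} (hF : Ann F) (ξ : ℝ) (p : RPoly n) :
    inner ℂ (polyL n p) (trL c hF ξ) = ∫ σ, pev (pconj p) σ * tr c F ξ σ ∂(nu n) := by
  rw [inner_polyL]
  refine integral_congr_ae ?_
  filter_upwards [trL_coe c hF ξ] with σ hσ
  rw [hσ]

lemma quot_static (hn : 1 ≤ n) (α : ℝ) {F L : Eu n → ℂ} (h : HPair F L) {M : ℝ} (hM : 0 ≤ M)
    (hs : ∀ ξ, M * ‖trL ((α - 4 + n) / 2) h.annF ξ‖ ^ 2 ≤ ‖trL ((α + n) / 2) h.annL ξ‖ ^ 2) :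
    ENNReal.ofReal M * ∫⁻ x, ENNReal.ofReal (‖x‖ ^ (α - 4)) * ‖F x‖ₑ ^ 2 ≤
      ∫⁻ x, ENNReal.ofReal (‖x‖ ^ α) * ‖L x‖ₑ ^ 2 := by
  rw [← tr_plancherel ((α - 4 + n) / 2) hn h.annF (α - 4) (by ring),
    ← tr_plancherel ((α + n) / 2) hn h.annL α (by ring), ← lintegral_const_mul' _ _ (by simp)]
  refine lintegral_mono fun ξ => ?_
  rw [lint_toLp (tr_memLp _ h.annF ξ), lint_toLp (tr_memLp _ h.annL ξ), ← ENNReal.ofReal_mul hM]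
  exact ENNReal.ofReal_le_ofReal (hs ξ)

lemma coeff_rel (hn : 1 ≤ n) (α : ℝ) {F L : Eu n → ℂ} (h : HPair F L) {j : ℕ} {p : RPoly n}
    (hp : p.IsHomogeneous j) (hpl : plap p = 0) (ξ : ℝ) :
    inner ℂ (polyL n p) (trL ((α + n) / 2) h.annL ξ) =
      qsym n α j (2 * Real.pi * ξ) * inner ℂ (polyL n p) (trL ((α - 4 + n) / 2) h.annF ξ) := by
  rw [inner_trL, inner_trL]
  exact h.symb hn α (pconj_hom hp) (by rw [plap_pconj, hpl]; simp [pconj]) ξ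

lemma parseval {ι : Type} {H : Type*} [NormedAddCommGroup H] [InnerProductSpace ℂ H] [CompleteSpace H]
    (b : HilbertBasis ι ℂ H) (x : H) : HasSum (fun i => ‖inner ℂ (b i) x‖ ^ 2) (‖x‖ ^ 2) := by
  have h := b.hasSum_inner_mul_inner x x
  have h2 := Complex.reCLM.hasSum h
  have e : ∀ i, inner ℂ x (b i) * inner ℂ (b i) x = ((‖inner ℂ (b i) x‖ ^ 2 : ℝ) : ℂ) := by
    intro i
    rw [← inner_conj_symm x (b i), Complex.conj_mul']
    push_cast; rfl
  have e2 : Complex.reCLM (inner ℂ x x) = ‖x‖ ^ 2 := inner_self_eq_norm_sq (𝕜 := ℂ) x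
  rw [e2] at h2
  refine h2.congr_fun fun i => ?_
  simp only [Function.comp, e, Complex.reCLM_apply, Complex.ofReal_re]

lemma qsym_sq (n : ℕ) (α : ℝ) (j : ℕ) (τ : ℝ) : (gam n α + lamj n j) ^ 2 ≤ ‖qsym n α j τ‖ ^ 2 := by
  have h : ‖qsym n α j τ‖ ^ 2 = (gam n α + lamj n j + τ ^ 2) ^ 2 + ((α - 2) * τ) ^ 2 := by
    rw [qsym, norm_neg, ← Complex.normSq_eq_norm_sq, Complex.normSq_add_mul_I]
  rw [h]
  have hl : -2 * (((n:ℝ) - 2) / 2) ^ 2 ≤ 2 * lamj n j := by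
    unfold lamj
    nlinarith [sq_nonneg (((n:ℝ) - 2) / 2 + j)]
  have : 0 ≤ τ ^ 2 * (2 * lamj n j + 2 * (((n:ℝ) - 2) / 2) ^ 2 + 2 * ((α - 2) / 2) ^ 2) := by
    apply mul_nonneg (sq_nonneg _)
    nlinarith [sq_nonneg ((α - 2) / 2)]
  have h3 := sq_nonneg (τ ^ 2)
  unfold gam at *
  nlinarith

lemma pev_hom_zero {p : RPoly n} (hp : p.IsHomogeneous 0) : ∃ c : ℂ, ∀ x, pev p x = c := by
  refine ⟨pev p 0, fun x => ?_⟩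
  have := pev_smul hp 0 x
  simpa using this.symm

lemma tr_refl {v : Eu n} (c : ℝ) (F : Eu n → ℂ) (ξ : ℝ) (σ : Sp n) :
    tr c (fun x => F (Rf v x)) ξ σ = tr c F ξ (sphMap (Rf v) σ) := by
  unfold tr
  have : gsl c (fun x => F (Rf v x)) σ = gsl c F (sphMap (Rf v) σ) := by
    ext s; simp [gsl, sphMap]
  rw [this]

lemma tr_neg (c : ℝ) (F : Eu n → ℂ) (ξ : ℝ) (σ : Sp n) :
    tr c (fun x => - F x) ξ σ = - tr c F ξ σ := by
  unfold tr
  rw [Real.fourier_real_eq, Real.fourier_real_eq, ← integral_neg]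
  simp [gsl]

lemma int_odd {v : Eu n} {f : Sp n → ℂ} (hf : ∀ σ, f (sphMap (Rf v) σ) = - f σ) : ∫ σ, f σ ∂(nu n) = 0 := by
  have inv : ∀ σ, sphMap (Rf v) (sphMap (Rf v) σ) = σ := fun σ => by
    ext1; simp [sphMap, Rf_Rf]
  have he : MeasurableEmbedding (sphMap (Rf v) : Sp n → Sp n) :=
    (Homeomorph.mk ⟨sphMap (Rf v), sphMap (Rf v), inv, inv⟩ (continuous_sphMap _) (continuous_sphMap _)).measurableEmbedding
  have := (sphMap_mp (Rf v)).integral_comp he f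
  simp only [hf, integral_neg] at this
  linear_combination (-1 / 2) * this

lemma static_navier (hn : 2 ≤ n) (α : ℝ) {v : Eu n} {F L : Eu n → ℂ} (h : HPair F L)
    (hodd : ∀ x, F (Rf v x) = - F x) {m : ℝ} (hm : ∀ k : ℕ, 1 ≤ k → m ≤ (gam n α + lamj n k) ^ 2) (ξ : ℝ) :
    m * ‖trL ((α - 4 + n) / 2) h.annF ξ‖ ^ 2 ≤ ‖trL ((α + n) / 2) h.annL ξ‖ ^ 2 := by
  obtain ⟨ι, b, deg, P, hP, -⟩ := exists_basis hn
  refine hasSum_le (fun i => ?_) ((parseval b _).mul_left m) (parseval b _)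
  obtain ⟨h1, h2, h3⟩ := hP i
  rw [h3, coeff_rel (by omega) α h h1 h2, norm_mul, mul_pow]
  by_cases hd : deg i = 0
  · have : inner ℂ (polyL n (P i)) (trL ((α - 4 + n) / 2) h.annF ξ) = 0 := by
      rw [inner_trL]
      rw [hd] at h1
      obtain ⟨c, hc⟩ := pev_hom_zero (pconj_hom h1)
      apply int_odd (v := v)
      intro σ
      rw [hc, hc, ← tr_refl]
      simp only [hodd, tr_neg]
      ring
    rw [this]; simp
  · gcongr
    exact (hm _ (by omega)).trans (qsym_sq n α _ _)
end Static

open MeasureTheory Metric Set Filter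
open scoped RealInnerProductSpace

section Uniq
open Topology MvPolynomial
variable {n : ℕ}

lemma exists_perp (hn : 2 ≤ n) (x : Eu n) : ∃ e : Eu n, ‖e‖ = 1 ∧ ⟪x, e⟫ = 0 := by
  have h1 : 0 < Module.finrank ℝ ((ℝ ∙ x)ᗮ : Submodule ℝ (Eu n)) := by
    have := (ℝ ∙ x).finrank_add_finrank_orthogonal
    have h2 : Module.finrank ℝ (ℝ ∙ x) ≤ 1 := by
      simpa using finrank_span_le_card (R := ℝ) ({x} : Set (Eu n))
    have h3 : Module.finrank ℝ (Eu n) = n := by simp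
    omega
  have : Nontrivial ((ℝ ∙ x)ᗮ : Submodule ℝ (Eu n)) := Module.finrank_pos_iff.1 h1
  obtain ⟨y, hy⟩ := exists_ne (0 : ((ℝ ∙ x)ᗮ : Submodule ℝ (Eu n)))
  have hy' : ‖(y : Eu n)‖ ≠ 0 := by simpa using hy
  refine ⟨(‖(y : Eu n)‖⁻¹ : ℝ) • (y : Eu n), ?_, ?_⟩
  · rw [norm_smul, norm_inv, norm_norm, inv_mul_cancel₀ hy']
  · rw [inner_smul_right, Submodule.mem_orthogonal_singleton_iff_inner_right.1 y.2, mul_zero]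

lemma exists_circle (hn : 2 ≤ n) (x y : Eu n) (hx : ‖x‖ = 1) (hy : ‖y‖ = 1) :
    ∃ e : Eu n, ‖e‖ = 1 ∧ ⟪x, e⟫ = 0 ∧ ∃ t : ℝ, y = Real.cos t • x + Real.sin t • e := by
  set a := ⟪x, y⟫ with ha
  set w := y - a • x with hw
  have hxx : ⟪x, x⟫ = 1 := by rw [real_inner_self_eq_norm_sq, hx]; norm_num
  have hxw : ⟪x, w⟫ = 0 := by rw [hw, inner_sub_right, inner_smul_right, hxx]; simp [ha]
  have hwn : ‖w‖ ^ 2 = 1 - a ^ 2 := by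
    rw [← real_inner_self_eq_norm_sq, hw, inner_sub_sub_self, inner_smul_right, inner_smul_left, inner_smul_left,
      inner_smul_right, hxx, real_inner_self_eq_norm_sq, hy, real_inner_comm]
    simp only [conj_trivial, ← ha]; ring
  by_cases h0 : w = 0
  · obtain ⟨e, he1, he2⟩ := exists_perp hn x
    refine ⟨e, he1, he2, Real.arccos a, ?_⟩
    rw [h0] at hwn
    have ha2 : a ^ 2 = 1 := by simp at hwn; linarith
    have : Real.sin (Real.arccos a) = 0 := by rw [Real.sin_arccos, ha2]; simp
    rw [this, Real.cos_arccos (by nlinarith) (by nlinarith)]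
    rw [zero_smul, add_zero]; exact sub_eq_zero.1 h0
  · have hw0 : ‖w‖ ≠ 0 := by simpa using h0
    refine ⟨‖w‖⁻¹ • w, by rw [norm_smul, norm_inv, norm_norm, inv_mul_cancel₀ hw0],
      by rw [inner_smul_right, hxw, mul_zero], Real.arccos a, ?_⟩
    have hle : a ^ 2 ≤ 1 := by nlinarith [sq_nonneg ‖w‖]
    rw [Real.cos_arccos (by nlinarith) (by nlinarith), Real.sin_arccos, ← hwn, Real.sqrt_sq (norm_nonneg _),
      smul_smul, mul_inv_cancel₀ hw0, one_smul, hw]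
    abel

lemma poly_unique (hn : 2 ≤ n) {v : Eu n} (hv : v ≠ 0) {Q : RPoly n}
    (h : ∀ᵐ σ : Sp n ∂(nu n), ⟪(σ : Eu n), v⟫ < 0 → pev Q σ = 0) : ∀ σ : Sp n, pev Q σ = 0 := by
  have hO : IsOpen {σ : Sp n | ⟪(σ : Eu n), v⟫ < 0} := isOpen_lt (by fun_prop) continuous_const
  have h1 : ∀ σ : Sp n, ⟪(σ : Eu n), v⟫ < 0 → pev Q σ = 0 := by
    have hc : Continuous (fun σ : Sp n => pev Q (σ : Eu n)) := (pev_continuous Q).comp continuous_subtype_val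
    have := Measure.eqOn_open_of_ae_eq (μ := nu n) (f := fun σ : Sp n => pev Q (σ : Eu n)) (g := fun _ => 0)
      (U := {σ : Sp n | ⟪(σ : Eu n), v⟫ < 0}) ?_ hO hc.continuousOn continuousOn_const
    · exact fun σ hσ => this hσ
    · rw [EventuallyEq, ae_restrict_iff' hO.measurableSet]; exact h
  intro σ
  have hvn : ‖v‖ ≠ 0 := by simpa using hv
  set x : Eu n := (-‖v‖⁻¹) • v with hx
  have hxn : ‖x‖ = 1 := by rw [hx, norm_smul, norm_neg, norm_inv, norm_norm, inv_mul_cancel₀ hvn]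
  obtain ⟨e, he, hxe, t, ht⟩ := exists_circle hn x σ hxn (by simp)
  set f : ℝ → ℂ := fun t => pev Q (Real.cos t • x + Real.sin t • e) with hf
  have hfa : AnalyticOnNhd ℝ f univ := by
    intro t _
    have : AnalyticAt ℝ (fun t : ℝ => aeval (R := ℂ) (fun i => (((Real.cos t • x + Real.sin t • e : Eu n) i : ℝ) : ℂ)) Q) t := by
      refine AnalyticAt.aeval_mvPolynomial (f := fun (t : ℝ) i => (((Real.cos t • x + Real.sin t • e : Eu n) i : ℝ) : ℂ)) (fun i => ?_) Q
      refine Complex.ofRealCLM.analyticAt _ |>.comp (f := fun t : ℝ => (Real.cos t • x + Real.sin t • e : Eu n) i) ?_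
      simp only [PiLp.add_apply, PiLp.smul_apply, smul_eq_mul]
      exact (Real.analyticAt_cos.mul analyticAt_const).add (Real.analyticAt_sin.mul analyticAt_const)
    exact this
  have hev : f =ᶠ[𝓝 0] 0 := by
    have hc : ContinuousAt (fun t : ℝ => ⟪(Real.cos t • x + Real.sin t • e), v⟫) 0 := by
      apply Continuous.continuousAt; fun_prop
    have h0 : (fun t : ℝ => ⟪(Real.cos t • x + Real.sin t • e), v⟫) 0 < 0 := by
      simp only [Real.cos_zero, Real.sin_zero, one_smul, zero_smul, add_zero, hx, inner_smul_left,
        real_inner_self_eq_norm_sq, conj_trivial]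
      have : 0 < ‖v‖ := norm_pos_iff.2 hv
      rw [neg_mul, neg_lt_zero]; positivity
    filter_upwards [hc.eventually_lt continuousAt_const h0] with t ht
    refine h1 ⟨Real.cos t • x + Real.sin t • e, ?_⟩ ht
    have : ‖Real.cos t • x + Real.sin t • e‖ ^ 2 = 1 := by
      rw [norm_add_sq_real, norm_smul (Real.cos t), norm_smul (Real.sin t), hxn, he, inner_smul_left, inner_smul_right, hxe]
      simp
    rw [mem_sphere_zero_iff_norm]
    nlinarith [norm_nonneg (Real.cos t • x + Real.sin t • e)]
  have := hfa.eqOn_zero_of_preconnected_of_eventuallyEq_zero isPreconnected_univ (mem_univ 0) hev (mem_univ t)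
  rw [ht]; exact this
end Uniq

section StaticD
variable {n : ℕ}

lemma lamj_mono (hn : 2 ≤ n) {j k : ℕ} (h : j ≤ k) : lamj n j ≤ lamj n k := by
  unfold lamj
  have h1 : (2:ℝ) ≤ n := by exact_mod_cast hn
  have h2 : (j:ℝ) ≤ k := by exact_mod_cast h
  have h3 : (0:ℝ) ≤ j := by positivity
  have : 0 ≤ (n:ℝ) - 2 + j := by linarith
  gcongr

lemma lamj_ge (hn : 2 ≤ n) (j : ℕ) : (j:ℝ) ^ 2 ≤ lamj n j := by
  unfold lamj
  have h1 : (2:ℝ) ≤ n := by exact_mod_cast hn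
  have h3 : (0:ℝ) ≤ j := by positivity
  nlinarith

lemma static_dir_one (hn : 2 ≤ n) (α : ℝ) {v : Eu n} (hv : v ≠ 0) {m : ℝ}
    (hm : ∀ k : ℕ, m ≤ (gam n α + lamj n k) ^ 2) :
    ∃ ε > 0, ∀ (τ : ℝ) (Φ Ψ : Lp ℂ 2 (nu n)), (∀ᵐ σ : Sp n ∂(nu n), ⟪(σ : Eu n), v⟫ < 0 → Φ σ = 0) →
      (∀ (j : ℕ) (p : RPoly n), p.IsHomogeneous j → plap p = 0 →
        inner ℂ (polyL n p) Ψ = qsym n α j τ * inner ℂ (polyL n p) Φ) →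
      (m + ε) * ‖Φ‖ ^ 2 ≤ ‖Ψ‖ ^ 2 := by
  obtain ⟨ι, b, deg, P, hP, hfin⟩ := exists_basis hn
  obtain ⟨K, hK⟩ := exists_nat_gt (|gam n α| + |m| + 1)
  have hbig : ∀ j : ℕ, K < j → m + 1 ≤ (gam n α + lamj n j) ^ 2 := by
    intro j hj
    have h1 := lamj_ge hn j
    have h2 : (K:ℝ) ≤ j := by exact_mod_cast hj.le
    have h3 := neg_abs_le (gam n α)
    have h4 := abs_nonneg (gam n α)
    have h5 := le_abs_self m
    have h6 := abs_nonneg m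
    have h7 : |m| + 1 ≤ gam n α + lamj n j := by nlinarith
    nlinarith
  set I := (hfin K).toFinset with hI
  set W : Submodule ℂ (Lp ℂ 2 (nu n)) := Submodule.span ℂ (b '' (I : Set ι)) with hW
  have : FiniteDimensional ℂ W := FiniteDimensional.span_of_finite ℂ (I.finite_toSet.image _)
  have hWr : W ≤ LinearMap.range (polyL n) := by
    rw [hW, Submodule.span_le]
    rintro _ ⟨i, -, rfl⟩
    exact ⟨P i, (hP i).2.2.symm⟩
  have hms : MeasurableSet {σ : Sp n | ⟪(σ : Eu n), v⟫ < 0} :=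
    (isOpen_lt (by fun_prop) continuous_const).measurableSet
  set T := LpToLpRestrictCLM (Sp n) ℂ ℂ (nu n) 2 {σ : Sp n | ⟪(σ : Eu n), v⟫ < 0} with hT
  have hT0 : ∀ f : Lp ℂ 2 (nu n), T f = 0 ↔ ∀ᵐ σ : Sp n ∂(nu n), ⟪(σ : Eu n), v⟫ < 0 → f σ = 0 := by
    intro f
    rw [Lp.eq_zero_iff_ae_eq_zero]
    have h1 := LpToLpRestrictCLM_coeFn (μ := nu n) (p := 2) ℂ {σ : Sp n | ⟪(σ : Eu n), v⟫ < 0} f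
    have h2 : (∀ᵐ σ : Sp n ∂(nu n), ⟪(σ : Eu n), v⟫ < 0 → f σ = 0) ↔
       f =ᵐ[(nu n).restrict {σ : Sp n | ⟪(σ : Eu n), v⟫ < 0}] 0 := by
      rw [EventuallyEq, ae_restrict_iff' hms]; rfl
    rw [h2]
    exact ⟨fun h => h1.symm.trans h, fun h => h1.trans h⟩
  have hTn : ∀ f, ‖T f‖ ≤ ‖f‖ := fun f => norm_Lp_toLp_restrict_le _ f
  have hker : LinearMap.ker (T.toLinearMap ∘ₗ W.subtype) = ⊥ := by
    rw [LinearMap.ker_eq_bot']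
    rintro ⟨w, hw⟩ h0
    obtain ⟨Q, rfl⟩ := hWr hw
    have h1 : T (polyL n Q) = 0 := h0
    rw [hT0] at h1
    have h2 := poly_unique hn hv (Q := Q) (by
      filter_upwards [h1, polyL_coe Q] with σ h1 h2 h3
      rw [← h2]; exact h1 h3)
    ext1
    change polyL n Q = 0
    rw [Lp.eq_zero_iff_ae_eq_zero]
    filter_upwards [polyL_coe Q] with σ h3
    rw [h3]; exact h2 σ
  obtain ⟨A, hA, hlip⟩ := LinearMap.exists_antilipschitzWith _ hker
  have hA0 : (0:ℝ) < A := hA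
  refine ⟨1 / (1 + A) ^ 2, by positivity, fun τ Φ Ψ hΦ hrel => ?_⟩
  set PΦ : Lp ℂ 2 (nu n) := ∑ i ∈ I, inner ℂ (b i) Φ • b i with hPΦ
  have hPW : PΦ ∈ W := Submodule.sum_mem _ fun i hi => Submodule.smul_mem _ _ (Submodule.subset_span ⟨i, hi, rfl⟩)
  have hco : ∀ i, inner ℂ (b i) (Φ - PΦ) = if deg i ≤ K then 0 else inner ℂ (b i) Φ := by
    classical
    intro i
    rw [inner_sub_right, hPΦ, inner_sum]
    simp only [inner_smul_right, orthonormal_iff_ite.1 b.orthonormal i]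
    simp only [mul_ite, mul_one, mul_zero, Finset.sum_ite_eq]
    by_cases hi : deg i ≤ K <;> simp [hI, hi]
  have hmain : m * ‖Φ‖ ^ 2 + ‖Φ - PΦ‖ ^ 2 ≤ ‖Ψ‖ ^ 2 := by
    refine hasSum_le (fun i => ?_) (((parseval b _).mul_left m).add (parseval b (Φ - PΦ))) (parseval b _)
    rw [hco]
    obtain ⟨h1, h2, h3⟩ := hP i
    have h4 : inner ℂ (b i) Ψ = qsym n α (deg i) τ * inner ℂ (b i) Φ := by rw [h3]; exact hrel _ _ h1 h2
    rw [h4, norm_mul, mul_pow]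
    have h5 := qsym_sq n α (deg i) τ
    have h6 := sq_nonneg ‖(inner ℂ (b i) Φ : ℂ)‖
    split_ifs with hi
    · have := hm (deg i)
      simp only [norm_zero]; nlinarith
    · have := hbig (deg i) (by omega)
      nlinarith
  have hP1 : ‖PΦ‖ ≤ A * ‖Φ - PΦ‖ := by
    have h1 := hlip.le_mul_dist ⟨PΦ, hPW⟩ 0
    rw [dist_zero_right, map_zero, dist_zero_right] at h1
    have h2 : T (Φ - PΦ) = - T PΦ := by rw [map_sub, (hT0 Φ).2 hΦ, zero_sub]
    have h3 := hTn (Φ - PΦ)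
    rw [h2, norm_neg] at h3
    refine h1.trans ?_
    gcongr
    exact h3
  have hP2 : ‖Φ‖ ≤ (1 + A) * ‖Φ - PΦ‖ := by
    have := norm_add_le (Φ - PΦ) PΦ
    rw [sub_add_cancel] at this
    linarith
  have hP3 : ‖Φ‖ ^ 2 ≤ (1 + A) ^ 2 * ‖Φ - PΦ‖ ^ 2 := by
    rw [← mul_pow]; gcongr
  have : 1 / (1 + A : ℝ) ^ 2 * ‖Φ‖ ^ 2 ≤ ‖Φ - PΦ‖ ^ 2 := by
    rw [one_div, inv_mul_le_iff₀ (by positivity)]; exact hP3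
  linarith
end StaticD

open MeasureTheory Metric Set Filter
open scoped RealInnerProductSpace

section StaticE
open MvPolynomial
variable {n : ℕ}

/-- `Xo` is the odd reflection of `X`, supported in the half sphere -/
def OddOf (v : Eu n) (X Xo : Lp ℂ 2 (nu n)) : Prop :=
  (∀ᵐ σ : Sp n ∂(nu n), ⟪(σ : Eu n), v⟫ ≤ 0 → X σ = 0) ∧
  ∀ᵐ σ : Sp n ∂(nu n), Xo σ = X σ - X (sphMap (Rf v) σ)

lemma ae_refl {v : Eu n} {p : Sp n → Prop} (h : ∀ᵐ σ ∂(nu n), p σ) : ∀ᵐ σ ∂(nu n), p (sphMap (Rf v) σ) :=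
  (sphMap_mp (Rf v)).quasiMeasurePreserving.ae h

lemma sphMap_inv (v : Eu n) (σ : Sp n) : sphMap (Rf v) (sphMap (Rf v) σ) = σ := by
  ext1; simp [sphMap, Rf_Rf]

lemma sphMap_emb (v : Eu n) : MeasurableEmbedding (sphMap (Rf v) : Sp n → Sp n) :=
  (Homeomorph.mk ⟨sphMap (Rf v), sphMap (Rf v), sphMap_inv v, sphMap_inv v⟩ (continuous_sphMap _)
    (continuous_sphMap _)).measurableEmbedding

lemma OddOf.comb {v : Eu n} {X Xo Y Yo : Lp ℂ 2 (nu n)} (hX : OddOf v X Xo) (hY : OddOf v Y Yo) (c : ℂ) :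
    OddOf v (X + c • Y) (Xo + c • Yo) := by
  have h1 : ∀ᵐ σ ∂(nu n), (X + c • Y : Lp ℂ 2 (nu n)) σ = X σ + c * Y σ := by
    filter_upwards [Lp.coeFn_add X (c • Y), Lp.coeFn_smul c Y] with σ h1 h2
    rw [h1, Pi.add_apply, h2]; rfl
  have h2 : ∀ᵐ σ ∂(nu n), (Xo + c • Yo : Lp ℂ 2 (nu n)) σ = Xo σ + c * Yo σ := by
    filter_upwards [Lp.coeFn_add Xo (c • Yo), Lp.coeFn_smul c Yo] with σ h1 h2
    rw [h1, Pi.add_apply, h2]; rfl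
  constructor
  · filter_upwards [h1, hX.1, hY.1] with σ h1 h2 h3 h4
    rw [h1, h2 h4, h3 h4]; simp
  · filter_upwards [h1, h2, ae_refl (v := v) h1, hX.2, hY.2] with σ h1 h2 h3 h4 h5
    rw [h1, h2, h3, h4, h5]; ring

lemma OddOf.inner_eq {v : Eu n} (hv : v ≠ 0) {X Xo Y Yo : Lp ℂ 2 (nu n)} (hX : OddOf v X Xo) (hY : OddOf v Y Yo) :
    inner ℂ Xo Yo = 2 * inner ℂ X Y := by
  rw [L2.inner_def, L2.inner_def]
  have h1 : ∀ᵐ σ ∂(nu n), inner ℂ (Xo σ) (Yo σ) = inner ℂ (X σ) (Y σ) +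
      inner ℂ (X (sphMap (Rf v) σ)) (Y (sphMap (Rf v) σ)) := by
    filter_upwards [hX.2, hY.2, hX.1, hY.1, ae_refl (v := v) hX.1, ae_refl (v := v) hY.1] with σ h1 h2 h3 h4 h5 h6
    rw [h1, h2]
    have hR : ⟪((sphMap (Rf v) σ : Sp n) : Eu n), v⟫ = - ⟪(σ : Eu n), v⟫ := Rf_inner hv _
    rw [hR] at h5 h6
    rcases le_total ⟪(σ : Eu n), v⟫ 0 with h | h
    · rw [h3 h, h4 h]; simp
    · rw [h5 (by linarith), h6 (by linarith)]; simp
  rw [integral_congr_ae h1]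
  have hi := L2.integrable_inner (𝕜 := ℂ) X Y
  have mp := sphMap_mp (n := n) (Rf v)
  rw [integral_add hi]
  · rw [mp.integral_comp (sphMap_emb v) (fun σ => inner ℂ (X σ) (Y σ))]; ring
  · exact mp.integrable_comp_of_integrable hi

/-- linear form polynomial -/
noncomputable def plin (v : Eu n) : RPoly n := ∑ i, C ((v i : ℝ) : ℂ) * X i

lemma plin_hom (v : Eu n) : (plin v).IsHomogeneous 1 := by
  unfold plin
  refine IsHomogeneous.sum _ _ _ fun i _ => ?_
  simpa using (isHomogeneous_C (Fin n) ((v i : ℝ) : ℂ)).mul (isHomogeneous_X ℂ i)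

lemma pev_plin (v x : Eu n) : pev (plin v) x = ((⟪x, v⟫ : ℝ) : ℂ) := by
  simp only [pev, plin, map_sum, map_mul, eval_C, eval_X, PiLp.inner_apply]
  push_cast
  refine Finset.sum_congr rfl fun i _ => ?_
  simp [mul_comm]

lemma pev_sub_lin {P : RPoly n} (hP : P.IsHomogeneous 1) (x y : Eu n) : pev P (x - y) = pev P x - pev P y := by
  have hd : DifferentiableAt ℝ (pev P) 0 := (pev_hasFDerivAt P 0).differentiableAt
  have key : ∀ x : Eu n, pev P x = fderiv ℝ (pev P) 0 x := by
    intro x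
    have h1 : HasDerivAt (fun t : ℝ => pev P (t • x)) (fderiv ℝ (pev P) 0 x) 0 := by
      have h2 : HasDerivAt (fun t : ℝ => t • x) x 0 := by simpa using (hasDerivAt_id (0:ℝ)).smul_const x
      have h3 : HasFDerivAt (pev P) (fderiv ℝ (pev P) 0) ((0:ℝ) • x) := by simpa using hd.hasFDerivAt
      exact h3.comp_hasDerivAt 0 h2
    have h4 : HasDerivAt (fun t : ℝ => pev P (t • x)) (pev P x) 0 := by
      have : (fun t : ℝ => pev P (t • x)) = fun t : ℝ => (t : ℂ) * pev P x := by
        ext t; rw [pev_smul hP]; simp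
      rw [this]
      simpa using (Complex.ofRealCLM.hasDerivAt (x := (0:ℝ))).mul_const (pev P x)
    exact h4.unique h1
  rw [key, key x, key y, map_sub]

lemma pair_integrable (P : RPoly n) (f : Lp ℂ 2 (nu n)) : Integrable (fun σ : Sp n => pev P (σ : Eu n) * f σ) (nu n) := by
  have h := L2.integrable_inner (𝕜 := ℂ) (polyL n (pconj P)) f
  refine h.congr ?_
  filter_upwards [polyL_coe (pconj P)] with σ hσ
  rw [hσ, pev_pconj]
  simp [mul_comm]

/-- pairing an odd function with a polynomial only sees the odd part -/
lemma odd_pair {v : Eu n} {f : Lp ℂ 2 (nu n)} (hf : ∀ᵐ σ ∂(nu n), f (sphMap (Rf v) σ) = - f σ) (P : RPoly n) :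
    2 * ∫ σ : Sp n, pev P (σ : Eu n) * f σ ∂(nu n) =
      ∫ σ : Sp n, (pev P (σ : Eu n) - pev P (Rf v (σ : Eu n))) * f σ ∂(nu n) := by
  have hi := pair_integrable P f
  have mp := sphMap_mp (n := n) (Rf v)
  have hi2 := mp.integrable_comp_of_integrable hi
  have e := mp.integral_comp (sphMap_emb v) (fun σ => pev P (σ : Eu n) * f σ)
  have h1 : ∀ᵐ σ : Sp n ∂(nu n), (pev P (σ : Eu n) - pev P (Rf v (σ : Eu n))) * f σ =
      pev P (σ : Eu n) * f σ + pev P ((sphMap (Rf v) σ : Sp n) : Eu n) * f (sphMap (Rf v) σ) := by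
    filter_upwards [hf] with σ h
    rw [h, sphMap]; ring
  rw [integral_congr_ae h1, integral_add hi, e]
  · ring
  · exact hi2

lemma OddOf.odd {v : Eu n} {X Xo : Lp ℂ 2 (nu n)} (hX : OddOf v X Xo) :
    ∀ᵐ σ ∂(nu n), Xo (sphMap (Rf v) σ) = - Xo σ := by
  filter_upwards [hX.2, ae_refl (v := v) hX.2] with σ h1 h2
  rw [h1, h2, sphMap_inv]; ring
end StaticE

open MeasureTheory Metric Set Filter
open scoped RealInnerProductSpace

section StaticF
open MvPolynomial
variable {n : ℕ}

lemma odd_deg_zero {v : Eu n} {f : Lp ℂ 2 (nu n)} (hf : ∀ᵐ σ ∂(nu n), f (sphMap (Rf v) σ) = - f σ)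
    {P : RPoly n} (hP : P.IsHomogeneous 0) : inner ℂ (polyL n P) f = 0 := by
  have h := odd_pair hf (pconj P)
  obtain ⟨c, hc⟩ := pev_hom_zero (pconj_hom hP)
  rw [inner_polyL]
  simp only [hc, sub_self, zero_mul, integral_zero] at h ⊢
  simpa using h

lemma inner_plin (v : Eu n) (f : Lp ℂ 2 (nu n)) :
    inner ℂ (polyL n (plin v)) f = ∫ σ : Sp n, ((⟪(σ : Eu n), v⟫ : ℝ) : ℂ) * f σ ∂(nu n) := by
  rw [inner_polyL]
  simp only [pev_pconj, pev_plin, Complex.conj_ofReal]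

lemma odd_deg_one {v : Eu n} {f : Lp ℂ 2 (nu n)} (hf : ∀ᵐ σ ∂(nu n), f (sphMap (Rf v) σ) = - f σ)
    {P : RPoly n} (hP : P.IsHomogeneous 1) :
    inner ℂ (polyL n P) f = (pev (pconj P) v / (‖v‖ ^ 2 : ℝ)) * inner ℂ (polyL n (plin v)) f := by
  have h := odd_pair hf (pconj P)
  have e : ∀ σ : Sp n, (pev (pconj P) (σ : Eu n) - pev (pconj P) (Rf v (σ : Eu n))) * f σ =
      2 * ((pev (pconj P) v / (‖v‖ ^ 2 : ℝ)) * (((⟪(σ : Eu n), v⟫ : ℝ) : ℂ) * f σ)) := by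
    intro σ
    rw [← pev_sub_lin (pconj_hom hP), Rf_apply, sub_sub_cancel, pev_smul (pconj_hom hP)]
    push_cast
    ring
  simp only [e] at h
  rw [integral_const_mul, integral_const_mul] at h
  rw [inner_polyL, inner_plin]
  exact mul_left_cancel₀ two_ne_zero h

lemma plin_odd (v : Eu n) (hv : v ≠ 0) :
    ∀ᵐ σ ∂(nu n), (polyL n (plin v) : Lp ℂ 2 (nu n)) (sphMap (Rf v) σ) = - (polyL n (plin v) : Lp ℂ 2 (nu n)) σ := by
  filter_upwards [polyL_coe (plin v), ae_refl (v := v) (polyL_coe (plin v))] with σ h1 h2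
  rw [h1, h2, pev_plin, pev_plin]
  have hR : ⟪((sphMap (Rf v) σ : Sp n) : Eu n), v⟫ = - ⟪(σ : Eu n), v⟫ := Rf_inner hv _
  rw [hR]; push_cast; rfl

lemma plin_orth (hn : 2 ≤ n) (v : Eu n) {j : ℕ} (hj : j ≠ 1) {P : RPoly n} (hP : P.IsHomogeneous j) (hPl : plap P = 0) :
    inner ℂ (polyL n P) (polyL n (plin v)) = 0 := by
  rw [inner_polyL, ← sphere_orth hn hj (pconj_hom hP) (by rw [plap_pconj, hPl]; simp [pconj]) (plin_hom v) (plap_eq_zero (plin_hom v) (by norm_num))]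
  apply integral_congr_ae
  filter_upwards [polyL_coe (plin v)] with σ h
  rw [h]

/-- half sphere facts -/
lemma half_sphere {v : Eu n} (hv : v ≠ 0) : ∃ s : Lp ℂ 2 (nu n),
    inner ℂ s (polyL n (plin v)) ≠ 0 ∧ ∀ X Xo : Lp ℂ 2 (nu n), OddOf v X Xo →
      inner ℂ s Xo = inner ℂ (polyL n (1 : RPoly n)) X := by
  have hms : MeasurableSet {σ : Sp n | 0 < ⟪(σ : Eu n), v⟫} :=
    (isOpen_lt continuous_const (by fun_prop)).measurableSet
  refine ⟨indicatorConstLp 2 hms (measure_ne_top _ _) (1:ℂ), ?_, ?_⟩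
  · rw [L2.inner_indicatorConstLp_one]
    have h1 : ∫ σ in {σ : Sp n | 0 < ⟪(σ : Eu n), v⟫}, (polyL n (plin v) : Lp ℂ 2 (nu n)) σ ∂(nu n) =
        ((∫ σ : Sp n, max ⟪(σ : Eu n), v⟫ 0 ∂(nu n) : ℝ) : ℂ) := by
      rw [← integral_indicator hms, ← integral_complex_ofReal]
      apply integral_congr_ae
      filter_upwards [polyL_coe (plin v)] with σ h
      by_cases h0 : 0 < ⟪(σ : Eu n), v⟫
      · rw [indicator_of_mem (by exact h0), h, pev_plin, max_eq_left h0.le]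
      · rw [indicator_of_notMem (by exact h0), max_eq_right (not_lt.1 h0)]; simp
    rw [h1, Complex.ofReal_ne_zero]
    apply ne_of_gt
    have hvn : 0 < ‖v‖ := norm_pos_iff.2 hv
    refine Continuous.integral_pos_of_hasCompactSupport_nonneg_nonzero (x := (⟨‖v‖⁻¹ • v, ?_⟩ : Sp n)) (by fun_prop) ?_ (fun σ => le_max_right _ _) ?_
    · rw [mem_sphere_zero_iff_norm, norm_smul, norm_inv, norm_norm, inv_mul_cancel₀ hvn.ne']
    · exact HasCompactSupport.of_compactSpace _
    · apply ne_of_gt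
      apply lt_max_of_lt_left
      simp only [inner_smul_left, real_inner_self_eq_norm_sq, conj_trivial]
      positivity
  · intro X Xo h
    rw [L2.inner_indicatorConstLp_one, inner_polyL, ← integral_indicator hms]
    apply integral_congr_ae
    filter_upwards [h.1, h.2, ae_refl (v := v) h.1] with σ h1 h2 h3
    have hR : ⟪((sphMap (Rf v) σ : Sp n) : Eu n), v⟫ = - ⟪(σ : Eu n), v⟫ := Rf_inner hv _
    rw [hR] at h3
    have e1 : pev (pconj (1 : RPoly n)) (σ : Eu n) = 1 := by rw [pev_pconj]; simp [pev]
    rw [e1, one_mul]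
    by_cases h0 : 0 < ⟪(σ : Eu n), v⟫
    · rw [indicator_of_mem (by exact h0), h2, h3 (by linarith), sub_zero]
    · rw [indicator_of_notMem (by exact h0), h1 (not_lt.1 h0)]

lemma OddOf.norm_eq {v : Eu n} (hv : v ≠ 0) {X Xo : Lp ℂ 2 (nu n)} (hX : OddOf v X Xo) :
    ‖Xo‖ ^ 2 = 2 * ‖X‖ ^ 2 := by
  have h1 := hX.inner_eq hv hX
  rw [inner_self_eq_norm_sq_to_K, inner_self_eq_norm_sq_to_K] at h1
  simp only [Complex.coe_algebraMap] at h1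
  exact_mod_cast h1

set_option maxHeartbeats 1000000 in
lemma static_dir_two (hn : 2 ≤ n) (α : ℝ) {v : Eu n} (hv : v ≠ 0) (hd : 0 < gam n α + lamj n 1) :
    ∃ ε > 0, ∀ (τ : ℝ) (Φ Ψ Φo Ψo : Lp ℂ 2 (nu n)), OddOf v Φ Φo → OddOf v Ψ Ψo →
      (∀ (j : ℕ) (p : RPoly n), p.IsHomogeneous j → plap p = 0 →
        inner ℂ (polyL n p) Ψ = qsym n α j τ * inner ℂ (polyL n p) Φ) →
      (∀ (j : ℕ) (p : RPoly n), p.IsHomogeneous j → plap p = 0 →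
        inner ℂ (polyL n p) Ψo = qsym n α j τ * inner ℂ (polyL n p) Φo) →
      ((gam n α + lamj n 1) ^ 2 + ε) * ‖Φ‖ ^ 2 ≤ ‖Ψ‖ ^ 2 := by
  obtain ⟨ι, b, deg, P, hP, -⟩ := exists_basis hn
  obtain ⟨s, hs1, hs2⟩ := half_sphere hv
  set d := gam n α + lamj n 1 with hdd
  set e := polyL n (plin v) with he
  set one := polyL n (1 : RPoly n) with hone
  have he0 : e ≠ 0 := by rintro h; rw [h, inner_zero_right] at hs1; exact hs1 rfl
  have hen : 0 < ‖e‖ := norm_pos_iff.2 he0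
  have hsn : 0 < ‖(inner ℂ s e : ℂ)‖ := norm_pos_iff.2 hs1
  have hn2 : (2:ℝ) ≤ n := by exact_mod_cast hn
  set B := (‖one‖ + 2 * ‖s‖) / ‖(inner ℂ s e : ℂ)‖ * ‖e‖ + 2 with hB
  have hBp : 0 < B := by positivity
  refine ⟨1 / B ^ 2, by positivity, fun τ Φ Ψ Φo Ψo hΦ hΨ hr hro => ?_⟩
  set κ : ℂ := ((τ ^ 2 : ℝ) : ℂ) + ((α - 2) * τ : ℝ) * Complex.I with hκ
  set X := Ψ + (κ + d) • Φ with hX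
  set Xo := Ψo + (κ + d) • Φo with hXo
  have hXX : OddOf v X Xo := hΨ.comb hΦ _
  have hq : ∀ j, qsym n α j τ + (κ + d) = ((d - (gam n α + lamj n j) : ℝ) : ℂ) := by
    intro j; rw [qsym, hκ]; push_cast; ring
  have cX : ∀ (j : ℕ) (p : RPoly n), p.IsHomogeneous j → plap p = 0 →
      inner ℂ (polyL n p) X = ((d - (gam n α + lamj n j) : ℝ) : ℂ) * inner ℂ (polyL n p) Φ := by
    intro j p h1 h2
    rw [hX, inner_add_right, inner_smul_right, hr j p h1 h2, ← hq]; ring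
  have cXo : ∀ (j : ℕ) (p : RPoly n), p.IsHomogeneous j → plap p = 0 →
      inner ℂ (polyL n p) Xo = ((d - (gam n α + lamj n j) : ℝ) : ℂ) * inner ℂ (polyL n p) Φo := by
    intro j p h1 h2
    rw [hXo, inner_add_right, inner_smul_right, hro j p h1 h2, ← hq]; ring
  have hoddΦ := hΦ.odd
  -- step 1
  have s1 : ‖X - (d:ℂ) • Φ‖ ^ 2 ≤ ‖Ψ‖ ^ 2 := by
    refine hasSum_le (fun i => ?_) (parseval b _) (parseval b _)
    obtain ⟨h1, h2, h3⟩ := hP i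
    rw [h3, inner_sub_right, inner_smul_right, cX _ _ h1 h2, hr _ _ h1 h2, ← sub_mul, norm_mul, norm_mul, mul_pow, mul_pow]
    refine mul_le_mul_of_nonneg_right ?_ (by positivity)
    refine le_trans (le_of_eq ?_) (qsym_sq n α (deg i) τ)
    rw [← Complex.ofReal_sub, Complex.norm_real, Real.norm_eq_abs, sq_abs]; ring
  -- step 2
  have s2 : RCLike.re (inner ℂ X Φ : ℂ) ≤ 0 := by
    have h1 : inner ℂ Xo Φo = 2 * inner ℂ X Φ := hXX.inner_eq hv hΦ
    have h2 : RCLike.re (inner ℂ Xo Φo : ℂ) ≤ 0 := by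
      have h3 := Complex.reCLM.hasSum (b.hasSum_inner_mul_inner Xo Φo)
      refine hasSum_le (fun i => ?_) h3 (hasSum_zero (β := ι))
      obtain ⟨h1, h2, h3⟩ := hP i
      have h4 : inner ℂ Xo (b i) = ((d - (gam n α + lamj n (deg i)) : ℝ) : ℂ) * starRingEnd ℂ (inner ℂ (b i) Φo) := by
        rw [← inner_conj_symm, h3, cXo _ _ h1 h2, map_mul, Complex.conj_ofReal]
      have h5 : inner ℂ Xo (b i) * inner ℂ (b i) Φo =
          (((d - (gam n α + lamj n (deg i))) * ‖(inner ℂ (b i) Φo : ℂ)‖ ^ 2 : ℝ) : ℂ) := by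
        rw [h4, mul_assoc, Complex.conj_mul']; push_cast; ring
      rw [h5, Complex.reCLM_apply, Complex.ofReal_re]
      rcases Nat.eq_zero_or_pos (deg i) with hi | hi
      · rw [hi] at h1
        rw [h3, odd_deg_zero hoddΦ h1]; simp
      · have := lamj_mono hn (show 1 ≤ deg i from hi)
        refine mul_nonpos_of_nonpos_of_nonneg ?_ (by positivity)
        rw [hdd]; linarith
    rw [h1] at h2
    have : RCLike.re (2 * inner ℂ X Φ : ℂ) = 2 * RCLike.re (inner ℂ X Φ : ℂ) := by simp
    linarith
  -- step 3
  have s3 : d ^ 2 * ‖Φ‖ ^ 2 + ‖X‖ ^ 2 ≤ ‖Ψ‖ ^ 2 := by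
    rw [norm_sub_sq (𝕜 := ℂ), inner_smul_right, norm_smul] at s1
    have h1 : RCLike.re ((d:ℂ) * inner ℂ X Φ) = d * RCLike.re (inner ℂ X Φ : ℂ) := by simp
    rw [h1, Complex.norm_real, Real.norm_eq_abs, mul_pow, sq_abs] at s1
    have : d * RCLike.re (inner ℂ X Φ : ℂ) ≤ 0 := mul_nonpos_of_nonneg_of_nonpos hd.le s2
    linarith
  -- step 4
  set c : ℂ := inner ℂ e Φo / (‖e‖ ^ 2 : ℝ) with hc
  set Z := Φo - c • e with hZ
  have hee : inner ℂ e Z = 0 := by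
    rw [hZ, inner_sub_right, inner_smul_right, inner_self_eq_norm_sq_to_K, hc]
    have : ((‖e‖:ℝ):ℂ) ≠ 0 := by exact_mod_cast hen.ne'
    push_cast
    simp only [Complex.coe_algebraMap]
    field_simp
    ring
  have hZodd : ∀ᵐ σ ∂(nu n), Z (sphMap (Rf v) σ) = - Z σ := by
    have h1 : ∀ᵐ σ ∂(nu n), Z σ = Φo σ - c * e σ := by
      filter_upwards [Lp.coeFn_sub Φo (c • e), Lp.coeFn_smul c e] with σ h1 h2
      rw [hZ, h1, Pi.sub_apply, h2]; rfl
    filter_upwards [h1, ae_refl (v := v) h1, hoddΦ, plin_odd v hv] with σ h1 h2 h3 h4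
    rw [h1, h2, h3, h4]; ring
  -- step 5
  have hXn : ‖Xo‖ ^ 2 = 2 * ‖X‖ ^ 2 := hXX.norm_eq hv
  have hΦn : ‖Φo‖ ^ 2 = 2 * ‖Φ‖ ^ 2 := hΦ.norm_eq hv
  have s5 : ‖Z‖ ^ 2 ≤ ‖Xo‖ ^ 2 := by
    refine hasSum_le (fun i => ?_) (parseval b _) (parseval b _)
    obtain ⟨h1, h2, h3⟩ := hP i
    rw [h3]
    rcases lt_trichotomy (deg i) 1 with hi | hi | hi
    · have : deg i = 0 := by omega
      rw [this] at h1
      rw [odd_deg_zero hZodd h1]; simp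
    · rw [hi] at h1
      rw [odd_deg_one hZodd h1, ← he, hee]; simp
    · rw [hZ, inner_sub_right, inner_smul_right, he, plin_orth hn v hi.ne' h1 h2, mul_zero, sub_zero, cXo _ _ h1 h2, norm_mul]
      have h5 : (1:ℝ) ≤ ‖((d - (gam n α + lamj n (deg i)) : ℝ) : ℂ)‖ := by
        rw [Complex.norm_real, Real.norm_eq_abs, abs_sub_comm]
        refine le_trans ?_ (le_abs_self _)
        have := lamj_mono hn (show 2 ≤ deg i by omega)
        have h6 : lamj n 2 - lamj n 1 = n + 1 := by unfold lamj; push_cast; ring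
        rw [hdd]; linarith
      gcongr
      exact le_mul_of_one_le_left (norm_nonneg _) h5
  have s5' : ‖Z‖ ≤ 2 * ‖X‖ := by
    apply abs_le_of_sq_le_sq' _ (by positivity) |>.2
    nlinarith [sq_nonneg ‖X‖]
  -- step 6
  have s6 : ‖(inner ℂ one Φ : ℂ)‖ ≤ ‖one‖ * ‖X‖ := by
    have h1 := cX 0 1 (isHomogeneous_one _ _) (plap_eq_zero (isHomogeneous_one _ _) (by norm_num))
    have h2 := norm_inner_le_norm (𝕜 := ℂ) one X
    rw [← hone] at h1
    rw [h1, norm_mul] at h2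
    have h5 : (1:ℝ) ≤ ‖((d - (gam n α + lamj n 0) : ℝ) : ℂ)‖ := by
      rw [Complex.norm_real, Real.norm_eq_abs]
      refine le_trans ?_ (le_abs_self _)
      rw [hdd]; unfold lamj; push_cast; linarith
    exact (le_mul_of_one_le_left (norm_nonneg _) h5).trans h2
  have s7 : ‖c‖ * ‖(inner ℂ s e : ℂ)‖ ≤ (‖one‖ + 2 * ‖s‖) * ‖X‖ := by
    have h1 : c * inner ℂ s e = inner ℂ one Φ - inner ℂ s Z := by
      rw [hone, ← hs2 Φ Φo hΦ, hZ, inner_sub_right, inner_smul_right]; ring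
    rw [← norm_mul, h1]
    have h2 := norm_inner_le_norm (𝕜 := ℂ) s Z
    have h3 := norm_sub_le (inner ℂ one Φ : ℂ) (inner ℂ s Z)
    have h4 : ‖s‖ * ‖Z‖ ≤ ‖s‖ * (2 * ‖X‖) := by gcongr
    linarith
  have s8 : ‖Φo‖ ≤ B * ‖X‖ := by
    have h1 : ‖c‖ ≤ (‖one‖ + 2 * ‖s‖) / ‖(inner ℂ s e : ℂ)‖ * ‖X‖ := by
      rw [div_mul_eq_mul_div, le_div_iff₀ hsn]; exact s7
    have h2 : Φo = c • e + Z := by rw [hZ]; abel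
    have h3 := norm_add_le (c • e) Z
    rw [← h2, norm_smul] at h3
    have h4 : ‖c‖ * ‖e‖ ≤ (‖one‖ + 2 * ‖s‖) / ‖(inner ℂ s e : ℂ)‖ * ‖X‖ * ‖e‖ := by gcongr
    rw [hB]; linarith
  have s9 : ‖Φ‖ ^ 2 ≤ B ^ 2 * ‖X‖ ^ 2 := by
    have h1 : ‖Φo‖ ^ 2 ≤ (B * ‖X‖) ^ 2 := by gcongr
    rw [hΦn, mul_pow] at h1
    refine le_trans ?_ h1
    have := sq_nonneg ‖Φ‖
    linarith only [this]
  have : 1 / B ^ 2 * ‖Φ‖ ^ 2 ≤ ‖X‖ ^ 2 := by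
    rw [one_div, inv_mul_le_iff₀ (by positivity)]; exact s9
  rw [add_mul]
  exact (add_le_add_right this _).trans s3
end StaticF

open MeasureTheory Metric Set Filter
open scoped RealInnerProductSpace

section Conv
open FourierTransform
variable {n : ℕ}

lemma oddx_on {v : Eu n} (hv : v ≠ 0) (F : Eu n → ℂ) {x : Eu n} (hx : x ∈ Hs v) : oddx v F x = F x := by
  have : Rf v x ∉ Hs v := by
    have h1 : 0 < ⟪x, v⟫ := hx
    change ¬ (0 < ⟪Rf v x, v⟫)
    rw [Rf_inner hv]; linarith
  rw [oddx, indicator_of_mem hx, indicator_of_notMem this, sub_zero]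

lemma oddx_odd (v : Eu n) (F : Eu n → ℂ) (x : Eu n) : oddx v F (Rf v x) = - oddx v F x := by
  simp only [oddx, Rf_Rf]; ring

lemma oddx_lint {v : Eu n} (hv : v ≠ 0) {F : Eu n → ℂ} (hm : Measurable (oddx v F)) (β : ℝ) :
    ∫⁻ x, ENNReal.ofReal (‖x‖ ^ β) * ‖oddx v F x‖ₑ ^ 2 =
      2 * ∫⁻ x in Hs v, ENNReal.ofReal (‖x‖ ^ β) * ‖F x‖ₑ ^ 2 := by
  set g : Eu n → ENNReal := fun x => ENNReal.ofReal (‖x‖ ^ β) * ‖oddx v F x‖ₑ ^ 2 with hg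
  have gm : Measurable g := by
    refine Measurable.mul ?_ (hm.enorm.pow_const 2)
    exact ENNReal.measurable_ofReal.comp (measurable_norm.pow_const β)
  have hgR : ∀ x, g (Rf v x) = g x := by
    intro x
    simp only [hg, oddx_odd, enorm_neg, LinearIsometryEquiv.norm_map]
  have hH := (Hs_open v).measurableSet
  have h1 : ∀ x, g x = (Hs v).indicator g x + (Hs v).indicator g (Rf v x) := by
    intro x
    rcases lt_trichotomy 0 ⟪x, v⟫ with h | h | h
    · have a : x ∈ Hs v := h
      have b : Rf v x ∉ Hs v := by
        change ¬ (0 < ⟪Rf v x, v⟫); rw [Rf_inner hv]; linarith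
      rw [indicator_of_mem a, indicator_of_notMem b, add_zero]
    · have a : x ∉ Hs v := by change ¬ (0 < ⟪x, v⟫); rw [← h]; simp
      have b : Rf v x ∉ Hs v := by
        change ¬ (0 < ⟪Rf v x, v⟫); rw [Rf_inner hv, ← h]; simp
      rw [indicator_of_notMem a, indicator_of_notMem b, add_zero]
      simp only [hg, oddx, indicator_of_notMem a, indicator_of_notMem b]; simp
    · have a : x ∉ Hs v := by change ¬ (0 < ⟪x, v⟫); linarith
      have b : Rf v x ∈ Hs v := by
        change (0 < ⟪Rf v x, v⟫); rw [Rf_inner hv]; linarith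
      rw [indicator_of_mem b, indicator_of_notMem a, zero_add, hgR]
  have mp := (Rf v).measurePreserving
  calc ∫⁻ x, g x = ∫⁻ x, ((Hs v).indicator g x + (Hs v).indicator g (Rf v x)) := lintegral_congr h1
    _ = (∫⁻ x, (Hs v).indicator g x) + ∫⁻ x, (Hs v).indicator g (Rf v x) := lintegral_add_left (gm.indicator hH) _
    _ = 2 * ∫⁻ x, (Hs v).indicator g x := by
      rw [mp.lintegral_comp (gm.indicator hH)]; ring
    _ = _ := by
      rw [lintegral_indicator hH]
      congr 1
      refine setLIntegral_congr_fun hH fun x hx => ?_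
      simp only [hg, oddx_on hv F hx]

lemma ann_real {v : Eu n} (hv : v ≠ 0) {g : Eu n → ℝ} (h : Ann (oddx v (fun x => (g x : ℂ)))) (β : ℝ) :
    IntegrableOn (fun x => ‖x‖ ^ β * (g x) ^ 2) (Hs v) ∧
    ∫⁻ x, ENNReal.ofReal (‖x‖ ^ β) * ‖oddx v (fun x => (g x : ℂ)) x‖ₑ ^ 2 =
      2 * ENNReal.ofReal (∫ x in Hs v, ‖x‖ ^ β * (g x) ^ 2) := by
  have hH := (Hs_open v).measurableSet
  have hi : IntegrableOn (fun x => ‖x‖ ^ β * (g x) ^ 2) (Hs v) := by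
    obtain ⟨C, hC⟩ := h.bd
    obtain ⟨ε, hε, h1⟩ := h.near
    obtain ⟨R, h2⟩ := h.far
    have := ann_integrable (F := fun x => (oddx v (fun x => (g x : ℂ)) x) ^ 2)
      (g := fun x => ((‖x‖ ^ β : ℝ) : ℂ)) (C := C ^ 2) (R := R) hε (h.m.pow_const 2)
      (fun x => by rw [norm_pow]; gcongr; exact hC x) (fun x hx => by simp [h1 x hx])
      (fun x hx => by simp [h2 x hx])
      (fun x hx => by
        refine Complex.continuous_ofReal.continuousAt.comp ?_
        exact continuous_norm.continuousAt.rpow_const (Or.inl (norm_ne_zero_iff.2 hx)))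
    refine (this.integrableOn (s := Hs v)).re.congr ?_
    filter_upwards [ae_restrict_mem hH] with x hx
    rw [oddx_on hv _ hx, ← Complex.ofReal_pow, ← Complex.ofReal_mul, mul_comm]
    exact Complex.ofReal_re _
  refine ⟨hi, ?_⟩
  rw [oddx_lint hv h.m, ofReal_integral_eq_lintegral_ofReal hi]
  · congr 1
    refine setLIntegral_congr_fun hH fun x hx => ?_
    rw [ENNReal.ofReal_mul (by positivity), ← ofReal_norm, ← ENNReal.ofReal_pow (norm_nonneg _),
      Complex.norm_real, Real.norm_eq_abs, sq_abs]
  · exact Eventually.of_forall fun x => by positivity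

lemma navier_ineq {v : Eu n} (hv : v ≠ 0) (hn : 2 ≤ n) (α : ℝ) {u : Eu n → ℝ} (hu : NavierAdm (Hs v) u) {M : ℝ} (hM : 0 ≤ M)
    (hs : ∀ ξ, M * ‖trL ((α - 4 + n) / 2) (hpair_navier hv hu).annF ξ‖ ^ 2 ≤
      ‖trL ((α + n) / 2) (hpair_navier hv hu).annL ξ‖ ^ 2) :
    M * (∫ x in Hs v, ‖x‖ ^ (α - 4) * (u x) ^ 2) ≤ ∫ x in Hs v, ‖x‖ ^ α * (lap u x) ^ 2 := by
  have h := quot_static (by omega) α (hpair_navier hv hu) hM hs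
  rw [(ann_real hv (hpair_navier hv hu).annF _).2, (ann_real hv (hpair_navier hv hu).annL _).2,
    mul_left_comm, ENNReal.mul_le_mul_iff_right (by norm_num) (by norm_num), ← ENNReal.ofReal_mul hM,
    ENNReal.ofReal_le_ofReal_iff] at h
  · exact h
  · exact integral_nonneg fun x => by positivity

lemma navier_den_pos {v : Eu n} (hv : v ≠ 0) (β : ℝ) {u : Eu n → ℝ} (hu : NavierAdm (Hs v) u)
    (h0 : ∃ x ∈ Hs v, u x ≠ 0) : 0 < ∫ x in Hs v, ‖x‖ ^ β * (u x) ^ 2 := by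
  have hi := (ann_real hv (hpair_navier hv hu).annF β).1
  rw [setIntegral_pos_iff_support_of_nonneg_ae (Eventually.of_forall fun x => by positivity) hi]
  have hc : ContinuousOn u (Hs v) := hu.1.continuousOn.mono subset_closure
  have ho : IsOpen (Hs v ∩ u ⁻¹' {0}ᶜ) := hc.isOpen_inter_preimage (Hs_open v) isOpen_compl_singleton
  obtain ⟨x, hx, hx0⟩ := h0
  refine lt_of_lt_of_le (ho.measure_pos volume ⟨x, hx, hx0⟩) (measure_mono ?_)
  rintro y ⟨hy, hy0⟩
  refine ⟨?_, hy⟩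
  have : 0 < ‖y‖ := norm_pos_iff.2 (Hs_ne_zero hy)
  have h2 : u y ≠ 0 := hy0
  rw [Function.mem_support]
  positivity

lemma dir_navier {v : Eu n} (hv : v ≠ 0) {u : Eu n → ℝ} (hu : DirichletAdm (Hs v) u) : NavierAdm (Hs v) u := by
  obtain ⟨h1, h2⟩ := dir_near_far hu
  refine ⟨hu.1.contDiffOn, fun x hx => ?_, h1, h2⟩
  rw [Hs_frontier hv] at hx
  by_contra hne
  have : x ∈ Hs v := hu.2.2 (subset_tsupport _ hne)
  have h3 : 0 < ⟪x, v⟫ := this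
  rw [show ⟪x, v⟫ = 0 from hx] at h3
  exact lt_irrefl _ h3

lemma tr_sub {c : ℝ} {F G : Eu n → ℂ} (hF : Ann F) (hG : Ann G) (ξ : ℝ) (σ : Sp n) :
    tr c (fun x => F x - G x) ξ σ = tr c F ξ σ - tr c G ξ σ := by
  unfold tr
  have h1 : Integrable (gsl c F σ) := memLp_one_iff_integrable.1 (gsl_memLp c hF σ 1)
  have h2 : Integrable (gsl c G σ) := memLp_one_iff_integrable.1 (gsl_memLp c hG σ 1)
  have e : gsl c (fun x => F x - G x) σ = gsl c F σ + (fun s => - gsl c G σ s) := by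
    ext s; simp [gsl]; ring
  rw [e]
  rw [Real.fourier_real_eq, Real.fourier_real_eq, Real.fourier_real_eq, ← integral_sub]
  · refine integral_congr_ae (Eventually.of_forall fun s => ?_)
    simp only [Pi.add_apply, smul_add, smul_neg]
    ring
  · simpa [mul_comm] using (Real.fourierIntegral_convergent_iff ξ).2 h1
  · simpa [mul_comm] using (Real.fourierIntegral_convergent_iff ξ).2 h2

lemma Ann.refl (v : Eu n) {F : Eu n → ℂ} (hF : Ann F) : Ann (fun x => F (Rf v x)) := by
  obtain ⟨m, ⟨C, hC⟩, ⟨ε, hε, h1⟩, R, h2⟩ := hF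
  refine ⟨m.comp (Rf v).continuous.measurable, ⟨C, fun x => hC _⟩, ⟨ε, hε, fun x hx => h1 _ ?_⟩, R, fun x hx => h2 _ ?_⟩
  · rwa [LinearIsometryEquiv.norm_map]
  · rwa [LinearIsometryEquiv.norm_map]

lemma oddOf_tr {v : Eu n} {F : Eu n → ℂ} (hF : Ann F) (hFo : Ann (oddx v F)) (hs : ∀ x, x ∉ Hs v → F x = 0)
    (c ξ : ℝ) : OddOf v (trL c hF ξ) (trL c hFo ξ) := by
  have hind : (Hs v).indicator F = F := by
    ext x
    by_cases hx : x ∈ Hs v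
    · rw [indicator_of_mem hx]
    · rw [indicator_of_notMem hx, hs x hx]
  constructor
  · filter_upwards [trL_coe c hF ξ] with σ h1 h2
    rw [h1, tr]
    have : gsl c F σ = 0 := by
      ext s
      rw [gsl, hs]
      · simp
      · change ¬ (0 < ⟪Real.exp s • (σ : Eu n), v⟫)
        rw [inner_smul_left, not_lt]
        exact mul_nonpos_of_nonneg_of_nonpos (Real.exp_pos s).le h2
    rw [this, Real.fourier_real_eq]; simp
  · filter_upwards [trL_coe c hF ξ, ae_refl (v := v) (trL_coe c hF ξ), trL_coe c hFo ξ] with σ h1 h2 h3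
    rw [h1, h2, h3, ← tr_refl, ← tr_sub hF (hF.refl v)]
    congr 1
    ext x
    rw [oddx, hind]

end Conv

open MeasureTheory Metric Set Filter
open scoped RealInnerProductSpace

section Lower
variable {n : ℕ}

lemma navier_lower {v : Eu n} (hv : v ≠ 0) (hn : 2 ≤ n) (α : ℝ) {m : ℝ} (hm0 : 0 ≤ m)
    (hm : ∀ k : ℕ, 1 ≤ k → m ≤ (gam n α + lamj n k) ^ 2) {u : Eu n → ℝ} (hu : NavierAdm (Hs v) u) :
    m * (∫ x in Hs v, ‖x‖ ^ (α - 4) * (u x) ^ 2) ≤ ∫ x in Hs v, ‖x‖ ^ α * (lap u x) ^ 2 :=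
  navier_ineq hv hn α hu hm0 fun ξ => static_navier hn α (hpair_navier hv hu) (oddx_odd v _) hm ξ

lemma static_dir (hn : 2 ≤ n) (α : ℝ) {v : Eu n} (hv : v ≠ 0) {m : ℝ}
    (hm : ∀ k : ℕ, 1 ≤ k → m ≤ (gam n α + lamj n k) ^ 2) (hm1 : ∃ k : ℕ, 1 ≤ k ∧ m = (gam n α + lamj n k) ^ 2) :
    ∃ ε > 0, ∀ (τ : ℝ) (Φ Ψ Φo Ψo : Lp ℂ 2 (nu n)), OddOf v Φ Φo → OddOf v Ψ Ψo →
      (∀ (j : ℕ) (p : RPoly n), p.IsHomogeneous j → plap p = 0 →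
        inner ℂ (polyL n p) Ψ = qsym n α j τ * inner ℂ (polyL n p) Φ) →
      (∀ (j : ℕ) (p : RPoly n), p.IsHomogeneous j → plap p = 0 →
        inner ℂ (polyL n p) Ψo = qsym n α j τ * inner ℂ (polyL n p) Φo) →
      (m + ε) * ‖Φ‖ ^ 2 ≤ ‖Ψ‖ ^ 2 := by
  have hn2 : (2:ℝ) ≤ n := by exact_mod_cast hn
  have l0 : lamj n 0 = 0 := by unfold lamj; simp
  have l1 : 0 < lamj n 1 := by unfold lamj; push_cast; linarith
  by_cases h0 : m ≤ (gam n α) ^ 2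
  · obtain ⟨ε, hε, h⟩ := static_dir_one hn α hv (m := m) (fun k => by
      rcases Nat.eq_zero_or_pos k with rfl | hk
      · rw [l0, add_zero]; exact h0
      · exact hm k hk)
    refine ⟨ε, hε, fun τ Φ Ψ Φo Ψo h1 h2 h3 h4 => h τ Φ Ψ ?_ h3⟩
    filter_upwards [h1.1] with σ h5 h6 using h5 h6.le
  · have h1 := hm 1 le_rfl
    have hd : 0 < gam n α + lamj n 1 := by
      by_contra hc
      apply h0
      refine h1.trans ?_
      nlinarith
    have hme : m = (gam n α + lamj n 1) ^ 2 := by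
      obtain ⟨k, hk, hk2⟩ := hm1
      refine le_antisymm h1 ?_
      rw [hk2]
      have := lamj_mono hn hk
      gcongr
    obtain ⟨ε, hε, h⟩ := static_dir_two hn α hv hd
    rw [hme]
    exact ⟨ε, hε, h⟩

lemma dir_lower {v : Eu n} (hv : v ≠ 0) (hn : 2 ≤ n) (α : ℝ) {m : ℝ} (hm0 : 0 ≤ m)
    (hm : ∀ k : ℕ, 1 ≤ k → m ≤ (gam n α + lamj n k) ^ 2) (hm1 : ∃ k : ℕ, 1 ≤ k ∧ m = (gam n α + lamj n k) ^ 2) :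
    ∃ ε > 0, ∀ u : Eu n → ℝ, DirichletAdm (Hs v) u →
    (m + ε) * (∫ x in Hs v, ‖x‖ ^ (α - 4) * (u x) ^ 2) ≤ ∫ x in Hs v, ‖x‖ ^ α * (lap u x) ^ 2 := by
  obtain ⟨ε, hε, h⟩ := static_dir hn α hv hm hm1
  refine ⟨ε, hε, fun u hu => ?_⟩
  have hN := dir_navier hv hu
  refine navier_ineq hv hn α hN (by positivity) fun ξ => ?_
  have hD := hpair_dirichlet hu
  have hO := hpair_navier hv hN
  have s1 : ∀ x, x ∉ Hs v → (u x : ℂ) = 0 := by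
    intro x hx
    rw [image_eq_zero_of_notMem_tsupport (fun h => hx (hu.2.2 h))]; simp
  have s2 : ∀ x, x ∉ Hs v → (lap u x : ℂ) = 0 := by
    intro x hx
    rw [lap_zero]
    · simp
    · exact notMem_tsupport_iff_eventuallyEq.1 (fun h => hx (hu.2.2 h))
  have o1 := oddOf_tr hD.annF hO.annF s1 ((α - 4 + n) / 2) ξ
  have o2 := oddOf_tr hD.annL hO.annL s2 ((α + n) / 2) ξ
  have := h (2 * Real.pi * ξ) _ _ _ _ o1 o2
    (fun j p hp hpl => coeff_rel (by omega) α hD hp hpl ξ)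
    (fun j p hp hpl => coeff_rel (by omega) α hO hp hpl ξ)
  rw [o1.norm_eq hv, o2.norm_eq hv]
  linarith
end Lower

open MeasureTheory Metric Set Filter
open scoped RealInnerProductSpace

section Upper
open MvPolynomial
variable {n : ℕ}

/-- `(⟪x,w⟫ + i⟪x,e⟫)^k` -/
noncomputable def zpoly (w e : Eu n) (k : ℕ) : RPoly n := (plin w + C Complex.I * plin e) ^ k

lemma zpoly_hom (w e : Eu n) (k : ℕ) : (zpoly w e k).IsHomogeneous k := by
  unfold zpoly
  have h : (plin w + C Complex.I * plin e).IsHomogeneous 1 := by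
    refine (plin_hom w).add ?_
    simpa using (isHomogeneous_C (Fin n) Complex.I).mul (plin_hom e)
  simpa using h.pow k

lemma pev_zpoly (w e : Eu n) (k : ℕ) (x : Eu n) :
    pev (zpoly w e k) x = (((⟪x, w⟫ : ℝ) : ℂ) + Complex.I * ((⟪x, e⟫ : ℝ) : ℂ)) ^ k := by
  rw [← pev_plin, ← pev_plin]
  simp [zpoly, pev]

lemma pderiv_plin (w : Eu n) (i : Fin n) : pderiv i (plin w) = C ((w i : ℝ) : ℂ) := by
  classical
  unfold plin
  rw [map_sum]
  simp only [pderiv_C_mul, pderiv_X, smul_eq_mul]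
  rw [Finset.sum_eq_single i]
  · simp
  · intro j _ hj
    simp [Pi.single_apply, hj.symm]
  · simp

lemma zpoly_harm {w e : Eu n} (hw : ‖w‖ = 1) (he : ‖e‖ = 1) (hwe : ⟪w, e⟫ = 0) (k : ℕ) : plap (zpoly w e k) = 0 := by
  unfold plap zpoly
  set l := plin w + C Complex.I * plin e with hl
  have hd : ∀ i, pderiv i l = C (((w i : ℝ) : ℂ) + Complex.I * ((e i : ℝ) : ℂ)) := by
    intro i
    rw [hl, map_add, pderiv_C_mul, pderiv_plin, pderiv_plin]
    simp [smul_eq_C_mul]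
  have h2 : ∀ i, pderiv i (pderiv i (l ^ k)) =
      ((k : RPoly n) * ((k - 1 : ℕ) : RPoly n) * l ^ (k - 1 - 1)) * C ((((w i : ℝ) : ℂ) + Complex.I * ((e i : ℝ) : ℂ)) ^ 2) := by
    intro i
    rw [pderiv_pow, hd, Derivation.leibniz, pderiv_C, smul_zero, zero_add, Derivation.leibniz, pderiv_pow, hd]
    simp only [smul_eq_mul, Derivation.map_natCast, mul_zero, add_zero, map_pow]
    ring
  simp only [h2]
  rw [← Finset.mul_sum, ← map_sum]
  have h3 : ∑ i, (((w i : ℝ) : ℂ) + Complex.I * ((e i : ℝ) : ℂ)) ^ 2 = 0 := by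
    have a : ∑ i, (w i) ^ 2 = 1 := by rw [← EuclideanSpace.real_norm_sq_eq, hw]; norm_num
    have b : ∑ i, (e i) ^ 2 = 1 := by rw [← EuclideanSpace.real_norm_sq_eq, he]; norm_num
    have c : ∑ i, (w i) * (e i) = 0 := by
      rw [← hwe, PiLp.inner_apply]; simp [mul_comm]
    have e1 : ∀ i, (((w i : ℝ) : ℂ) + Complex.I * ((e i : ℝ) : ℂ)) ^ 2 =
        (((w i) ^ 2 : ℝ) : ℂ) - (((e i) ^ 2 : ℝ) : ℂ) + 2 * Complex.I * ((w i * e i : ℝ) : ℂ) := by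
      intro i; push_cast; ring_nf; rw [Complex.I_sq]; ring
    simp only [e1]
    rw [Finset.sum_add_distrib, Finset.sum_sub_distrib, ← Finset.mul_sum, ← Complex.ofReal_sum,
      ← Complex.ofReal_sum, ← Complex.ofReal_sum, a, b, c]
    simp
  rw [h3]; simp

lemma rad_int (hn : 2 ≤ n) {v : Eu n} {q : Eu n → ℝ} {h : ℝ → ℝ} {k : ℕ} (β : ℝ)
    (hq : ∀ (r : ℝ) x, q (r • x) = r ^ k * q x)
    (hi : IntegrableOn (fun x => ‖x‖ ^ β * (h (Real.log ‖x‖) * q x) ^ 2) (Hs v)) :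
    ∫ x in Hs v, ‖x‖ ^ β * (h (Real.log ‖x‖) * q x) ^ 2 =
      (∫ σ : Sp n, (Hs v).indicator (fun x => (q x) ^ 2) (σ : Eu n) ∂(nu n)) *
        ∫ s, Real.exp ((n + β + 2 * k) * s) * (h s) ^ 2 := by
  have hH := (Hs_open v).measurableSet
  rw [← integral_indicator hH, polar_integral (by omega) ((integrable_indicator_iff hH).2 hi), ← integral_mul_const]
  refine integral_congr_ae (Eventually.of_forall fun σ => ?_)
  simp only
  rw [← integral_const_mul]
  refine integral_congr_ae (Eventually.of_forall fun s => ?_)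
  simp only [smul_eq_mul]
  have hiff : Real.exp s • (σ : Eu n) ∈ Hs v ↔ (σ : Eu n) ∈ Hs v := by
    change 0 < ⟪Real.exp s • (σ : Eu n), v⟫ ↔ 0 < ⟪(σ : Eu n), v⟫
    rw [real_inner_smul_left]
    exact mul_pos_iff_of_pos_left (Real.exp_pos s)
  by_cases hσ : (σ : Eu n) ∈ Hs v
  · rw [indicator_of_mem (hiff.2 hσ), indicator_of_mem hσ, norm_expsmul, Real.log_exp, hq, ← Real.exp_mul,
      mul_pow, mul_pow, ← pow_mul, ← Real.exp_nat_mul]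
    rw [show ((n:ℝ) + β + 2 * k) * s = n * s + s * β + ((k * 2 : ℕ) : ℝ) * s by push_cast; ring, Real.exp_add, Real.exp_add]
    ring
  · rw [indicator_of_notMem (fun h => hσ (hiff.1 h)), indicator_of_notMem hσ]; simp
end Upper

open MeasureTheory Metric Set Filter
open scoped RealInnerProductSpace

section Upper2
open MvPolynomial Laplacian
variable {n : ℕ}

/-- cut-off profile -/
noncomputable def etaB : ContDiffBump (3 : ℝ) := ⟨1, 2, by norm_num, by norm_num⟩
noncomputable def eta (s : ℝ) : ℝ := etaB s

lemma eta_smooth (k : ℕ) : ContDiff ℝ k eta := etaB.contDiff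

lemma eta_zero {s : ℝ} (h : s < 1 ∨ 5 < s) : eta s = 0 := by
  apply etaB.zero_of_le_dist
  change 2 ≤ dist s 3
  rw [Real.dist_eq]
  rcases h with h | h
  · rw [abs_of_neg (by linarith)]; linarith
  · rw [abs_of_pos (by linarith)]; linarith

lemma eta_three : eta 3 = 1 := etaB.one_of_mem_closedBall (by simp [etaB.rIn_pos.le])

lemma eta_compact : HasCompactSupport eta := etaB.hasCompactSupport

/-- radial factor -/
noncomputable def Fb (b δ s : ℝ) : ℝ := Real.exp (b * s) * eta (δ * s)

lemma eta_hd (s : ℝ) : HasDerivAt eta (deriv eta s) s :=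
  ((eta_smooth 2).differentiable (by norm_num) s).hasDerivAt
lemma eta_hd2 (s : ℝ) : HasDerivAt (deriv eta) (deriv (deriv eta) s) s := by
  have h : ContDiff ℝ 1 (deriv eta) := by
    have := eta_smooth 2
    exact ((contDiff_succ_iff_deriv (n := 1)).1 (by exact_mod_cast this)).2.2
  exact (h.differentiable (by norm_num) s).hasDerivAt

lemma Fb_smooth (b δ : ℝ) : ContDiff ℝ 2 (Fb b δ) := by
  have h2 : ContDiff ℝ 2 eta := by exact_mod_cast eta_smooth 2
  unfold Fb
  fun_prop

lemma exp_hd (b s : ℝ) : HasDerivAt (fun s => Real.exp (b * s)) (Real.exp (b * s) * b) s := by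
  have : HasDerivAt (fun s : ℝ => b * s) b s := by simpa using (hasDerivAt_id s).const_mul b
  exact this.exp

lemma lin_hd (δ s : ℝ) : HasDerivAt (fun s : ℝ => δ * s) δ s := by
  simpa using (hasDerivAt_id s).const_mul δ

lemma Fb_d1 (b δ : ℝ) (s : ℝ) : HasDerivAt (Fb b δ)
    (Real.exp (b * s) * (b * eta (δ * s) + δ * deriv eta (δ * s))) s := by
  have h2 : HasDerivAt (fun s => eta (δ * s)) (deriv eta (δ * s) * δ) s := (eta_hd (δ * s)).comp s (lin_hd δ s)
  have := (exp_hd b s).mul h2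
  refine this.congr_deriv ?_
  ring

lemma Fb_d2 (b δ : ℝ) (s : ℝ) : HasDerivAt (fun s => Real.exp (b * s) * (b * eta (δ * s) + δ * deriv eta (δ * s)))
    (Real.exp (b * s) * (b ^ 2 * eta (δ * s) + 2 * b * δ * deriv eta (δ * s) + δ ^ 2 * deriv (deriv eta) (δ * s))) s := by
  have h2 : HasDerivAt (fun s => eta (δ * s)) (deriv eta (δ * s) * δ) s := (eta_hd (δ * s)).comp s (lin_hd δ s)
  have h3 : HasDerivAt (fun s => deriv eta (δ * s)) (deriv (deriv eta) (δ * s) * δ) s :=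
    (eta_hd2 (δ * s)).comp s (lin_hd δ s)
  have := (exp_hd b s).mul ((h2.const_mul b).add (h3.const_mul δ))
  refine this.congr_deriv ?_
  simp only [Pi.add_apply]
  ring

lemma navier_test (hn : 2 ≤ n) {v : Eu n} (hv : v ≠ 0) (α : ℝ) {k : ℕ} (hk : 1 ≤ k) {δ : ℝ} (h0 : 0 < δ) (h1 : δ ≤ 1) :
    ∃ u, NavierAdm (Hs v) u ∧ (∃ x ∈ Hs v, u x ≠ 0) ∧
      (∫ x in Hs v, ‖x‖ ^ α * (lap u x) ^ 2) / (∫ x in Hs v, ‖x‖ ^ (α - 4) * (u x) ^ 2) =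
      (∫ s, (-(gam n α + lamj n k) * eta s + (2 - α) * δ * deriv eta s + δ ^ 2 * deriv (deriv eta) s) ^ 2) /
        ∫ s, eta s ^ 2 := by
  have hvn : 0 < ‖v‖ := norm_pos_iff.2 hv
  set e : Eu n := ‖v‖⁻¹ • v with he
  have hen : ‖e‖ = 1 := by rw [he, norm_smul, norm_inv, norm_norm, inv_mul_cancel₀ hvn.ne']
  obtain ⟨w, hw, hwe'⟩ := exists_perp hn e
  have hwe : ⟪w, e⟫ = 0 := by rw [real_inner_comm]; exact hwe'
  set Q := zpoly w e k with hQ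
  set b : ℝ := -(α - 4 + n) / 2 - k with hb
  set f : ℝ → ℂ := fun s => (Fb b δ s : ℂ) with hf
  have hfc : ContDiff ℝ 2 f := Complex.ofRealCLM.contDiff.comp (Fb_smooth b δ)
  have hf1 : ∀ s < 1, f s = 0 := by
    intro s hs
    have : eta (δ * s) = 0 := eta_zero (Or.inl (by nlinarith))
    simp [hf, Fb, this]
  have hf2 : ∀ s > 5 / δ, f s = 0 := by
    intro s hs
    have : eta (δ * s) = 0 := eta_zero (Or.inr (by
      have := (div_lt_iff₀ h0).1 hs; linarith))
    simp [hf, Fb, this]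
  set q : Eu n → ℝ := fun x => (pev Q x).im with hq
  set u : Eu n → ℝ := fun x => (Nf f Q x).im with hu
  have huq : ∀ x, u x = Fb b δ (Real.log ‖x‖) * q x := by
    intro x; simp only [hu, Nf, hf, hq, Complex.im_ofReal_mul]
  have hqh : ∀ (r : ℝ) x, q (r • x) = r ^ k * q x := by
    intro r x
    simp only [hq]
    rw [pev_smul (zpoly_hom w e k), ← Complex.ofReal_pow, Complex.im_ofReal_mul]
  have hN : NavierAdm (Hs v) u := by
    refine ⟨(Complex.imCLM.contDiff.comp (Nf_contDiff hfc hf1 Q)).contDiffOn, ?_, ⟨2, by norm_num, ?_⟩, Real.exp (5 / δ), ?_⟩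
    · intro x hx
      rw [Hs_frontier hv] at hx
      have hx : ⟪x, v⟫ = 0 := hx
      have hxe : ⟪x, e⟫ = 0 := by rw [he, real_inner_smul_right, hx, mul_zero]
      rw [huq]
      simp only [hq, hQ]
      rw [pev_zpoly, hxe]
      simp only [Complex.ofReal_zero, mul_zero, add_zero]
      rw [← Complex.ofReal_pow, Complex.ofReal_im, mul_zero]
    · intro x hx
      simp only [hu]; rw [Nf_zero_near hf1 Q hx]; rfl
    · intro x hx
      simp only [hu]; rw [Nf_zero_far hf2 Q hx]; rfl
  have hne : ∃ x ∈ Hs v, u x ≠ 0 := by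
    have hk0 : (0:ℝ) < k := by exact_mod_cast hk
    have hk1 : (1:ℝ) ≤ k := by exact_mod_cast hk
    set t : ℝ := Real.pi / (2 * k) with ht
    have ht0 : 0 < t := by positivity
    have htp : t < Real.pi := by
      rw [ht, div_lt_iff₀ (by positivity)]
      nlinarith [Real.pi_pos]
    have hsin : 0 < Real.sin t := Real.sin_pos_of_pos_of_lt_pi ht0 htp
    set y : Eu n := Real.cos t • w + Real.sin t • e with hy
    have hyn : ‖y‖ = 1 := by
      have : ‖y‖ ^ 2 = 1 := by
        rw [hy, norm_add_sq_real, norm_smul (Real.cos t), norm_smul (Real.sin t), hw, hen, inner_smul_left, inner_smul_right, hwe]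
        simp
      nlinarith [norm_nonneg y]
    have hye : ⟪y, e⟫ = Real.sin t := by
      rw [hy, inner_add_left, real_inner_smul_left, real_inner_smul_left, hwe, real_inner_self_eq_norm_sq, hen]; ring
    have hyw : ⟪y, w⟫ = Real.cos t := by
      rw [hy, inner_add_left, real_inner_smul_left, real_inner_smul_left, hwe', real_inner_self_eq_norm_sq, hw]; ring
    have hqy : q y = 1 := by
      simp only [hq, hQ]
      rw [pev_zpoly, hye, hyw]
      have : ((Real.cos t : ℝ) : ℂ) + Complex.I * ((Real.sin t : ℝ) : ℂ) = Complex.exp (t * Complex.I) := by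
        rw [Complex.exp_mul_I]; push_cast; ring
      rw [this, ← Complex.exp_nat_mul]
      have h3 : (k : ℂ) * (t * Complex.I) = ((Real.pi / 2 : ℝ) : ℂ) * Complex.I := by
        have : (k:ℝ) * t = Real.pi / 2 := by rw [ht]; field_simp
        rw [← this]; push_cast; ring
      rw [h3, Complex.exp_ofReal_mul_I_im, Real.sin_pi_div_two]
    refine ⟨Real.exp (3 / δ) • y, ?_, ?_⟩
    · change 0 < ⟪Real.exp (3 / δ) • y, v⟫
      have : v = ‖v‖ • e := by rw [he, smul_smul, mul_inv_cancel₀ hvn.ne', one_smul]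
      rw [this, real_inner_smul_left, real_inner_smul_right, hye]
      positivity
    · rw [huq, hqh, hqy, norm_smul, hyn, mul_one, Real.norm_of_nonneg (Real.exp_pos _).le, Real.log_exp, Fb,
        show δ * (3 / δ) = 3 by field_simp, eta_three]
      positivity
  refine ⟨u, hN, hne, ?_⟩
  -- laplacian
  set G : ℝ → ℝ := fun s => Real.exp (-2 * s) * (Real.exp (b * s) * (b ^ 2 * eta (δ * s) + 2 * b * δ * deriv eta (δ * s) + δ ^ 2 * deriv (deriv eta) (δ * s))
    + ((n:ℝ) + 2 * k - 2) * (Real.exp (b * s) * (b * eta (δ * s) + δ * deriv eta (δ * s)))) with hG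
  have hlap : ∀ x ∈ Hs v, lap u x = G (Real.log ‖x‖) * q x := by
    intro x hx
    have hx0 := Hs_ne_zero hx
    have hc : ContDiffAt ℝ 2 (Nf f Q) x := (Nf_contDiff hfc hf1 Q).contDiffAt
    have e1 := hc.laplacian_CLM_comp_left (l := Complex.imCLM)
    rw [lap_eq_laplacian]
    have e2 : (Δ u) x = ((Δ (Nf f Q)) x).im := e1
    have d1 : deriv f = fun s : ℝ => ((Real.exp (b * s) * (b * eta (δ * s) + δ * deriv eta (δ * s)) : ℝ) : ℂ) := by
      ext s; exact (Fb_d1 b δ s).ofReal_comp.deriv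
    have d2 : deriv (deriv f) = fun s : ℝ => ((Real.exp (b * s) * (b ^ 2 * eta (δ * s) + 2 * b * δ * deriv eta (δ * s) + δ ^ 2 * deriv (deriv eta) (δ * s)) : ℝ) : ℂ) := by
      rw [d1]; ext s; exact (Fb_d2 b δ s).ofReal_comp.deriv
    rw [e2, Nf_laplacian hfc (zpoly_hom w e k) (zpoly_harm hw hen hwe k) hx0, d2, d1, Nf]
    simp only [hq]
    rw [← Complex.im_ofReal_mul]
    congr 2
    simp only [hG]
    push_cast
    ring
  have hH := (Hs_open v).measurableSet
  have iF := (ann_real hv (hpair_navier hv hN).annF (α - 4)).1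
  have iL := (ann_real hv (hpair_navier hv hN).annL α).1
  have hden := navier_den_pos hv (α - 4) hN hne
  have eL : EqOn (fun x => ‖x‖ ^ α * (lap u x) ^ 2) (fun x => ‖x‖ ^ α * (G (Real.log ‖x‖) * q x) ^ 2) (Hs v) := by
    intro x hx; simp only [hlap x hx]
  rw [setIntegral_congr_fun hH eL]
  have iL' := iL.congr_fun eL hH
  simp only [huq] at iF hden ⊢
  rw [rad_int hn (α - 4) hqh iF] at hden
  rw [rad_int hn (α - 4) hqh iF, rad_int hn α hqh iL']
  have hA := left_ne_zero_of_mul hden.ne'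
  rw [mul_div_mul_left _ _ hA]
  have r1 : ∀ s, Real.exp ((n + (α - 4) + 2 * k) * s) * (Fb b δ s) ^ 2 = (fun t => eta t ^ 2) (δ * s) := by
    intro s
    simp only [Fb]
    rw [mul_pow, ← Real.exp_nat_mul, ← mul_assoc, ← Real.exp_add,
      show (n + (α - 4) + 2 * k) * s + ((2:ℕ):ℝ) * (b * s) = 0 by rw [hb]; push_cast; ring, Real.exp_zero, one_mul]
  have r2 : ∀ s, Real.exp ((n + α + 2 * k) * s) * (G s) ^ 2 =
      (fun s => (-(gam n α + lamj n k) * eta s + (2 - α) * δ * deriv eta s + δ ^ 2 * deriv (deriv eta) s) ^ 2) (δ * s) := by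
    intro s
    have e1 : G s = Real.exp (-2 * s) * Real.exp (b * s) * (-(gam n α + lamj n k) * eta (δ * s) + (2 - α) * δ * deriv eta (δ * s) + δ ^ 2 * deriv (deriv eta) (δ * s)) := by
      simp only [hG, hb, gam, lamj]; ring
    rw [e1, ← Real.exp_add, mul_pow, ← Real.exp_nat_mul, ← mul_assoc, ← Real.exp_add,
      show (n + α + 2 * k) * s + ((2:ℕ):ℝ) * (-2 * s + b * s) = 0 by rw [hb]; push_cast; ring, Real.exp_zero, one_mul]
  simp only [r1, r2]
  rw [Measure.integral_comp_mul_left (fun t => eta t ^ 2) δ,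
    Measure.integral_comp_mul_left (fun s => (-(gam n α + lamj n k) * eta s + (2 - α) * δ * deriv eta s + δ ^ 2 * deriv (deriv eta) s) ^ 2) δ,
    smul_eq_mul, smul_eq_mul, mul_div_mul_left _ _ (by positivity)]

end Upper2

open MeasureTheory Metric Set Filter
open scoped RealInnerProductSpace

section Final
variable {n : ℕ}

lemma eta_cont : Continuous eta := (eta_smooth 2).continuous
lemma eta_cont1 : Continuous (deriv eta) := continuous_iff_continuousAt.2 fun s => (eta_hd2 s).continuousAt
lemma eta_cont2 : Continuous (deriv (deriv eta)) := by
  have h : ContDiff ℝ 1 (deriv eta) := by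
    have := eta_smooth 2
    exact ((contDiff_succ_iff_deriv (n := 1)).1 (by exact_mod_cast this)).2.2
  exact h.continuous_deriv (by norm_num)

lemma eta_sq_pos : 0 < ∫ s, eta s ^ 2 := by
  refine Continuous.integral_pos_of_hasCompactSupport_nonneg_nonzero (x := 3) (eta_cont.pow 2) ?_ (fun s => sq_nonneg _) ?_
  · exact eta_compact.comp_left (g := fun t : ℝ => t ^ 2) (by norm_num)
  · rw [eta_three]; norm_num

lemma navier_bddBelow (v : Eu n) (α : ℝ) : BddBelow {q : ℝ | ∃ u, NavierAdm (Hs v) u ∧ (∃ x ∈ Hs v, u x ≠ 0) ∧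
    q = (∫ x in Hs v, ‖x‖ ^ α * (lap u x) ^ 2) / (∫ x in Hs v, ‖x‖ ^ (α - 4) * (u x) ^ 2)} := by
  refine ⟨0, ?_⟩
  rintro q ⟨u, -, -, rfl⟩
  exact div_nonneg (integral_nonneg fun x => by positivity) (integral_nonneg fun x => by positivity)

lemma sq_integrable_aux {f : ℝ → ℝ} (hf : Continuous f) (hc : HasCompactSupport f) :
    Integrable (fun s => f s ^ 2) := by
  have h1 : Continuous (fun s => f s ^ 2) := hf.pow 2
  have h2 : HasCompactSupport (fun s => f s ^ 2) :=
    hc.comp_left (g := fun t : ℝ => t ^ 2) (by norm_num)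
  exact h1.integrable_of_hasCompactSupport h2

set_option maxHeartbeats 1000000 in
lemma muN_upper (hn : 2 ≤ n) {v : Eu n} (hv : v ≠ 0) (α : ℝ) {k : ℕ} (hk : 1 ≤ k) :
    muN (Hs v) α ≤ (gam n α + lamj n k) ^ 2 := by
  set l := gam n α + lamj n k with hl
  set E0 := ∫ s, eta s ^ 2 with hE0
  have hE : 0 < E0 := eta_sq_pos
  have i0 : Integrable (fun s => eta s ^ 2) :=
    sq_integrable_aux eta_cont eta_compact
  have i1 : Integrable (fun s => deriv eta s ^ 2) := sq_integrable_aux eta_cont1 eta_compact.deriv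
  have i2 : Integrable (fun s => deriv (deriv eta) s ^ 2) :=
    sq_integrable_aux eta_cont2 eta_compact.deriv.deriv
  set E1 := ∫ s, deriv eta s ^ 2 with hE1
  set E2 := ∫ s, deriv (deriv eta) s ^ 2 with hE2
  have key : ∀ δ : ℝ, 0 < δ → δ ≤ 1 → muN (Hs v) α ≤ l ^ 2 + δ * (l ^ 2 + 4 * ((2 - α) ^ 2 * E1 + E2) / E0) := by
    intro δ h0 h1
    obtain ⟨u, hu, hne, hq⟩ := navier_test hn hv α hk h0 h1
    refine (csInf_le (navier_bddBelow v α) ⟨u, hu, hne, rfl⟩).trans ?_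
    rw [hq, ← hl, ← hE0, div_le_iff₀ hE]
    have hb : ∫ s, (-l * eta s + (2 - α) * δ * deriv eta s + δ ^ 2 * deriv (deriv eta) s) ^ 2 ≤
        ∫ s, ((1 + δ) * l ^ 2 * eta s ^ 2 + (4 * δ * (2 - α) ^ 2 * deriv eta s ^ 2 + 4 * δ * deriv (deriv eta) s ^ 2)) := by
      refine integral_mono_of_nonneg (Eventually.of_forall fun s => sq_nonneg _) ?_ (Eventually.of_forall fun s => ?_)
      · exact (i0.const_mul _).add ((i1.const_mul _).add (i2.const_mul _))
      · simp only
        set x := l * eta s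
        set y := (2 - α) * deriv eta s with hy
        set z := deriv (deriv eta) s
        have a1 : (-l * eta s + (2 - α) * δ * deriv eta s + δ ^ 2 * z) = -x + δ * (y + δ * z) := by ring
        have a2 : (1 + δ) * l ^ 2 * eta s ^ 2 + (4 * δ * (2 - α) ^ 2 * deriv eta s ^ 2 + 4 * δ * z ^ 2) =
          (1 + δ) * x ^ 2 + 4 * δ * (y ^ 2 + z ^ 2) := by ring
        rw [a1, a2]
        have a3 : (y + δ * z) ^ 2 ≤ 2 * (y ^ 2 + z ^ 2) := by
          have : δ ^ 2 * z ^ 2 ≤ 1 * z ^ 2 := by gcongr; nlinarith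
          nlinarith [sq_nonneg (y - δ * z)]
        have a4 : (-x + δ * (y + δ * z)) ^ 2 ≤ (1 + δ) * x ^ 2 + (δ + δ ^ 2) * (y + δ * z) ^ 2 := by
          nlinarith [mul_nonneg h0.le (sq_nonneg (x + (y + δ * z)))]
        have a5 : (δ + δ ^ 2) * (y + δ * z) ^ 2 ≤ (2 * δ) * (2 * (y ^ 2 + z ^ 2)) := by
          gcongr; nlinarith
        linarith
    refine hb.trans (le_of_eq ?_)
    have i3 : Integrable (fun s => 4 * δ * (2 - α) ^ 2 * deriv eta s ^ 2 + 4 * δ * deriv (deriv eta) s ^ 2) :=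
      (i1.const_mul _).add (i2.const_mul _)
    rw [integral_add (i0.const_mul _) i3,
      integral_add (i1.const_mul _) (i2.const_mul _), integral_const_mul, integral_const_mul, integral_const_mul]
    rw [← hE0, ← hE1, ← hE2]
    field_simp
    ring
  have ht : Tendsto (fun δ : ℝ => l ^ 2 + δ * (l ^ 2 + 4 * ((2 - α) ^ 2 * E1 + E2) / E0)) (nhdsWithin 0 (Ioi 0)) (nhds (l ^ 2)) := by
    have : Continuous (fun δ : ℝ => l ^ 2 + δ * (l ^ 2 + 4 * ((2 - α) ^ 2 * E1 + E2) / E0)) := by fun_prop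
    have h2 := this.tendsto 0
    simp only [zero_mul, add_zero] at h2
    exact h2.mono_left nhdsWithin_le_nhds
  refine ge_of_tendsto ht ?_
  filter_upwards [Ioc_mem_nhdsGT (zero_lt_one (α := ℝ))] with δ hδ using key δ hδ.1 hδ.2

lemma exists_min (hn : 2 ≤ n) (α : ℝ) : ∃ k : ℕ, 1 ≤ k ∧ ∀ j : ℕ, 1 ≤ j →
    (gam n α + lamj n k) ^ 2 ≤ (gam n α + lamj n j) ^ 2 := by
  have ht : Tendsto (fun j : ℕ => (gam n α + lamj n (j + 1)) ^ 2) (cofinite) atTop := by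
    rw [Nat.cofinite_eq_atTop]
    have h1 : Tendsto (fun j : ℕ => gam n α + lamj n (j + 1)) atTop atTop := by
      refine tendsto_atTop_add_const_left _ _ (tendsto_atTop_mono (fun j => ?_) tendsto_natCast_atTop_atTop)
      have := lamj_ge hn (j + 1)
      push_cast at this
      have h3 : (0:ℝ) ≤ j := by positivity
      nlinarith
    exact (tendsto_pow_atTop (by norm_num)).comp h1
  obtain ⟨k, hk⟩ := ht.exists_forall_le
  refine ⟨k + 1, by omega, fun j hj => ?_⟩
  have := hk (j - 1)
  rwa [Nat.sub_add_cancel hj] at this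

lemma dir_nonempty {v : Eu n} (hv : v ≠ 0) : ∃ u, DirichletAdm (Hs v) u ∧ ∃ x ∈ Hs v, u x ≠ 0 := by
  have hvH : v ∈ Hs v := by
    change 0 < ⟪v, v⟫
    rw [real_inner_self_eq_norm_sq]
    have := norm_pos_iff.2 hv
    positivity
  obtain ⟨r, hr, hb⟩ := Metric.isOpen_iff.1 (Hs_open v) v hvH
  let f : ContDiffBump v := ⟨r / 4, r / 2, by positivity, by linarith⟩
  refine ⟨f, ⟨f.contDiff, f.hasCompactSupport, ?_⟩, v, hvH, ?_⟩
  · rw [f.tsupport_eq]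
    exact (closedBall_subset_ball (by change r / 2 < r; linarith)).trans hb
  · rw [f.one_of_mem_closedBall (mem_closedBall_self f.rIn_pos.le)]; norm_num

lemma final_aux (hn : 2 ≤ n) (α : ℝ) {v : Eu n} (hv : v ≠ 0) :
    IsLeast {val : ℝ | ∃ k : ℕ, 1 ≤ k ∧ val = (gam n α + (k : ℝ) * ((n : ℝ) - 2 + (k : ℝ))) ^ 2}
      (muN (Hs v) α) ∧ muN (Hs v) α < muD (Hs v) α := by
  obtain ⟨k, hk, hmin⟩ := exists_min hn α
  have hlow : ∀ u, NavierAdm (Hs v) u → (∃ x ∈ Hs v, u x ≠ 0) → (gam n α + lamj n k) ^ 2 ≤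
      (∫ x in Hs v, ‖x‖ ^ α * (lap u x) ^ 2) / (∫ x in Hs v, ‖x‖ ^ (α - 4) * (u x) ^ 2) := by
    intro u hu hne
    rw [le_div_iff₀ (navier_den_pos hv (α - 4) hu hne)]
    exact navier_lower hv hn α (sq_nonneg _) hmin hu
  have heq : muN (Hs v) α = (gam n α + lamj n k) ^ 2 := by
    refine le_antisymm (muN_upper hn hv α hk) ?_
    refine le_csInf ?_ ?_
    · obtain ⟨u, hu, hne, -⟩ := navier_test hn hv α hk one_pos le_rfl
      exact ⟨_, u, hu, hne, rfl⟩
    · rintro q ⟨u, hu, hne, rfl⟩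
      exact hlow u hu hne
  refine ⟨⟨⟨k, hk, heq⟩, ?_⟩, ?_⟩
  · rintro q ⟨j, hj, rfl⟩
    rw [heq]
    exact hmin j hj
  · obtain ⟨ε, hε, h⟩ := dir_lower hv hn α (sq_nonneg _) hmin ⟨k, hk, rfl⟩
    rw [heq]
    refine lt_of_lt_of_le (lt_add_of_pos_right _ hε) ?_
    refine le_csInf ?_ ?_
    · obtain ⟨u, hu, hne⟩ := dir_nonempty hv
      exact ⟨_, u, hu, hne, rfl⟩
    · rintro q ⟨u, hu, hne, rfl⟩
      rw [le_div_iff₀ (navier_den_pos hv (α - 4) (dir_navier hv hu) hne)]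
      exact h u hu
end Final

noncomputable section

/-- on a homogeneous half-space,
`μ_D(ℝⁿ₊;α) > μ_N(ℝⁿ₊;α) = min_{k ≥ 1} |γ_{n,α} + k(n-2+k)|²`. -/
theorem rellich_half_space {n : ℕ} (hn : 2 ≤ n) (α : ℝ)
    (v : EuclideanSpace ℝ (Fin n)) (hv : v ≠ 0) :
    IsLeast
      {val : ℝ | ∃ k : ℕ, 1 ≤ k ∧ val = (gam n α + (k : ℝ) * ((n : ℝ) - 2 + (k : ℝ))) ^ 2}
      (muN {x : EuclideanSpace ℝ (Fin n) | 0 < ⟪x, v⟫} α) ∧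
    muN {x : EuclideanSpace ℝ (Fin n) | 0 < ⟪x, v⟫} α <
      muD {x : EuclideanSpace ℝ (Fin n) | 0 < ⟪x, v⟫} α := by
  exact final_aux hn α hv

end
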